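/- Let t ≥ 1 be an integer and define u₀ = 0, u₁ = 1, u_{n+2} = t·u_{n+1} + u_n. If t ≠ 2, then for every odd index j ≥ 1, u_j is a perfect square only if j = 1. If t = 2, then for odd j ≥ 1, u_j is a perfect square if and only if j = 1 or j = 7. -/

import Mathlib

section

def LU (t : ℤ) : ℕ → ℤ
  | 0 => 0
  | 1 => 1
  | n + 2 => t * LU t (n + 1) + LU t n

def LV (t : ℤ) : ℕ → ℤ
  | 0 => 2
  | 1 => t
  | n + 2 => t * LV t (n + 1) + LV t n

theorem LU_succ (t : ℤ) (n : ℕ) : LU t (n + 2) = t * LU t (n + 1) + LU t n := rfl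
theorem LV_succ (t : ℤ) (n : ℕ) : LV t (n + 2) = t * LV t (n + 1) + LV t n := rfl

theorem LU_unique (t : ℤ) (u : ℕ → ℤ) (hu0 : u 0 = 0) (hu1 : u 1 = 1)
    (hu : ∀ n, u (n + 2) = t * u (n + 1) + u n) (n : ℕ) : u n = LU t n := by
  induction n using Nat.strong_induction_on with
  | _ n ih =>
    match n, ih with
    | 0, _ => simpa [LU] using hu0
    | 1, _ => simpa [LU] using hu1
    | n + 2, ih => rw [hu, LU_succ, ih (n + 1) (by omega), ih n (by omega)]

theorem LU_add (t : ℤ) (m n : ℕ) :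
    LU t (m + n + 1) = LU t (m + 1) * LU t (n + 1) + LU t m * LU t n := by
  induction n using Nat.twoStepInduction with
  | zero => simp [LU]
  | one => simp only [LU, LU_succ]; ring
  | more n ih1 ih2 =>
    have : m + (n + 2) + 1 = (m + n + 1) + 2 := by ring
    rw [this, LU_succ, ih1, show m + n + 1 + 1 = m + (n + 1) + 1 by ring, ih2]
    rw [show n + 2 + 1 = (n + 1) + 2 by ring, LU_succ t (n + 1), LU_succ t n]; ring

theorem LV_eq (t : ℤ) (n : ℕ) : LV t n = 2 * LU t (n + 1) - t * LU t n := by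
  induction n using Nat.twoStepInduction with
  | zero => simp [LU, LV]
  | one => simp [LU, LV]; ring
  | more n ih1 ih2 =>
    rw [LV_succ, ih1, ih2, show n + 2 + 1 = (n + 1) + 2 by ring, LU_succ t (n + 1), LU_succ t n]
    ring

theorem LU_cassini (t : ℤ) (n : ℕ) :
    LU t (n + 1) ^ 2 - t * LU t (n + 1) * LU t n - LU t n ^ 2 = (-1) ^ n := by
  induction n with
  | zero => simp [LU]
  | succ n ih => rw [LU_succ, pow_succ (-1 : ℤ), ← ih]; ring

theorem LU_add_two_mul (t : ℤ) (m k : ℕ) :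
    LU t (m + 2 * k) + (-1) ^ k * LU t m = LV t k * LU t (m + k) := by
  rw [LV_eq, ← LU_cassini t k]
  have key : ∀ m k, LU t (m + 1 + k) = LU t (m + 1) * LU t (k + 1) + LU t m * LU t k := by
    intro m k
    rw [← LU_add]; ring_nf
  induction m using Nat.twoStepInduction with
  | zero =>
    rcases k with _ | k
    · simp [LU]
    · have := LU_add t k (k + 1)
      rw [show k + (k + 1) + 1 = 2 * (k + 1) by ring] at this
      simp only [zero_add, this, LU, LU_succ]; ring
  | one =>
    have := LU_add t k k
    rw [show k + k + 1 = 1 + 2 * k by ring] at this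
    rw [this, show 1 + k = k + 1 by ring]
    simp only [LU]; ring
  | more m ih1 ih2 =>
    rw [show m + 2 + 2 * k = (m + 2 * k) + 2 by ring, show m + 2 + k = (m + k) + 2 by ring,
      LU_succ, LU_succ, LU_succ]
    rw [show m + 1 + 2 * k = (m + 2 * k) + 1 by ring, show m + 1 + k = (m + k) + 1 by ring] at ih2
    linear_combination t * ih2 + ih1

theorem LV_dvd_shift (t : ℤ) (m k : ℕ) (hk : Even k) (w : ℕ) :
    LV t k ∣ LU t (m + 2 * k * w) - (-1) ^ w * LU t m := by
  induction w with
  | zero => simp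
  | succ w ih =>
    have h := LU_add_two_mul t (m + 2 * k * w) k
    rw [hk.neg_one_pow, one_mul] at h
    rw [show m + 2 * k * (w + 1) = m + 2 * k * w + 2 * k by ring]
    obtain ⟨c, hc⟩ := ih
    refine ⟨LU t (m + 2 * k * w + k) - c, ?_⟩
    rw [pow_succ]
    linear_combination h - hc

theorem LV_mod (t : ℤ) (ht : t % 2 = 1) (n : ℕ) :
    LV t (6 * n + 2) % 4 = 3 ∧ LV t (6 * n + 4) % 4 = 3 := by
  have h4 : t % 4 = 1 ∨ t % 4 = 3 := by omega
  have key : ∀ n, LV t (6 * n) % 4 = 2 ∧ LV t (6 * n + 1) % 4 = t % 4 := by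
    intro n
    induction n with
    | zero => simp [LV]
    | succ n ih =>
      rw [show 6 * (n + 1) = 6 * n + 6 by ring, show 6 * n + 6 + 1 = 6 * n + 7 by ring]
      obtain ⟨h0, h1⟩ := ih
      simp only [LV_succ]
      rcases h4 with h | h <;> rw [h] at h1 ⊢ <;>
        simp [Int.add_emod, Int.mul_emod, h, h0, h1]
  obtain ⟨h0, h1⟩ := key n
  simp only [LV_succ]
  rcases h4 with h | h <;> rw [h] at h1 <;>
    simp [Int.add_emod, Int.mul_emod, h, h0, h1]

theorem two_pow_mod6 (e : ℕ) : ∃ n, 2 ^ (e + 1) = 6 * n + 2 ∨ 2 ^ (e + 1) = 6 * n + 4 := by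
  induction e with
  | zero => exact ⟨0, by simp⟩
  | succ e ih =>
    obtain ⟨n, h | h⟩ := ih
    · exact ⟨2 * n, by right; rw [pow_succ, h]; ring⟩
    · exact ⟨2 * n + 1, by left; rw [pow_succ, h]; ring⟩

theorem not_dvd_sq_add_one (v y : ℤ) (hv : v % 4 = 3) (hp : 0 < v) : ¬ v ∣ y ^ 2 + 1 := by
  intro h
  lift v to ℕ using hp.le
  have hsq : IsSquare (-1 : ZMod v) := by
    have : ((y ^ 2 + 1 : ℤ) : ZMod v) = 0 := (ZMod.intCast_zmod_eq_zero_iff_dvd _ _).2 h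
    push_cast at this
    exact ⟨y, by linear_combination -this⟩
  have h2 : ¬ (v % 4 = 3) := by
    have hv0 : v ≠ 0 := by omega
    obtain ⟨a, b, rfl⟩ := Nat.eq_sq_add_sq_of_isSquare_mod_neg_one hsq
    rcases (by omega : a % 4 = 0 ∨ a % 4 = 1 ∨ a % 4 = 2 ∨ a % 4 = 3) with h | h | h | h <;>
    rcases (by omega : b % 4 = 0 ∨ b % 4 = 1 ∨ b % 4 = 2 ∨ b % 4 = 3) with h' | h' | h' | h' <;>
    simp [Nat.add_mod, Nat.pow_mod, h, h']
  omega

theorem M1_main (t : ℤ) (ht : 1 ≤ t) (hodd : t % 2 = 1) (j : ℕ) (hj : j % 2 = 1) (x : ℤ)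
    (hx : LU t j = x ^ 2) : j = 1 := by
  by_contra hne
  have hVpos : ∀ n, 0 < LV t n := by
    intro n
    induction n using Nat.twoStepInduction with
    | zero => simp [LV]
    | one => simp [LV]; omega
    | more n h1 h2 => rw [LV_succ]; positivity
  obtain ⟨q, hq0, hq⟩ : ∃ q, q ≠ 0 ∧ (j = 4 * q + 1 ∨ j + 1 = 4 * q) := by
    rcases (by omega : j % 4 = 1 ∨ j % 4 = 3) with h | h
    · exact ⟨j / 4, by omega, by omega⟩
    · exact ⟨j / 4 + 1, by omega, by omega⟩
  obtain ⟨e, w, hw, rfl⟩ := Nat.exists_eq_two_pow_mul_odd hq0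
  set k := 2 ^ (e + 1) with hk
  have hkev : Even k := ⟨2 ^ e, by rw [hk, pow_succ]; ring⟩
  have hV : LV t k % 4 = 3 := by
    obtain ⟨n, h | h⟩ := two_pow_mod6 e
    · rw [hk, h]; exact (LV_mod t hodd n).1
    · rw [hk, h]; exact (LV_mod t hodd n).2
  apply not_dvd_sq_add_one (LV t k) x hV (hVpos k)
  rw [← hx]
  have e4 : 4 * (2 ^ e * w) = 2 * k * w := by rw [hk, pow_succ]; ring
  rw [e4] at hq
  rcases hq with rfl | h
  · have := LV_dvd_shift t 1 k hkev w
    rw [hw.neg_one_pow] at this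
    simpa [LU, add_comm] using this
  · obtain ⟨c, rfl⟩ := hw
    have hkpos : 1 ≤ k := Nat.one_le_two_pow
    have h1 := LV_dvd_shift t (2 * k - 1) k hkev (2 * c)
    have hj : j = 2 * k - 1 + 2 * k * (2 * c) := by
      have : 2 * k * (2 * c + 1) = 2 * k * (2 * c) + 2 * k := by ring
      omega
    rw [← hj] at h1
    have h2 : LV t k ∣ LU t (2 * k - 1) + 1 := by
      obtain ⟨k', hk'⟩ : ∃ k', k = k' + 1 := ⟨k - 1, by omega⟩
      have h3 := LU_add_two_mul t 1 k
      have h4 := LU_add_two_mul t 0 k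
      have h5 : LU t (1 + 2 * k) = t * LU t (2 * k) + LU t (2 * k - 1) := by
        rw [show 1 + 2 * k = (2 * k - 1) + 2 by omega, LU_succ]
        congr 3; omega
      rw [hkev.neg_one_pow] at h3 h4
      simp only [LU, zero_add] at h3 h4
      exact ⟨LU t (1 + k) - t * LU t k, by rw [h5] at h3; linear_combination h3 - t * h4⟩
    have : Even (2 * c) := ⟨c, by ring⟩
    rw [this.neg_one_pow, one_mul] at h1
    have h6 := dvd_add h1 h2
    rwa [show LU t j - LU t (2 * k - 1) + (LU t (2 * k - 1) + 1) = LU t j + 1 by ring] at h6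

end

section

def QF (s a b : ℤ) : ℤ := a ^ 4 - 4 * s * a ^ 3 * b - 6 * a ^ 2 * b ^ 2 + 4 * s * a * b ^ 3 + b ^ 4

theorem QF_eq_one (s a b : ℤ) (hpar : a % 2 = 0 ∧ b % 2 = 1 ∨ a % 2 = 1 ∧ b % 2 = 0)
    (h : QF s a b = 1 ∨ QF s a b = -1) : QF s a b = 1 := by
  rcases h with h | h
  · exact h
  exfalso
  have : ∃ c, QF s a b = 4 * c + 1 := by
    rcases hpar with ⟨h1, h2⟩ | ⟨h1, h2⟩
    · obtain ⟨p, rfl⟩ : ∃ p, a = 2 * p := ⟨a / 2, by omega⟩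
      obtain ⟨q, rfl⟩ : ∃ q, b = 2 * q + 1 := ⟨b / 2, by omega⟩
      refine ⟨?_, ?_⟩
      swap
      · unfold QF
        have : (2 * q + 1) ^ 4 = 4 * (4 * q ^ 4 + 8 * q ^ 3 + 6 * q ^ 2 + 2 * q) + 1 := by ring
        rw [this]
        have e : (2 * p) ^ 4 - 4 * s * (2 * p) ^ 3 * (2 * q + 1) - 6 * (2 * p) ^ 2 * (2 * q + 1) ^ 2 +
          4 * s * (2 * p) * (2 * q + 1) ^ 3 + (4 * (4 * q ^ 4 + 8 * q ^ 3 + 6 * q ^ 2 + 2 * q) + 1)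
          = 4 * (4 * p ^ 4 - s * (2 * p) ^ 3 * (2 * q + 1) - 6 * p ^ 2 * (2 * q + 1) ^ 2 +
          s * (2 * p) * (2 * q + 1) ^ 3 + (4 * q ^ 4 + 8 * q ^ 3 + 6 * q ^ 2 + 2 * q)) + 1 := by ring
        exact e
    · obtain ⟨p, rfl⟩ : ∃ p, b = 2 * p := ⟨b / 2, by omega⟩
      obtain ⟨q, rfl⟩ : ∃ q, a = 2 * q + 1 := ⟨a / 2, by omega⟩
      refine ⟨4 * p ^ 4 + s * (2 * p) ^ 3 * (2 * q + 1) - 6 * p ^ 2 * (2 * q + 1) ^ 2 -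
          s * (2 * p) * (2 * q + 1) ^ 3 + (4 * q ^ 4 + 8 * q ^ 3 + 6 * q ^ 2 + 2 * q), ?_⟩
      unfold QF; ring
  obtain ⟨c, hc⟩ := this
  omega

theorem M2_main (s : ℤ) (n : ℕ) (hn : n % 2 = 1) (x : ℤ) (hx : LU (2 * s) n = x ^ 2) :
    ∃ a b : ℤ, QF s a b = 1 ∧ (a ^ 2 + b ^ 2) ^ 2 = LU (2 * s) n := by
  obtain ⟨m, rfl⟩ : ∃ m, n = m + m + 1 := ⟨n / 2, by omega⟩
  have hadd := LU_add (2 * s) m m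
  have hc := LU_cassini (2 * s) m
  set p := LU (2 * s) (m + 1)
  set q := LU (2 * s) m
  have hpy : PythagoreanTriple p q x := by
    unfold PythagoreanTriple
    linear_combination hx - hadd
  have hpm : (-1 : ℤ) ^ m = 1 ∨ (-1 : ℤ) ^ m = -1 := neg_one_pow_eq_or ℤ m
  have hgcd : Int.gcd p q = 1 := by
    rw [← Int.isCoprime_iff_gcd_eq_one]
    rcases hpm with h | h <;> rw [h] at hc
    · exact ⟨p - 2 * s * q, -q, by linear_combination hc⟩
    · exact ⟨-(p - 2 * s * q), q, by linear_combination -hc⟩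
  obtain ⟨a, b, hab, hz, -, hpar⟩ := PythagoreanTriple.coprime_classification.1 ⟨hpy, hgcd⟩
  have hz2 : (a ^ 2 + b ^ 2) ^ 2 = LU (2 * s) (m + m + 1) := by
    rw [hx]; rcases hz with rfl | rfl <;> ring
  rcases hab with ⟨h1, h2⟩ | ⟨h1, h2⟩
  · refine ⟨a, b, QF_eq_one s a b hpar ?_, hz2⟩
    have : QF s a b = (-1) ^ m := by
      rw [← hc, h1, h2]; unfold QF; ring
    rw [this]; exact hpm
  · refine ⟨a, -b, QF_eq_one s a (-b) (by omega) ?_, by rw [← hz2]; ring⟩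
    have : QF s a (-b) = -(-1) ^ m := by
      rw [← hc, h1, h2]; unfold QF; ring
    rw [this]
    rcases hpm with h | h <;> rw [h] <;> simp

end

section
open Finset

theorem h3_sum_id (r : ℕ) : ∀ c : ℂ, (∀ l : ℕ, c + l ≠ 0) →
    ∑ k ∈ range (r + 1), (r.choose k : ℂ) * ((-1) ^ k / (c + k)) =
      r.factorial / ∏ l ∈ range (r + 1), (c + l) := by
  induction r with
  | zero => intro c hc; simp
  | succ r ih =>
    intro c hc
    have h1 := Finset.sum_choose_succ_mul (fun i _ => (-1 : ℂ) ^ i / (c + i)) r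
    have hc' : ∀ l : ℕ, (c + 1) + l ≠ 0 := by
      intro l
      have := hc (l + 1)
      push_cast at this
      rwa [show c + 1 + (l : ℂ) = c + (l + 1) by ring]
    have h2 := ih c hc
    have h3 := ih (c + 1) hc'
    rw [h1]
    have h4 : ∑ i ∈ range (r + 1), (r.choose i : ℂ) * ((-1) ^ (i + 1) / (c + ((i + 1 : ℕ) : ℂ))) =
        - (r.factorial / ∏ l ∈ range (r + 1), (c + 1 + l)) := by
      rw [← h3, ← Finset.sum_neg_distrib]
      refine Finset.sum_congr rfl fun i _ => ?_
      push_cast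
      rw [show c + ((i : ℂ) + 1) = c + 1 + i by ring]; ring
    rw [h2, h4]
    have e1 : ∏ l ∈ range (r + 1 + 1), (c + (l : ℂ)) = (∏ l ∈ range (r + 1), (c + l)) * (c + (r + 1)) := by
      rw [Finset.prod_range_succ]; push_cast; ring
    have e2 : ∏ l ∈ range (r + 1 + 1), (c + (l : ℂ)) = (∏ l ∈ range (r + 1), (c + 1 + l)) * c := by
      rw [Finset.prod_range_succ']
      congr 1
      · refine Finset.prod_congr rfl fun i _ => ?_
        push_cast; ring
      · simp
    have n1 : (∏ l ∈ range (r + 1), (c + (l : ℂ))) ≠ 0 := Finset.prod_ne_zero_iff.2 fun i _ => hc i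
    have n2 : (∏ l ∈ range (r + 1), (c + 1 + (l : ℂ))) ≠ 0 := Finset.prod_ne_zero_iff.2 fun i _ => hc' i
    have n0 : c ≠ 0 := by simpa using hc 0
    have n3 : c + (r + 1) ≠ 0 := by simpa using hc (r + 1)
    have n4 : (∏ l ∈ range (r + 1 + 1), (c + (l : ℂ))) ≠ 0 := by rw [e1]; exact mul_ne_zero n1 n3
    have f1 : (r.factorial : ℂ) / ∏ l ∈ range (r + 1), (c + l) =
        r.factorial * (c + (r + 1)) / ∏ l ∈ range (r + 1 + 1), (c + l) := by
      rw [e1]; field_simp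
    have f2 : (r.factorial : ℂ) / ∏ l ∈ range (r + 1), (c + 1 + l) =
        r.factorial * c / ∏ l ∈ range (r + 1 + 1), (c + l) := by
      rw [e2]; field_simp
    rw [f1, f2, Nat.factorial_succ]
    push_cast
    ring

/-- products `5·9·13⋯` and `3·7·11⋯` -/
def h3p (n : ℕ) : ℕ := ∏ m ∈ range n, (4 * m + 5)
def h3n (n : ℕ) : ℕ := ∏ m ∈ range n, (4 * m + 3)

theorem h3p_pos (n : ℕ) : 0 < h3p n := Finset.prod_pos fun _ _ => by positivity
theorem h3n_pos (n : ℕ) : 0 < h3n n := Finset.prod_pos fun _ _ => by positivity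

theorem h3_prod1 (k : ℕ) : ∏ l ∈ range k, (-(k : ℂ) + 1 / 4 + l) = (-1) ^ k * h3n k / 4 ^ k := by
  induction k with
  | zero => simp [h3n]
  | succ k ih =>
    rw [Finset.prod_range_succ']
    have : ∏ l ∈ range k, (-((k + 1 : ℕ) : ℂ) + 1 / 4 + ((l + 1 : ℕ) : ℂ)) =
        ∏ l ∈ range k, (-(k : ℂ) + 1 / 4 + l) := by
      refine Finset.prod_congr rfl fun i _ => ?_
      push_cast; ring
    rw [this, ih, h3n, h3n, Finset.prod_range_succ]
    push_cast
    field_simp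
    ring

theorem h3_prod2 (j : ℕ) : ∏ l ∈ range (1 + j), ((1 : ℂ) / 4 + l) = h3p j / 4 ^ (j + 1) := by
  induction j with
  | zero => simp [h3p]
  | succ j ih =>
    rw [← add_assoc, Finset.prod_range_succ, ih, h3p, h3p, Finset.prod_range_succ]
    push_cast
    field_simp
    ring

theorem h3_prod (k j : ℕ) :
    ∏ l ∈ range (k + j + 1), (-(k : ℂ) + 1 / 4 + l) = (-1) ^ k * h3n k * h3p j / 4 ^ (k + j + 1) := by
  rw [show k + j + 1 = k + (1 + j) by ring, Finset.prod_range_add, h3_prod1]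
  have : ∏ x ∈ range (1 + j), (-(k : ℂ) + 1 / 4 + ((k + x : ℕ) : ℂ)) =
      ∏ l ∈ range (1 + j), ((1 : ℂ) / 4 + l) := by
    refine Finset.prod_congr rfl fun i _ => ?_
    push_cast; ring
  rw [this, h3_prod2]
  rw [show k + (1 + j) = k + (j + 1) by ring, pow_add (4 : ℂ) k]
  field_simp

theorem quarter_ne (k : ℤ) : (k : ℂ) + 1 / 4 ≠ 0 := by
  intro h
  have h2 : ((4 * k + 1 : ℤ) : ℂ) = 0 := by push_cast; linear_combination 4 * h
  have h3 : 4 * k + 1 = 0 := by exact_mod_cast h2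
  omega

/-- Factorial divisibility. -/
theorem h3_fact_dvd (n c : ℕ) : n.factorial ∣ 2 ^ n * ∏ i ∈ range n, (4 * i + c) := by
  obtain ⟨e, o, ho, hfac⟩ := Nat.exists_eq_two_pow_mul_odd (Nat.factorial_ne_zero n)
  have he : e ≤ n := by
    rcases Nat.eq_zero_or_pos n with rfl | hn
    · rcases e with _ | e
      · simp
      · exfalso
        have h2 : 2 ∣ Nat.factorial 0 := by rw [hfac, pow_succ]; exact ⟨2 ^ e * o, by ring⟩
        simp at h2
    have h1 : emultiplicity 2 n.factorial < n := Nat.emultiplicity_two_factorial_lt hn.ne'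
    by_contra hcon
    have h2 : 2 ^ n ∣ n.factorial := by
      rw [hfac]
      exact Dvd.dvd.mul_right (pow_dvd_pow 2 (by omega)) _
    have h3 := le_emultiplicity_of_pow_dvd h2
    exact absurd h1 (not_lt.2 h3)
  have hcop : Nat.Coprime 4 o := by
    have : Nat.Coprime 2 o := (Nat.coprime_two_left).2 ho
    exact Nat.Coprime.pow_left 2 this
  have hodvd : o ∣ ∏ i ∈ range n, (4 * i + c) := by
    rw [← ZMod.natCast_eq_zero_iff]
    let u := ZMod.unitOfCoprime 4 hcop
    have hu : (u : ZMod o) = 4 := by simp [u]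
    obtain ⟨b, hb⟩ : ∃ b : ℕ, (4 : ZMod o) * b = 1 := by
      have : NeZero o := ⟨fun h => by rw [h] at ho; simp at ho⟩
      refine ⟨((u⁻¹ : (ZMod o)ˣ) : ZMod o).val, ?_⟩
      rw [ZMod.natCast_zmod_val, ← hu]; simp
    have h1 : n.factorial ∣ ∏ i ∈ range n, (b * c + i) := by
      have := Nat.factorial_dvd_ascFactorial (b * c) n
      rwa [Nat.ascFactorial_eq_prod_range] at this
    have h2 : o ∣ ∏ i ∈ range n, (b * c + i) := (Dvd.intro_left _ hfac.symm).trans h1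
    rw [← ZMod.natCast_eq_zero_iff] at h2
    have h3 : ((∏ i ∈ range n, (4 * i + c) : ℕ) : ZMod o) =
        4 ^ n * ((∏ i ∈ range n, (b * c + i) : ℕ) : ZMod o) := by
      push_cast
      rw [show (4 : ZMod o) ^ n = ∏ i ∈ range n, 4 by simp, ← Finset.prod_mul_distrib]
      refine Finset.prod_congr rfl fun i _ => ?_
      linear_combination (-(c : ZMod o)) * hb
    rw [h3, h2, mul_zero]
  rw [hfac]
  exact mul_dvd_mul (pow_dvd_pow 2 he) hodvd

theorem h3p_split (j k : ℕ) : h3p (j + k) = h3p j * ∏ i ∈ range k, (4 * i + (4 * j + 5)) := by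
  unfold h3p
  rw [Finset.prod_range_add]
  congr 1
  exact Finset.prod_congr rfl fun i _ => by ring

theorem h3n_split (j k : ℕ) : h3n (j + k) = h3n j * ∏ i ∈ range k, (4 * i + (4 * j + 3)) := by
  unfold h3n
  rw [Finset.prod_range_add]
  congr 1
  exact Finset.prod_congr rfl fun i _ => by ring

theorem h3_prod_le (k c m : ℕ) (h : c ≤ 4 * (m + 1)) : ∏ i ∈ range k, (4 * i + c) ≤
    4 ^ k * (k.factorial * (m + k).choose k) := by
  rw [← Nat.ascFactorial_eq_factorial_mul_choose, Nat.ascFactorial_eq_prod_range]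
  calc _ ≤ ∏ i ∈ range k, 4 * (m + 1 + i) := Finset.prod_le_prod' fun i _ => by omega
    _ = _ := by rw [Finset.prod_mul_distrib]; simp

theorem h3_coef (j k : ℕ) : ∃ a : ℕ,
    a * (j.factorial * k.factorial * (h3p j * h3n k)) = 2 ^ (j + k) * (h3p (j + k) * h3n (j + k)) ∧
    a ≤ 2 ^ (j + k) * 4 ^ (j + k) * (2 ^ (j + k + 1) * (j + k).choose j) := by
  obtain ⟨x, hx⟩ := h3_fact_dvd k (4 * j + 5)
  obtain ⟨y, hy⟩ := h3_fact_dvd j (4 * k + 3)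
  refine ⟨x * y, ?_, ?_⟩
  · rw [h3p_split, add_comm j k, h3n_split]
    calc _ = (k.factorial * x) * (j.factorial * y) * (h3p j * h3n k) := by ring
      _ = _ := by rw [← hx, ← hy]; ring
  · have hx1 := h3_prod_le k (4 * j + 5) (j + 1) (by omega)
    have hy1 := h3_prod_le j (4 * k + 3) k (by omega)
    have hx2 : x ≤ 2 ^ k * 4 ^ k * 2 ^ (j + k + 1) := by
      have h1 : k.factorial * x ≤ k.factorial * (2 ^ k * 4 ^ k * 2 ^ (j + k + 1)) := by
        rw [← hx]
        calc _ ≤ 2 ^ k * (4 ^ k * (k.factorial * (j + 1 + k).choose k)) := by gcongr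
          _ ≤ 2 ^ k * (4 ^ k * (k.factorial * 2 ^ (j + 1 + k))) := by
            gcongr; exact Nat.choose_le_two_pow _ _
          _ = _ := by rw [show j + 1 + k = j + k + 1 by ring]; ring
      exact Nat.le_of_mul_le_mul_left h1 (Nat.factorial_pos k)
    have hy2 : y ≤ 2 ^ j * 4 ^ j * (j + k).choose j := by
      have h1 : j.factorial * y ≤ j.factorial * (2 ^ j * 4 ^ j * (j + k).choose j) := by
        rw [← hy]
        calc _ ≤ 2 ^ j * (4 ^ j * (j.factorial * (k + j).choose j)) := by gcongr
          _ = _ := by rw [add_comm k j]; ring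
      exact Nat.le_of_mul_le_mul_left h1 (Nat.factorial_pos j)
    calc x * y ≤ (2 ^ k * 4 ^ k * 2 ^ (j + k + 1)) * (2 ^ j * 4 ^ j * (j + k).choose j) := by gcongr
      _ = _ := by ring

end

section
open Finset

noncomputable def h3D (r : ℕ) : ℝ := 2 ^ r * (h3p r * h3n r) / (4 ^ (r + 1) * (r.factorial : ℝ) ^ 2)

theorem h3D_succ (r : ℕ) : h3D (r + 1) = h3D r * (8 * (1 - 1 / (16 * ((r : ℝ) + 1) ^ 2))) := by
  unfold h3D h3p h3n
  rw [Finset.prod_range_succ, Finset.prod_range_succ, Nat.factorial_succ]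
  push_cast
  have : (r.factorial : ℝ) ≠ 0 := by exact_mod_cast r.factorial_ne_zero
  have h2 : (r : ℝ) + 1 ≠ 0 := by positivity
  field_simp
  ring

theorem h3D_zero : h3D 0 = 1 / 4 := by simp [h3D, h3p, h3n]

theorem h3D_bounds (r : ℕ) : (1 / 4) * (15 / 2) ^ r ≤ h3D r ∧ h3D r ≤ (1 / 4) * 8 ^ r := by
  induction r with
  | zero => simp [h3D_zero]
  | succ r ih =>
    have h1 : (15 : ℝ) / 2 ≤ 8 * (1 - 1 / (16 * ((r : ℝ) + 1) ^ 2)) := by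
      have : 1 / (16 * ((r : ℝ) + 1) ^ 2) ≤ 1 / 16 := by
        apply one_div_le_one_div_of_le (by norm_num)
        nlinarith [(Nat.cast_nonneg r : (0 : ℝ) ≤ r)]
      linarith
    have h2 : 8 * (1 - 1 / (16 * ((r : ℝ) + 1) ^ 2)) ≤ 8 := by
      have : 0 ≤ 1 / (16 * ((r : ℝ) + 1) ^ 2) := by positivity
      linarith
    rw [h3D_succ, pow_succ, pow_succ]
    have h0 : 0 ≤ h3D r := le_trans (by positivity) ih.1
    constructor
    · calc _ = (1 / 4 * (15 / 2 : ℝ) ^ r) * (15 / 2) := by ring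
        _ ≤ _ := mul_le_mul ih.1 h1 (by norm_num) h0
    · calc _ ≤ (1 / 4 * (8 : ℝ) ^ r) * 8 := mul_le_mul ih.2 h2 (le_trans (by norm_num) h1) (by positivity)
        _ = _ := by ring

/-- integer coefficients -/
noncomputable def h3a (r j : ℕ) : ℕ := if h : j ≤ r then (h3_coef j (r - j)).choose else 0

theorem h3a_spec (r j : ℕ) (h : j ≤ r) :
    h3a r j * (j.factorial * (r - j).factorial * (h3p j * h3n (r - j))) = 2 ^ r * (h3p r * h3n r) ∧
    h3a r j ≤ 2 ^ r * 4 ^ r * (2 ^ (r + 1) * r.choose j) := by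
  have h1 := (h3_coef j (r - j)).choose_spec
  have h2 : h3a r j = (h3_coef j (r - j)).choose := by simp [h3a, h]
  rw [← h2] at h1
  have h3 : j + (r - j) = r := by omega
  rw [h3] at h1
  exact h1

theorem h3a_inner (r j : ℕ) (h : j ≤ r) :
    (h3D r : ℂ) * ((r.choose j : ℂ) * (-1) ^ (r - j) *
      ∑ k ∈ range (r + 1), (r.choose k : ℂ) * ((-1) ^ k / ((-((r - j : ℕ) : ℂ) + 1 / 4) + k))) = h3a r j := by
  rw [h3_sum_id]
  swap
  · intro l hl
    apply quarter_ne (-((r - j : ℕ) : ℤ) + l)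
    push_cast
    linear_combination hl
  have h1 := h3_prod (r - j) j
  rw [show r - j + j + 1 = r + 1 by omega] at h1
  rw [h1]
  obtain ⟨h2, -⟩ := h3a_spec r j h
  have h3 : (r.choose j : ℂ) * (j.factorial * (r - j).factorial) = r.factorial := by
    have := Nat.choose_mul_factorial_mul_factorial h
    rw [← mul_assoc]
    exact_mod_cast this
  have h2' : (h3a r j : ℂ) * (j.factorial * (r - j).factorial * (h3p j * h3n (r - j))) =
      2 ^ r * (h3p r * h3n r) := by exact_mod_cast h2
  have np : (h3p j : ℂ) ≠ 0 := by exact_mod_cast (h3p_pos j).ne'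
  have nn : (h3n (r - j) : ℂ) ≠ 0 := by exact_mod_cast (h3n_pos (r - j)).ne'
  have f1 : (j.factorial : ℂ) ≠ 0 := by exact_mod_cast j.factorial_ne_zero
  have f2 : ((r - j).factorial : ℂ) ≠ 0 := by exact_mod_cast (r - j).factorial_ne_zero
  have f3 : (r.factorial : ℂ) ≠ 0 := by exact_mod_cast r.factorial_ne_zero
  have hs : ((-1 : ℂ) ^ (r - j)) * (-1) ^ (r - j) = 1 := by
    rw [← mul_pow]; simp
  have hs0 : ((-1 : ℂ) ^ (r - j)) ≠ 0 := by simp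
  unfold h3D
  push_cast
  have e : (h3a r j : ℂ) = 2 ^ r * (h3p r * h3n r) / (j.factorial * (r - j).factorial * (h3p j * h3n (r - j))) := by
    rw [← h2']; field_simp
  have e2 : (r.choose j : ℂ) = r.factorial / (j.factorial * (r - j).factorial) := by
    rw [← h3]; field_simp
  rw [e, e2]
  field_simp

open Complex in
theorem h3_integral (r : ℕ) (ψ : ℝ) :
    (∫ φ in (0 : ℝ)..(2 * ψ), (cexp (φ * I) - 1) ^ r * (cexp (2 * ψ * I) - cexp (φ * I)) ^ r *
      cexp (((1 / 4 - r) * I) * φ)) =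
    ∑ j ∈ range (r + 1), ∑ k ∈ range (r + 1), ((r.choose j : ℂ) * (-1) ^ (r - j)) *
      ((r.choose k : ℂ) * (-1) ^ k) * ((cexp (2 * ψ * I) ^ j * cexp (ψ / 2 * I) - cexp (2 * ψ * I) ^ (r - k)) /
        ((((j : ℂ) - r + 1 / 4) + k) * I)) := by
  have hexp : ∀ φ : ℝ, (cexp (φ * I) - 1) ^ r * (cexp (2 * ψ * I) - cexp (φ * I)) ^ r *
      cexp (((1 / 4 - r) * I) * φ) = ∑ j ∈ range (r + 1), ∑ k ∈ range (r + 1),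
      (((r.choose j : ℂ) * (-1) ^ (r - j)) *
      ((r.choose k : ℂ) * (-1) ^ k) * cexp (2 * ψ * I) ^ (r - k)) *
        cexp ((((j : ℂ) - r + 1 / 4 + k) * I) * φ) := by
    intro φ
    have h1 : (cexp (φ * I) - 1) ^ r = ∑ j ∈ range (r + 1), (cexp (φ * I)) ^ j * (-1) ^ (r - j) * (r.choose j : ℂ) := by
      rw [sub_eq_add_neg, add_pow]
    have h2 : (cexp (2 * ψ * I) - cexp (φ * I)) ^ r = ∑ k ∈ range (r + 1),
        (- cexp (φ * I)) ^ k * (cexp (2 * ψ * I)) ^ (r - k) * (r.choose k : ℂ) := by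
      rw [sub_eq_add_neg, add_comm, add_pow]
    rw [h1, h2, Finset.sum_mul_sum, Finset.sum_mul]
    refine Finset.sum_congr rfl fun j _ => ?_
    rw [Finset.sum_mul]
    refine Finset.sum_congr rfl fun k _ => ?_
    have : cexp ((((j : ℂ) - r + 1 / 4 + k) * I) * φ) =
        cexp (φ * I) ^ j * cexp (φ * I) ^ k * cexp (((1 / 4 - r) * I) * φ) := by
      rw [← Complex.exp_nat_mul, ← Complex.exp_nat_mul, ← Complex.exp_add, ← Complex.exp_add]
      congr 1; ring
    rw [this, neg_pow]; ring
  simp_rw [hexp]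
  rw [intervalIntegral.integral_finset_sum]
  swap
  · intro j _
    apply Continuous.intervalIntegrable
    fun_prop
  refine Finset.sum_congr rfl fun j _ => ?_
  rw [intervalIntegral.integral_finset_sum]
  swap
  · intro k _
    apply Continuous.intervalIntegrable
    fun_prop
  refine Finset.sum_congr rfl fun k hk => ?_
  have hne : ((j : ℂ) - r + 1 / 4 + k) ≠ 0 := by
    have := quarter_ne ((j : ℤ) - r + k)
    push_cast at this
    intro h; apply this; linear_combination h
  have hne' : ((j : ℂ) - r + 1 / 4 + k) * I ≠ 0 := mul_ne_zero hne I_ne_zero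
  rw [intervalIntegral.integral_const_mul, integral_exp_mul_complex hne']
  have hk' : k ≤ r := by simp at hk; omega
  have e1 : cexp (2 * ψ * I) ^ (r - k) * cexp ((((j : ℂ) - r + 1 / 4 + k) * I) * ((2 * ψ : ℝ) : ℂ)) =
      cexp (2 * ψ * I) ^ j * cexp (ψ / 2 * I) := by
    rw [← Complex.exp_nat_mul, ← Complex.exp_nat_mul, ← Complex.exp_add, ← Complex.exp_add]
    congr 1
    rw [Nat.cast_sub hk']
    push_cast; ring
  rw [← e1]
  simp only [ofReal_zero, mul_zero, Complex.exp_zero]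
  ring

end

section
open Finset Complex

noncomputable def h3q (r s : ℕ) : GaussianInt :=
  ∑ j ∈ range (r + 1), (h3a r j : GaussianInt) * ((⟨s, 1⟩ : GaussianInt) ^ j * (⟨s, -1⟩ : GaussianInt) ^ (r - j))

theorem h3q_coe (r s : ℕ) : (h3q r s : ℂ) =
    ∑ j ∈ range (r + 1), (h3a r j : ℂ) * (((s : ℂ) + I) ^ j * ((s : ℂ) - I) ^ (r - j)) := by
  unfold h3q
  rw [map_sum]
  refine Finset.sum_congr rfl fun j _ => ?_
  rw [map_mul, map_mul, map_pow, map_pow, map_natCast, GaussianInt.toComplex_def', GaussianInt.toComplex_def']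
  push_cast
  ring_nf

theorem h3q_star (r s : ℕ) : (starRingEnd ℂ) (h3q r s : ℂ) =
    ∑ j ∈ range (r + 1), (h3a r j : ℂ) * (((s : ℂ) - I) ^ j * ((s : ℂ) + I) ^ (r - j)) := by
  rw [h3q_coe, map_sum]
  refine Finset.sum_congr rfl fun j _ => ?_
  simp [sub_eq_add_neg]

theorem h3_ident (r s : ℕ) (ψ : ℝ) (hz : cexp (2 * ψ * I) * ((s : ℂ) - I) = s + I) :
    (h3D r : ℂ) * ((s : ℂ) - I) ^ r * (I * ∫ φ in (0 : ℝ)..(2 * ψ), (cexp (φ * I) - 1) ^ r *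
      (cexp (2 * ψ * I) - cexp (φ * I)) ^ r * cexp (((1 / 4 - r) * I) * φ)) =
    (h3q r s : ℂ) * cexp (ψ / 2 * I) - (starRingEnd ℂ) (h3q r s : ℂ) := by
  rw [h3_integral]
  set z := cexp (2 * ψ * I)
  set w := cexp (ψ / 2 * I)
  have h1 : I * (∑ j ∈ range (r + 1), ∑ k ∈ range (r + 1), ((r.choose j : ℂ) * (-1) ^ (r - j)) *
      ((r.choose k : ℂ) * (-1) ^ k) * ((z ^ j * w - z ^ (r - k)) /
        ((((j : ℂ) - r + 1 / 4) + k) * I))) =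
      w * (∑ j ∈ range (r + 1), z ^ j * ((r.choose j : ℂ) * (-1) ^ (r - j) *
        ∑ k ∈ range (r + 1), (r.choose k : ℂ) * ((-1) ^ k / ((-((r - j : ℕ) : ℂ) + 1 / 4) + k)))) -
      (∑ k ∈ range (r + 1), z ^ (r - k) * ((r.choose k : ℂ) * (-1) ^ (r - k) *
        ∑ j ∈ range (r + 1), (r.choose j : ℂ) * ((-1) ^ j / ((-((r - k : ℕ) : ℂ) + 1 / 4) + j)))) := by
    have e2 : (∑ k ∈ range (r + 1), z ^ (r - k) * ((r.choose k : ℂ) * (-1) ^ (r - k) *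
        ∑ j ∈ range (r + 1), (r.choose j : ℂ) * ((-1) ^ j / ((-((r - k : ℕ) : ℂ) + 1 / 4) + j)))) =
        ∑ j ∈ range (r + 1), ∑ k ∈ range (r + 1), z ^ (r - k) * ((r.choose k : ℂ) * (-1) ^ (r - k) *
         ((r.choose j : ℂ) * ((-1) ^ j / ((-((r - k : ℕ) : ℂ) + 1 / 4) + j)))) := by
      rw [Finset.sum_comm]
      refine Finset.sum_congr rfl fun j _ => ?_
      rw [Finset.mul_sum, Finset.mul_sum]
    rw [e2, Finset.mul_sum, Finset.mul_sum, ← Finset.sum_sub_distrib]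
    refine Finset.sum_congr rfl fun j hj => ?_
    rw [Finset.mul_sum, Finset.mul_sum, Finset.mul_sum, Finset.mul_sum, ← Finset.sum_sub_distrib]
    refine Finset.sum_congr rfl fun k hk => ?_
    have hj' : j ≤ r := by simp at hj; omega
    have hk' : k ≤ r := by simp at hk; omega
    have hne : ((j : ℂ) - r + 1 / 4 + k) ≠ 0 := by
      have := quarter_ne ((j : ℤ) - r + k)
      push_cast at this
      intro h; apply this; linear_combination h
    rw [Nat.cast_sub hj', Nat.cast_sub hk']
    rw [show -((r : ℂ) - j) + 1 / 4 + k = (j : ℂ) - r + 1 / 4 + k by ring,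
      show -((r : ℂ) - k) + 1 / 4 + j = (j : ℂ) - r + 1 / 4 + k by ring]
    have hsign : (-1 : ℂ) ^ (r - k) * (-1) ^ j = (-1) ^ (r - j) * (-1) ^ k := by
      rw [← pow_add, ← pow_add]
      apply neg_one_pow_congr
      constructor <;> intro h <;> rw [Nat.even_iff] at h ⊢ <;> omega
    have : I ≠ 0 := I_ne_zero
    have e3 : z ^ (r - k) * ((r.choose k : ℂ) * (-1) ^ (r - k) * ((r.choose j : ℂ) * ((-1) ^ j / ((j : ℂ) - r + 1 / 4 + k)))) =
        z ^ (r - k) * ((r.choose k : ℂ) * (r.choose j : ℂ) * (((-1) ^ (r - j) * (-1) ^ k) / ((j : ℂ) - r + 1 / 4 + k))) := by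
      rw [← hsign]; ring
    rw [e3]
    field_simp
  rw [h1, h3q_coe, ← h3q_coe, h3q_star, h3q_coe]
  have hz1 : ∀ j ≤ r, ((s : ℂ) - I) ^ r * z ^ j = ((s : ℂ) + I) ^ j * ((s : ℂ) - I) ^ (r - j) := by
    intro j hj
    obtain ⟨k, rfl⟩ := Nat.exists_eq_add_of_le hj
    rw [← hz, mul_pow, pow_add, show j + k - j = k by omega]
    ring
  rw [mul_sub]
  congr 1
  · rw [mul_comm w, ← mul_assoc]
    congr 1
    rw [Finset.mul_sum]
    refine Finset.sum_congr rfl fun j hj => ?_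
    have hj' : j ≤ r := by simp at hj; omega
    rw [← h3a_inner r j hj', ← hz1 j hj']
    ring
  · rw [Finset.mul_sum]
    refine Finset.sum_congr rfl fun j hj => ?_
    have hj' : j ≤ r := by simp at hj; omega
    have := hz1 (r - j) (by omega)
    rw [show r - (r - j) = j by omega] at this
    rw [← h3a_inner r j hj', mul_comm (((s : ℂ) - I) ^ j), ← this]
    ring

theorem h3q_norm (r s : ℕ) : ‖(h3q r s : ℂ)‖ ≤ 2 * (32 * √((s : ℝ) ^ 2 + 1)) ^ r := by
  rw [h3q_coe]
  have n1 : ‖(s : ℂ) + I‖ = √((s : ℝ) ^ 2 + 1) := by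
    have := Complex.norm_add_mul_I (s : ℝ) 1
    simpa using this
  have n2 : ‖(s : ℂ) - I‖ = √((s : ℝ) ^ 2 + 1) := by
    have := Complex.norm_add_mul_I (s : ℝ) (-1)
    simpa [sub_eq_add_neg] using this
  set D := √((s : ℝ) ^ 2 + 1)
  calc _ ≤ ∑ j ∈ range (r + 1), ‖(h3a r j : ℂ) * (((s : ℂ) + I) ^ j * ((s : ℂ) - I) ^ (r - j))‖ := norm_sum_le _ _
    _ ≤ ∑ j ∈ range (r + 1), (2 ^ r * 4 ^ r * (2 ^ (r + 1) * r.choose j)) * D ^ r := by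
      refine Finset.sum_le_sum fun j hj => ?_
      have hj' : j ≤ r := by simp at hj; omega
      rw [norm_mul, norm_mul, norm_pow, norm_pow, n1, n2, ← pow_add, show j + (r - j) = r by omega,
        Complex.norm_natCast]
      gcongr
      exact_mod_cast (h3a_spec r j hj').2
    _ = 2 ^ r * 4 ^ r * 2 ^ (r + 1) * D ^ r * ∑ j ∈ range (r + 1), (r.choose j : ℝ) := by
      rw [Finset.mul_sum]
      exact Finset.sum_congr rfl fun j _ => by ring
    _ = 2 ^ r * 4 ^ r * 2 ^ (r + 1) * D ^ r * 2 ^ r := by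
      congr 1
      exact_mod_cast Nat.sum_range_choose r
    _ = 2 * ((2 * 4 * 2 * 2) * D) ^ r := by
      rw [mul_pow, mul_pow, mul_pow, mul_pow]; ring
    _ = _ := by norm_num

end

section
open Finset Complex

theorem h3_integrand (r : ℕ) (ψ φ : ℝ) :
    (cexp (φ * I) - 1) ^ r * (cexp (2 * ψ * I) - cexp (φ * I)) ^ r * cexp (((1 / 4 - r) * I) * φ) =
    ((-1) ^ r * cexp (ψ * I) ^ r) * (((2 * Real.cos (φ - ψ) - 2 * Real.cos ψ) ^ r : ℝ) * cexp (((φ / 4 : ℝ) : ℂ) * I)) := by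
  have h1 : (cexp (φ * I) - 1) * (cexp (2 * ψ * I) - cexp (φ * I)) =
      -1 * cexp (ψ * I) * ((2 * Real.cos (φ - ψ) - 2 * Real.cos ψ : ℝ) : ℂ) * cexp (φ * I) := by
    push_cast
    rw [Complex.cos, Complex.cos]
    have e1 : cexp (φ * I) * cexp (-(φ * I)) = 1 := by rw [← Complex.exp_add]; simp
    have e2 : cexp (ψ * I) * cexp (-(ψ * I)) = 1 := by rw [← Complex.exp_add]; simp
    have e3 : cexp (2 * ψ * I) = cexp (ψ * I) * cexp (ψ * I) := by rw [← Complex.exp_add]; congr 1; ring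
    have e4 : cexp ((φ - ψ) * I) = cexp (φ * I) * cexp (-(ψ * I)) := by
      rw [← Complex.exp_add]; congr 1; ring
    have e5 : cexp (-(φ - ψ) * I) = cexp (-(φ * I)) * cexp (ψ * I) := by
      rw [← Complex.exp_add]; congr 1; ring
    have e6 : cexp (-ψ * I) = cexp (-(ψ * I)) := by congr 1; ring
    rw [e3, e4, e5, e6]
    set a := cexp (φ * I)
    set b := cexp (ψ * I)
    set a' := cexp (-(φ * I))
    set b' := cexp (-(ψ * I))
    linear_combination (a ^ 2 - a) * e2 + (b ^ 2) * e1
  have h2 : cexp (((φ / 4 : ℝ) : ℂ) * I) = cexp (φ * I) ^ r * cexp (((1 / 4 - r) * I) * φ) := by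
    rw [← Complex.exp_nat_mul, ← Complex.exp_add]
    congr 1; push_cast; ring
  rw [← mul_pow, h1, h2]
  push_cast
  rw [mul_pow, mul_pow, mul_pow]
  ring

theorem h3_int_upper (r : ℕ) (ψ : ℝ) (h0 : 0 ≤ ψ) (h1 : ψ ≤ 1) :
    ‖∫ φ in (0 : ℝ)..(2 * ψ), (cexp (φ * I) - 1) ^ r *
      (cexp (2 * ψ * I) - cexp (φ * I)) ^ r * cexp (((1 / 4 - r) * I) * φ)‖ ≤
    (2 - 2 * Real.cos ψ) ^ r * (2 * ψ) := by
  have := intervalIntegral.norm_integral_le_of_norm_le_const (a := (0 : ℝ)) (b := 2 * ψ)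
    (C := (2 - 2 * Real.cos ψ) ^ r) (f := fun φ : ℝ => (cexp (φ * I) - 1) ^ r *
      (cexp (2 * ψ * I) - cexp (φ * I)) ^ r * cexp (((1 / 4 - r) * I) * φ)) ?_
  · rwa [sub_zero, abs_of_nonneg (by linarith)] at this
  intro φ hφ
  rw [Set.uIoc_of_le (by linarith)] at hφ
  rw [h3_integrand, norm_mul, norm_mul, norm_mul, norm_pow, norm_pow, Complex.norm_exp_ofReal_mul_I,
    Complex.norm_exp_ofReal_mul_I, Complex.norm_real]
  simp only [norm_neg, norm_one, one_pow, one_mul, mul_one, norm_pow, Real.norm_eq_abs]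
  have hg : 0 ≤ 2 * Real.cos (φ - ψ) - 2 * Real.cos ψ := by
    have : Real.cos ψ ≤ Real.cos (φ - ψ) := by
      rw [← Real.cos_abs (φ - ψ)]
      apply Real.cos_le_cos_of_nonneg_of_le_pi (abs_nonneg _) (by linarith [Real.pi_gt_three])
      rw [abs_le]; constructor <;> linarith [hφ.1, hφ.2]
    linarith
  rw [abs_of_nonneg hg]
  gcongr
  linarith [Real.cos_le_one (φ - ψ)]

theorem h3_int_lower (r : ℕ) (ψ : ℝ) (h0 : 0 ≤ ψ) (h1 : ψ ≤ 1 / 2) :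
    (9 / 10) * ψ * ((7 / 10) * (2 - 2 * Real.cos ψ)) ^ r ≤
    ‖∫ φ in (0 : ℝ)..(2 * ψ), (cexp (φ * I) - 1) ^ r *
      (cexp (2 * ψ * I) - cexp (φ * I)) ^ r * cexp (((1 / 4 - r) * I) * φ)‖ := by
  simp_rw [h3_integrand]
  rw [intervalIntegral.integral_const_mul, norm_mul, norm_mul, norm_pow, norm_pow, Complex.norm_exp_ofReal_mul_I]
  simp only [norm_neg, norm_one, one_pow, one_mul]
  set g : ℝ → ℝ := fun φ => (2 * Real.cos (φ - ψ) - 2 * Real.cos ψ) ^ r * Real.cos (φ / 4) with hgdef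
  have hre : (∫ φ in (0 : ℝ)..(2 * ψ), (((2 * Real.cos (φ - ψ) - 2 * Real.cos ψ) ^ r : ℝ) : ℂ) *
      cexp (((φ / 4 : ℝ) : ℂ) * I)).re = ∫ φ in (0 : ℝ)..(2 * ψ), g φ := by
    have := Complex.reCLM.intervalIntegral_comp_comm (μ := MeasureTheory.volume) (a := (0 : ℝ)) (b := 2 * ψ)
      (f := fun φ : ℝ => (((2 * Real.cos (φ - ψ) - 2 * Real.cos ψ) ^ r : ℝ) : ℂ) * cexp (((φ / 4 : ℝ) : ℂ) * I))
      (by apply Continuous.intervalIntegrable; fun_prop)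
    simp only [Complex.reCLM_apply] at this
    rw [← this]
    refine intervalIntegral.integral_congr fun φ _ => ?_
    simp only [hgdef]
    rw [Complex.re_ofReal_mul, Complex.exp_ofReal_mul_I_re]
  have hcont : Continuous g := by fun_prop
  have hnn : ∀ φ ∈ Set.Icc 0 (2 * ψ), 0 ≤ g φ := by
    intro φ hφ
    have hg : 0 ≤ 2 * Real.cos (φ - ψ) - 2 * Real.cos ψ := by
      have : Real.cos ψ ≤ Real.cos (φ - ψ) := by
        rw [← Real.cos_abs (φ - ψ)]
        apply Real.cos_le_cos_of_nonneg_of_le_pi (abs_nonneg _) (by linarith [Real.pi_gt_three])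
        rw [abs_le]; constructor <;> linarith [hφ.1, hφ.2]
      linarith
    have : 0 ≤ Real.cos (φ / 4) := Real.cos_nonneg_of_mem_Icc
      ⟨by linarith [hφ.1, Real.pi_gt_three], by linarith [hφ.2, Real.pi_gt_three]⟩
    positivity
  have hmid : ∫ φ in (ψ / 2)..(3 * ψ / 2), g φ ≤ ∫ φ in (0 : ℝ)..(2 * ψ), g φ := by
    apply intervalIntegral.integral_mono_interval (by linarith) (by linarith) (by linarith)
    · filter_upwards [MeasureTheory.ae_restrict_mem measurableSet_Ioc] with φ hφ
      exact hnn φ ⟨hφ.1.le, hφ.2⟩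
    · exact hcont.intervalIntegrable _ _
  have hconst : ∫ φ in (ψ / 2)..(3 * ψ / 2), ((7 / 10) * (2 - 2 * Real.cos ψ)) ^ r * (9 / 10) ≤
      ∫ φ in (ψ / 2)..(3 * ψ / 2), g φ := by
    apply intervalIntegral.integral_mono_on (by linarith) (by simp) (hcont.intervalIntegrable _ _)
    intro φ hφ
    have hc9 : 9 / 10 ≤ Real.cos (φ / 4) := by
      have := Real.one_sub_sq_div_two_le_cos (x := φ / 4)
      nlinarith [hφ.1, hφ.2]
    have hcψ : 2 / 3 ≤ Real.cos (ψ / 2) := by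
      have := Real.one_sub_sq_div_two_le_cos (x := ψ / 2)
      nlinarith
    have hcc : Real.cos (ψ / 2) ≤ Real.cos (φ - ψ) := by
      rw [← Real.cos_abs (φ - ψ)]
      apply Real.cos_le_cos_of_nonneg_of_le_pi (abs_nonneg _) (by linarith [Real.pi_gt_three])
      rw [abs_le]; constructor <;> linarith [hφ.1, hφ.2]
    have hd : Real.cos ψ = 2 * Real.cos (ψ / 2) ^ 2 - 1 := by
      rw [← Real.cos_two_mul]; congr 1; ring
    have hc1 := Real.cos_le_one (ψ / 2)
    have hw : 0 ≤ 2 - 2 * Real.cos ψ := by linarith [Real.cos_le_one ψ]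
    have hg : 7 / 10 * (2 - 2 * Real.cos ψ) ≤ 2 * Real.cos (φ - ψ) - 2 * Real.cos ψ := by
      have : 7 / 10 * (2 - 2 * Real.cos ψ) ≤ 2 * Real.cos (ψ / 2) - 2 * Real.cos ψ := by
        rw [hd]; nlinarith
      linarith
    simp only [hgdef]
    have hl0 : 0 ≤ 7 / 10 * (2 - 2 * Real.cos ψ) := by positivity
    exact mul_le_mul (pow_le_pow_left₀ hl0 hg r) hc9 (by norm_num) (pow_nonneg (hl0.trans hg) r)
  rw [intervalIntegral.integral_const, smul_eq_mul] at hconst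
  calc _ = (3 * ψ / 2 - ψ / 2) * (((7 / 10) * (2 - 2 * Real.cos ψ)) ^ r * (9 / 10)) := by ring
    _ ≤ _ := hconst.trans (hmid.trans (by rw [← hre]; exact Complex.re_le_norm _))

theorem h3_E (r s : ℕ) (hs : 100 ≤ s) : ∃ w : ℂ, ‖w‖ = 1 ∧ w ^ 4 * ((s : ℂ) - I) = s + I ∧
    ∀ r : ℕ, ‖(h3q r s : ℂ) * w - (starRingEnd ℂ) (h3q r s : ℂ)‖ ≤ 1 / (2 * s) * (8 / s) ^ r ∧
    (1 / 5) / √((s : ℝ) ^ 2 + 1) * (5 / √((s : ℝ) ^ 2 + 1)) ^ r ≤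
      ‖(h3q r s : ℂ) * w - (starRingEnd ℂ) (h3q r s : ℂ)‖ := by
  have hs' : (100 : ℝ) ≤ s := by exact_mod_cast hs
  set d := √((s : ℝ) ^ 2 + 1) with hd
  have hdsq : d ^ 2 = (s : ℝ) ^ 2 + 1 := Real.sq_sqrt (by positivity)
  have hd0 : 0 < d := Real.sqrt_pos.2 (by positivity)
  have hds : (s : ℝ) < d := by nlinarith
  set ψ := Real.arctan (1 / s) with hψ
  have hcos : Real.cos ψ * d = s := by
    rw [hψ, Real.cos_arctan]
    have : √(1 + (1 / (s : ℝ)) ^ 2) = d / s := by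
      rw [Real.sqrt_eq_iff_mul_self_eq (by positivity) (by positivity)]
      field_simp; nlinarith
    rw [this]; field_simp
  have hsin : Real.sin ψ * d = 1 := by
    rw [hψ, Real.sin_arctan]
    have : √(1 + (1 / (s : ℝ)) ^ 2) = d / s := by
      rw [Real.sqrt_eq_iff_mul_self_eq (by positivity) (by positivity)]
      field_simp; nlinarith
    rw [this]; field_simp
  have hψ0 : 0 < ψ := by rw [hψ]; exact Real.arctan_pos.2 (by positivity)
  have hψ1 : ψ ≤ 1 / s := by
    have := Real.le_tan hψ0.le (Real.arctan_lt_pi_div_two _)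
    rwa [hψ, Real.tan_arctan] at this
  have hψ2 : 1 / d ≤ ψ := by
    have := Real.sin_le hψ0.le
    rw [div_le_iff₀ hd0]; nlinarith
  have h1s : 1 / (s : ℝ) ≤ 1 / 100 := one_div_le_one_div_of_le (by norm_num) hs'
  have hexp1 : (d : ℂ) * cexp (ψ * I) = s + I := by
    rw [Complex.exp_mul_I, ← Complex.ofReal_cos, ← Complex.ofReal_sin]
    have h1 : ((Real.cos ψ : ℝ) : ℂ) * (d : ℂ) = s := by exact_mod_cast hcos
    have h2 : ((Real.sin ψ : ℝ) : ℂ) * (d : ℂ) = 1 := by exact_mod_cast hsin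
    linear_combination h1 + I * h2
  have hexp2 : (d : ℂ) * cexp (-(ψ * I)) = s - I := by
    have := congrArg (starRingEnd ℂ) hexp1
    rw [map_mul, ← Complex.exp_conj] at this
    simpa [sub_eq_add_neg] using this
  have hz : cexp (2 * ψ * I) * ((s : ℂ) - I) = s + I := by
    rw [← hexp1, ← hexp2]
    have : cexp (2 * ψ * I) * cexp (-(ψ * I)) = cexp (ψ * I) := by
      rw [← Complex.exp_add]; congr 1; ring
    linear_combination (d : ℂ) * this
  have hnorm : ‖(s : ℂ) - I‖ = d := by
    have := Complex.norm_add_mul_I (s : ℝ) (-1)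
    simpa [sub_eq_add_neg] using this
  refine ⟨cexp (ψ / 2 * I), ?_, ?_, ?_⟩
  · have := Complex.norm_exp_ofReal_mul_I (ψ / 2)
    push_cast at this; exact this
  · rw [← Complex.exp_nat_mul, ← hz]
    congr 2
    push_cast; ring
  intro r
  rw [← h3_ident r s ψ hz, norm_mul, norm_mul, norm_mul, norm_pow, hnorm, Complex.norm_I, one_mul,
    Complex.norm_real]
  obtain ⟨hD1, hD2⟩ := h3D_bounds r
  have hD0 : 0 ≤ h3D r := le_trans (by positivity) hD1
  rw [Real.norm_of_nonneg hD0]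
  have hwd : (2 - 2 * Real.cos ψ) * d = 2 * (d - s) := by linear_combination -2 * hcos
  have hw0 : 0 ≤ 2 - 2 * Real.cos ψ := by linarith [Real.cos_le_one ψ]
  have hwd1 : 2 * (d - s) ≤ 1 / s := by
    rw [le_div_iff₀ (by positivity)]; nlinarith
  have hwd2 : 1 / d ≤ 2 * (d - s) := by
    rw [div_le_iff₀ hd0]; nlinarith
  constructor
  · have h := h3_int_upper r ψ hψ0.le (by linarith)
    calc _ ≤ (1 / 4 * 8 ^ r) * d ^ r * ((2 - 2 * Real.cos ψ) ^ r * (2 * ψ)) := by gcongr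
      _ = (1 / 2) * ψ * (8 * ((2 - 2 * Real.cos ψ) * d)) ^ r := by
        rw [mul_pow, mul_pow]; ring
      _ ≤ (1 / 2) * (1 / s) * (8 * (1 / s)) ^ r := by
        have : (2 - 2 * Real.cos ψ) * d ≤ 1 / s := by rw [hwd]; exact hwd1
        gcongr
      _ = _ := by
        rw [mul_one_div]; ring
  · have h := h3_int_lower r ψ hψ0.le (by linarith)
    have hE : (1 / d) ≤ (2 - 2 * Real.cos ψ) * d := by rw [hwd]; exact hwd2
    calc (1 / 5) / d * (5 / d) ^ r ≤ (1 / 4) * (9 / 10) * (1 / d) * ((15 / 2) * (7 / 10) * (1 / d)) ^ r := by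
          have e1 : (1 / 5) / d ≤ (1 / 4) * (9 / 10) * (1 / d) := by
            rw [← sub_nonneg]
            have : (1 / 4) * (9 / 10) * (1 / d) - (1 / 5) / d = (1 / 40) / d := by field_simp; norm_num
            rw [this]; positivity
          have e2 : 5 / d ≤ (15 / 2) * (7 / 10) * (1 / d) := by
            rw [← sub_nonneg]
            have : (15 / 2) * (7 / 10) * (1 / d) - 5 / d = (1 / 4) / d := by field_simp; norm_num
            rw [this]; positivity
          gcongr
      _ ≤ (1 / 4) * (9 / 10) * ψ * ((15 / 2) * (7 / 10) * ((2 - 2 * Real.cos ψ) * d)) ^ r := by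
          gcongr
      _ = (1 / 4 * (15 / 2) ^ r) * d ^ r * ((9 / 10) * ψ * ((7 / 10) * (2 - 2 * Real.cos ψ)) ^ r) := by
          rw [show (15 / 2 : ℝ) * (7 / 10) * ((2 - 2 * Real.cos ψ) * d) = (15 / 2) * d * ((7 / 10) * (2 - 2 * Real.cos ψ)) by ring,
            mul_pow, mul_pow (15 / 2 : ℝ)]; ring
      _ ≤ _ := by gcongr

end

section
open Finset Complex

theorem h3_root_unit (t : ℂ) (ht : ‖t‖ = 1) :
    ∃ u : ℂ, (u = 1 ∨ u = -1 ∨ u = I ∨ u = -I) ∧ 2 * ‖t - u‖ ≤ ‖t ^ 4 - 1‖ := by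
  have key : ∀ t : ℂ, ‖t‖ = 1 → |t.im| ≤ t.re → 2 * ‖t - 1‖ ≤ ‖t ^ 4 - 1‖ := by
    intro t ht h
    have hsq : t.re ^ 2 + t.im ^ 2 = 1 := by
      have := Complex.sq_norm t
      rw [ht, Complex.normSq_apply] at this
      nlinarith
    have hre : 1 ≤ 2 * t.re ^ 2 := by
      have : |t.im| ^ 2 ≤ t.re ^ 2 := by
        have := abs_nonneg t.im
        gcongr
      rw [sq_abs] at this
      linarith
    have hre0 : 0 ≤ t.re := (abs_nonneg _).trans h
    have e : t ^ 4 - 1 = (t - 1) * ((t + 1) * (t ^ 2 + 1)) := by ring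
    rw [e, norm_mul, mul_comm]
    gcongr
    have : (2 : ℝ) ^ 2 ≤ ‖(t + 1) * (t ^ 2 + 1)‖ ^ 2 := by
      rw [norm_mul, mul_pow, Complex.sq_norm, Complex.sq_norm, Complex.normSq_apply, Complex.normSq_apply]
      simp only [Complex.add_re, Complex.add_im, Complex.one_re, Complex.one_im, pow_two, Complex.mul_re, Complex.mul_im]
      have e1 : (t.re + 1) * (t.re + 1) + (t.im + 0) * (t.im + 0) = 2 + 2 * t.re := by nlinarith
      have e2 : (t.re * t.re - t.im * t.im + 1) * (t.re * t.re - t.im * t.im + 1) +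
          (t.re * t.im + t.im * t.re + 0) * (t.re * t.im + t.im * t.re + 0) = 4 * t.re ^ 2 := by
        have : t.im ^ 2 = 1 - t.re ^ 2 := by linarith
        ring_nf
        rw [show t.im ^ 4 = (t.im ^ 2) ^ 2 by ring, this]; ring
      rw [e1, e2]
      nlinarith
    exact le_of_sq_le_sq this (norm_nonneg _) 
  have key2 : ∀ u : ℂ, u ^ 4 = 1 → ‖u‖ = 1 → |(t * u).im| ≤ (t * u).re → ∀ u', u * u' = 1 →
      2 * ‖t - u'‖ ≤ ‖t ^ 4 - 1‖ := by
    intro u hu hu1 h u' huu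
    have := key (t * u) (by rw [norm_mul, ht, hu1]; norm_num) h
    rw [mul_pow, hu, mul_one] at this
    have e : t * u - 1 = (t - u') * u := by linear_combination huu
    rwa [e, norm_mul, hu1, mul_one] at this
  have hI4 : I ^ 4 = 1 := Complex.I_pow_four
  rcases le_total |t.im| |t.re| with h | h
  · rcases le_total 0 t.re with h2 | h2
    · refine ⟨1, by simp, ?_⟩
      exact key t ht (by rwa [abs_of_nonneg h2] at h)
    · refine ⟨-1, by simp, key2 (-1) (by norm_num) (by simp) ?_ _ (by norm_num)⟩
      rw [abs_of_nonpos h2] at h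
      simpa using h
  · rcases le_total 0 t.im with h2 | h2
    · refine ⟨I, by simp, key2 (-I) (by rw [neg_pow, hI4]; norm_num) (by simp) ?_ _ (by simp)⟩
      rw [abs_of_nonneg h2] at h
      simpa using h
    · refine ⟨-I, by simp, key2 I hI4 (by simp) ?_ _ (by simp)⟩
      rw [abs_of_nonpos h2] at h
      simpa using h

theorem h3_unit_exists (x y : ℂ) (Z : ℝ) (hZ : 0 < Z) (hx : ‖x‖ = Z) (hy : ‖y‖ = Z) :
    ∃ u : ℂ, (u = 1 ∨ u = -1 ∨ u = I ∨ u = -I) ∧ 2 * Z ^ 3 * ‖x - u * y‖ ≤ ‖x ^ 4 - y ^ 4‖ := by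
  have hy0 : y ≠ 0 := by intro h; rw [h, norm_zero] at hy; linarith
  obtain ⟨u, hu, h⟩ := h3_root_unit (x / y) (by rw [norm_div, hx, hy]; field_simp)
  refine ⟨u, hu, ?_⟩
  have e1 : x - u * y = (x / y - u) * y := by field_simp
  have e2 : x ^ 4 - y ^ 4 = ((x / y) ^ 4 - 1) * y ^ 4 := by field_simp
  rw [e1, e2, norm_mul, norm_mul, norm_pow, hy]
  calc _ = 2 * ‖x / y - u‖ * Z ^ 4 := by ring
    _ ≤ _ := by gcongr

/-- real-number estimates -/
theorem h3_real1 (s d Z : ℝ) (r : ℕ) (hs : 200 ≤ s) (hd1 : s < d) (hd2 : d ^ 2 = s ^ 2 + 1) (hZ : 1 ≤ Z)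
    (h1 : Z ≤ s * (s / 8) ^ r) (h2 : r = 0 ∨ 8 * (s / 8) ^ r < Z) :
    2 * (32 * d) ^ r * (3 / 2 / (d * Z ^ 3)) + 3 / 2 * Z * (1 / (2 * s) * (8 / s) ^ r) < 2 := by
  have t2 : 3 / 2 * Z * (1 / (2 * s) * (8 / s) ^ r) ≤ 3 / 4 := by
    calc _ ≤ 3 / 2 * (s * (s / 8) ^ r) * (1 / (2 * s) * (8 / s) ^ r) := by gcongr
      _ = 3 / 4 * ((s / 8) * (8 / s)) ^ r := by rw [mul_pow]; field_simp; ring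
      _ = 3 / 4 := by
        rw [show s / 8 * (8 / s) = 1 by field_simp]; simp
  have hd3 : d < s + 1 := by nlinarith
  have t1 : 2 * (32 * d) ^ r * (3 / 2 / (d * Z ^ 3)) ≤ 1 := by
    have hZ3 : (32 * d) ^ r ≤ Z ^ 3 := by
      rcases h2 with rfl | h2
      · simpa using one_le_pow₀ hZ
      · calc (32 * d) ^ r ≤ ((s / 8) ^ 3) ^ r := by
              have h5 : 40000 * s ≤ s ^ 3 := by nlinarith [mul_nonneg (sub_nonneg.2 hs) (sub_nonneg.2 hs)]
              have h6 : 32 * d ≤ (s / 8) ^ 3 := by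
                rw [div_pow, le_div_iff₀ (by norm_num)]; nlinarith
              exact pow_le_pow_left₀ (by linarith) h6 r
          _ ≤ (8 * (s / 8) ^ r) ^ 3 := by
              rw [← pow_mul, mul_comm 3 r, pow_mul, mul_pow]
              have : 0 ≤ ((s / 8) ^ r) ^ 3 := by positivity
              linarith
          _ ≤ Z ^ 3 := by gcongr
    have hd0 : 0 < d := by linarith
    calc _ ≤ 2 * Z ^ 3 * (3 / 2 / (d * Z ^ 3)) := by gcongr
      _ = 3 / d := by field_simp
      _ ≤ 1 := by rw [div_le_one hd0]; linarith
  linarith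

theorem h3_real2 (s d Z : ℝ) (r : ℕ) (hs : 200 ≤ s) (hd1 : s < d) (hd2 : d ^ 2 = s ^ 2 + 1)
    (h2 : 8 * (s / 8) ^ r < Z) (h : (1 / 5) / d * (5 / d) ^ r * Z ^ 4 ≤ 2 * (32 * d) ^ r / d) : False := by
  have hd0 : 0 < d := by linarith
  have h3 : Z ^ 4 ≤ 10 * ((32 / 5) * d ^ 2) ^ r := by
    have e : (10 : ℝ) * ((32 / 5) * d ^ 2) ^ r = (2 * (32 * d) ^ r / d) / ((1 / 5) / d * (5 / d) ^ r) := by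
      rw [show (32 / 5) * d ^ 2 = (32 * d) / (5 / d) by field_simp, div_pow]
      field_simp; ring
    rw [e, le_div_iff₀ (by positivity)]
    linarith
  have h4 : ((32 / 5) * d ^ 2) ^ r ≤ ((s / 8) ^ 4) ^ r := by
    gcongr
    rw [hd2]
    nlinarith [mul_nonneg (sub_nonneg.2 hs) (sub_nonneg.2 hs), sq_nonneg (s ^ 2 - 40000)]
  have h5 : (8 * (s / 8) ^ r) ^ 4 < Z ^ 4 := by gcongr
  have h6 : (8 * (s / 8) ^ r) ^ 4 = 4096 * ((s / 8) ^ 4) ^ r := by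
    rw [← pow_mul, mul_comm 4 r, pow_mul, mul_pow]; norm_num
  have h7 : 0 < ((s / 8) ^ 4) ^ r := by positivity
  linarith

theorem M3_main (s : ℕ) (hs : 200 ≤ s) (a b : ℤ) (h : QF s a b = 1) : a * b = 0 := by
  have hs' : (200 : ℝ) ≤ s := by exact_mod_cast hs
  obtain ⟨w, hw1, hw4, hE⟩ := h3_E 0 s (by omega)
  set d := √((s : ℝ) ^ 2 + 1) with hd
  have hdsq : d ^ 2 = (s : ℝ) ^ 2 + 1 := Real.sq_sqrt (by positivity)
  have hd0 : 0 < d := Real.sqrt_pos.2 (by positivity)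
  have hds : (s : ℝ) < d := by nlinarith
  set x : ℂ := (a : ℂ) + b * I with hx
  set xb : ℂ := (a : ℂ) - b * I with hxb
  have hconj : (starRingEnd ℂ) x = xb := by simp [hx, hxb, sub_eq_add_neg]
  have hnormI : ‖(s : ℂ) - I‖ = d := by
    have := Complex.norm_add_mul_I (s : ℝ) (-1)
    simpa [sub_eq_add_neg] using this
  have hQ : I * ((s : ℂ) - I) * (x ^ 4 - (w * xb) ^ 4) = 2 := by
    have h' : ((QF s a b : ℤ) : ℂ) = 1 := by rw [h]; simp
    unfold QF at h'
    push_cast at h'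
    have e : I * ((s : ℂ) - I) * (x ^ 4 - (w * xb) ^ 4) = I * ((s : ℂ) - I) * x ^ 4 - I * (s + I) * xb ^ 4 := by
      rw [← hw4]; ring
    rw [e, hx, hxb]
    have hI2 : I ^ 2 = -1 := Complex.I_sq
    have hI4 : I ^ 4 = 1 := Complex.I_pow_four
    have hI3 : I ^ 3 = -I := by rw [pow_succ, hI2]; ring
    have hI5 : I ^ 5 = I := by rw [pow_succ, hI4]; ring
    have hI6 : I ^ 6 = -1 := by rw [pow_succ, hI5, ← pow_two, hI2]
    ring_nf
    simp only [hI2, hI3, hI4, hI5, hI6]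
    linear_combination 2 * h'
  set Z := ‖x‖ with hZ
  have hxne : x ≠ 0 := by
    intro h0
    have h1 : xb = 0 := by rw [← hconj, h0]; simp
    rw [h0, h1] at hQ
    simp at hQ
  have hZ1 : 1 ≤ Z := by
    have h1 : (0 : ℝ) < Z := norm_pos_iff.2 hxne
    have h2 : Z ^ 2 = ((a ^ 2 + b ^ 2 : ℤ) : ℝ) := by
      rw [hZ, Complex.sq_norm, Complex.normSq_apply]
      simp [hx]; ring
    have h3 : (1 : ℤ) ≤ a ^ 2 + b ^ 2 := by
      have : (0 : ℝ) < ((a ^ 2 + b ^ 2 : ℤ) : ℝ) := by rw [← h2]; positivity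
      have : 0 < a ^ 2 + b ^ 2 := by exact_mod_cast this
      omega
    have h4 : (1 : ℝ) ≤ Z ^ 2 := by rw [h2]; exact_mod_cast h3
    nlinarith
  have hxbn : ‖xb‖ = Z := by rw [← hconj, Complex.norm_conj]
  have hdiff : ‖x ^ 4 - (w * xb) ^ 4‖ = 2 / d := by
    have := congrArg norm hQ
    rw [norm_mul, norm_mul, Complex.norm_I, hnormI] at this
    rw [eq_div_iff hd0.ne']
    simp at this
    linarith
  obtain ⟨u, hu, hu2⟩ := h3_unit_exists x (w * xb) Z (by linarith) rfl (by rw [norm_mul, hw1, hxbn, one_mul])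
  rw [hdiff] at hu2
  -- the multiplier
  obtain ⟨g, hg, hgn, hgim⟩ : ∃ g : GaussianInt, (starRingEnd ℂ) (g : ℂ) = (g : ℂ) * u ∧
      (0 < ‖(g : ℂ)‖ ∧ ‖(g : ℂ)‖ ≤ 3 / 2) ∧ ((g * ⟨a, b⟩).im = 0 → a * b = 0) := by
    have hsq : ∀ p q : ℤ, p ^ 2 + q ^ 2 = 2 → (0 < ‖((⟨p, q⟩ : GaussianInt) : ℂ)‖ ∧ ‖((⟨p, q⟩ : GaussianInt) : ℂ)‖ ≤ 3 / 2) := by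
      intro p q hpq
      have : ‖((⟨p, q⟩ : GaussianInt) : ℂ)‖ ^ 2 = 2 := by
        rw [Complex.sq_norm, Complex.normSq_apply, GaussianInt.re_toComplex, GaussianInt.im_toComplex]
        have : ((p ^ 2 + q ^ 2 : ℤ) : ℝ) = 2 := by rw [hpq]; norm_num
        push_cast at this; linarith
      have h0 := norm_nonneg ((⟨p, q⟩ : GaussianInt) : ℂ)
      constructor
      · rcases h0.lt_or_eq with h | h
        · exact h
        · rw [← h] at this; norm_num at this
      · nlinarith
    have hdiag : ∀ a b : ℤ, QF s a b = 1 → b ^ 2 = a ^ 2 → False := by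
      intro a b h hab
      have : QF s a b = -4 * (a ^ 4) := by
        unfold QF
        linear_combination (b ^ 2 + a ^ 2 - 6 * a ^ 2 + 4 * s * a * b) * hab
      omega
    rcases hu with rfl | rfl | rfl | rfl
    · refine ⟨1, by simp, by simp; norm_num, ?_⟩
      intro h; simp at h; simp [h]
    · refine ⟨⟨0, 1⟩, by simp [GaussianInt.toComplex_def'], by simp [GaussianInt.toComplex_def']; norm_num, ?_⟩
      intro h; simp at h; simp [h]
    · refine ⟨⟨1, -1⟩, ?_, hsq _ _ (by norm_num), ?_⟩
      · simp only [GaussianInt.toComplex_def', map_add, map_mul, Complex.conj_I]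
        push_cast
        simp
        linear_combination Complex.I_sq
      · intro h; simp at h
        exact (hdiag a b ‹_› (by rw [show b = a by omega])).elim
    · refine ⟨⟨1, 1⟩, ?_, hsq _ _ (by norm_num), ?_⟩
      · simp only [GaussianInt.toComplex_def', map_add, map_mul, Complex.conj_I]
        push_cast
        simp
        linear_combination Complex.I_sq
      · intro h; simp at h
        exact (hdiag a b ‹_› (by rw [show b = -a by omega]; ring)).elim
  -- choose r
  have hex : ∃ r : ℕ, Z ≤ s * ((s : ℝ) / 8) ^ r := by
    obtain ⟨r, hr⟩ := pow_unbounded_of_one_lt Z (show 1 < (s : ℝ) / 8 by linarith)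
    exact ⟨r, by nlinarith [hr.le]⟩
  classical
  set r := Nat.find hex with hr
  have hr1 : Z ≤ s * ((s : ℝ) / 8) ^ r := Nat.find_spec hex
  have hr2 : r = 0 ∨ 8 * ((s : ℝ) / 8) ^ r < Z := by
    rcases Nat.eq_zero_or_pos r with h0 | h0
    · exact Or.inl h0
    · right
      have h1 : ¬ (Z ≤ s * ((s : ℝ) / 8) ^ (r - 1)) := Nat.find_min hex (by omega)
      push Not at h1
      have e : 8 * ((s : ℝ) / 8) ^ r = s * ((s : ℝ) / 8) ^ (r - 1) := by
        conv_lhs => rw [show r = (r - 1) + 1 by omega, pow_succ]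
        ring
      rw [e]; exact h1
  obtain ⟨hE1, hE2⟩ := hE r
  have hq := h3q_norm r s
  rw [← hd] at hq
  set q := h3q r s with hqdef
  set G : ℂ := (g : ℂ) with hG
  -- L
  have hdelta : ‖G * x - w * ((starRingEnd ℂ) G * xb)‖ ≤ ‖G‖ / (d * Z ^ 3) := by
    rw [hg, show G * x - w * (G * u * xb) = G * (x - u * (w * xb)) by ring, norm_mul, div_eq_mul_inv]
    gcongr
    rw [← one_div, le_div_iff₀ (by positivity)]
    rw [le_div_iff₀ hd0] at hu2
    nlinarith
  have hL : (q : ℂ) * (G * x) - (starRingEnd ℂ) ((q : ℂ) * (G * x)) =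
      (q : ℂ) * (G * x - w * ((starRingEnd ℂ) G * xb)) +
      ((starRingEnd ℂ) G * xb) * ((q : ℂ) * w - (starRingEnd ℂ) (q : ℂ)) := by
    rw [map_mul, map_mul, hconj]; ring
  have hGc : ‖(starRingEnd ℂ) G‖ = ‖G‖ := Complex.norm_conj _
  have hLn : ‖(q : ℂ) * (G * x) - (starRingEnd ℂ) ((q : ℂ) * (G * x))‖ < 2 := by
    rw [hL]
    refine lt_of_le_of_lt (norm_add_le _ _) (lt_of_le_of_lt ?_
      (h3_real1 s d Z r hs' hds hdsq hZ1 hr1 hr2))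
    rw [norm_mul, norm_mul, norm_mul, hGc, hxbn]
    have : ‖G‖ / (d * Z ^ 3) ≤ 3 / 2 / (d * Z ^ 3) := by gcongr; exact hgn.2
    have h2 := hdelta.trans this
    gcongr
    exact hgn.2
  have hLint : (q : ℂ) * (G * x) - (starRingEnd ℂ) ((q : ℂ) * (G * x)) = ((2 * (q * (g * ⟨a, b⟩)).im : ℤ) : ℂ) * I := by
    have e : (q : ℂ) * (G * x) = ((q * (g * ⟨a, b⟩) : GaussianInt) : ℂ) := by
      rw [map_mul, map_mul, GaussianInt.toComplex_def' a b]
    rw [e, Complex.sub_conj, ← GaussianInt.intCast_im]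
    push_cast; ring
  have him : (q * (g * ⟨a, b⟩)).im = 0 := by
    rw [hLint, norm_mul, Complex.norm_I, mul_one, Complex.norm_intCast] at hLn
    have : |(2 * (q * (g * ⟨a, b⟩)).im : ℤ)| < 2 := by exact_mod_cast hLn
    rw [abs_lt] at this
    omega
  rcases hr2 with h0 | hr2
  · have hq1 : q = 1 := by
      have := (h3a_spec 0 0 le_rfl).1
      simp [h3p, h3n] at this
      rw [hqdef, h0]; simp [h3q, this]
    rw [hq1, one_mul] at him
    exact hgim him
  · exfalso
    rw [hLint, him] at hL
    simp only [mul_zero, Int.cast_zero, zero_mul] at hL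
    have h3 : ‖((starRingEnd ℂ) G * xb) * ((q : ℂ) * w - (starRingEnd ℂ) (q : ℂ))‖ =
        ‖(q : ℂ) * (G * x - w * ((starRingEnd ℂ) G * xb))‖ := by
      rw [← norm_neg]
      congr 1
      linear_combination hL
    rw [norm_mul, norm_mul, norm_mul, hGc, hxbn] at h3
    refine h3_real2 s d Z r hs' hds hdsq hr2 ?_
    have h4 : ‖G‖ * Z * ((1 / 5) / d * (5 / d) ^ r) ≤ 2 * (32 * d) ^ r * (‖G‖ / (d * Z ^ 3)) := by
      calc _ ≤ _ := by gcongr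
        _ = _ := h3
        _ ≤ _ := by gcongr
    have hG0 := hgn.1
    have e1 : (1 / 5) / d * (5 / d) ^ r * Z ^ 4 = (‖G‖ * Z * ((1 / 5) / d * (5 / d) ^ r)) * (Z ^ 3 / ‖G‖) := by
      field_simp
    have e2 : 2 * (32 * d) ^ r / d = (2 * (32 * d) ^ r * (‖G‖ / (d * Z ^ 3))) * (Z ^ 3 / ‖G‖) := by
      field_simp
    rw [e1, e2]
    gcongr

end

section
open Finset

lemma inj_sum_ge {ι : Type} [Fintype ι] (f : ι → ℕ) (hf : Function.Injective f) :
    Fintype.card ι * (Fintype.card ι - 1) / 2 ≤ ∑ i, f i := by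
  classical
  have key : ∀ (n : ℕ) (s : Finset ℕ), s.card = n → ∑ i ∈ range n, i ≤ ∑ i ∈ s, i := by
    intro n
    induction n with
    | zero => intro s _; simp
    | succ n ih =>
      intro s hs
      have hne : s.Nonempty := by
        rw [← Finset.card_pos]; omega
      have hm := s.max'_mem hne
      have h1 := ih (s.erase (s.max' hne)) (by rw [Finset.card_erase_of_mem hm]; omega)
      have h2 : n ≤ s.max' hne := by
        have hsub : s ⊆ range (s.max' hne + 1) := by
          intro x hx; rw [mem_range]; have := s.le_max' x hx; omega
        have := card_le_card hsub
        rw [card_range] at this; omega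
      rw [sum_range_succ, ← Finset.sum_erase_add _ _ hm]
      omega
  have h := key (Fintype.card ι) (univ.map ⟨f, hf⟩) (by simp)
  rw [Finset.sum_map, Finset.sum_range_id] at h
  exact h

lemma det_abs_le {ι : Type} [Fintype ι] [DecidableEq ι] (M : Matrix ι ι ℝ) (C : ι → ℝ)
    (h : ∀ i j, |M i j| ≤ C i) : |M.det| ≤ (Fintype.card ι).factorial * ∏ i, C i := by
  rw [← Matrix.det_transpose, Matrix.det_apply]
  refine (Finset.abs_sum_le_sum_abs _ _).trans ?_
  have : ∀ σ : Equiv.Perm ι, |Equiv.Perm.sign σ • ∏ i, M.transpose (σ i) i| ≤ ∏ i, C i := by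
    intro σ
    have h1 : |Equiv.Perm.sign σ • ∏ i, M.transpose (σ i) i| = ∏ i, |M i (σ i)| := by
      rcases Int.units_eq_one_or (Equiv.Perm.sign σ) with h | h <;> simp [h, Finset.abs_prod, Units.smul_def]
    rw [h1]
    exact Finset.prod_le_prod (fun i _ => abs_nonneg _) (fun i _ => h i _)
  refine (Finset.sum_le_sum (fun σ _ => this σ)).trans ?_
  simp [Finset.card_univ, Fintype.card_perm]

lemma det_series {ι : Type} [Fintype ι] [DecidableEq ι] (a : ι → ℕ → ℝ) (ha : ∀ i m, 0 ≤ a i m)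
    (t : ι → ℝ) (R ρ : ℝ) (hR : ∀ j, |t j| ≤ R) (hR0 : 0 ≤ R) (hρ : 1 ≤ ρ) (H : ℕ) :
    |(Matrix.of fun i j => ∑ m ∈ range H, a i m * t j ^ m).det| *
        ρ ^ (Fintype.card ι * (Fintype.card ι - 1) / 2)
      ≤ (Fintype.card ι).factorial * ∏ i, ∑ m ∈ range H, a i m * (ρ * R) ^ m := by
  set E := Fintype.card ι * (Fintype.card ι - 1) / 2
  have h1 : (Matrix.of fun i j => ∑ m ∈ range H, a i m * t j ^ m).det
      = ∑ f ∈ Fintype.piFinset (fun _ : ι => range H),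
          (Matrix.of fun i j => a i (f i) * t j ^ (f i)).det := by
    have := (Matrix.detRowAlternating (n := ι) (R := ℝ)).toMultilinearMap.map_sum_finset
      (fun i m => (fun j => a i m * t j ^ m)) (fun _ : ι => range H)
    have e : (Matrix.of fun i j => ∑ m ∈ range H, a i m * t j ^ m)
       = fun i => ∑ m ∈ range H, (fun j => a i m * t j ^ m) := by
      ext i j; simp
    rw [e]
    exact this
  rw [h1, Finset.prod_univ_sum, Finset.mul_sum]
  refine (mul_le_mul_of_nonneg_right (Finset.abs_sum_le_sum_abs _ _) (by positivity)).trans ?_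
  rw [Finset.sum_mul]
  refine Finset.sum_le_sum fun f _ => ?_
  by_cases hf : Function.Injective f
  · have h2 := det_abs_le (Matrix.of fun i j => a i (f i) * t j ^ (f i)) (fun i => a i (f i) * R ^ (f i))
      (by
        intro i j
        simp only [Matrix.of_apply, abs_mul, abs_pow]
        rw [abs_of_nonneg (ha _ _)]
        exact mul_le_mul_of_nonneg_left (pow_le_pow_left₀ (abs_nonneg _) (hR j) _) (ha _ _))
    have h3 : ρ ^ E ≤ ∏ i, ρ ^ f i := by
      rw [Finset.prod_pow_eq_pow_sum]
      exact pow_le_pow_right₀ hρ (inj_sum_ge f hf)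
    have h4 : (∏ i, a i (f i) * (ρ * R) ^ f i) = (∏ i, a i (f i) * R ^ (f i)) * ∏ i, ρ ^ f i := by
      rw [← Finset.prod_mul_distrib]
      refine Finset.prod_congr rfl fun i _ => ?_
      rw [mul_pow]; ring
    have h5 : 0 ≤ ∏ i, a i (f i) * R ^ (f i) :=
      Finset.prod_nonneg fun i _ => mul_nonneg (ha _ _) (by positivity)
    rw [h4, ← mul_assoc]
    refine mul_le_mul h2 h3 (by positivity) (by positivity)
  · have h2 : (Matrix.of fun i j => a i (f i) * t j ^ (f i)).det = 0 := by
      have h3 : (Matrix.of fun i j => a i (f i) * t j ^ (f i))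
        = Matrix.of fun i j => a i (f i) * (Matrix.of fun i j => t j ^ (f i)) i j := rfl
      rw [h3, Matrix.det_mul_column]
      simp only [Function.Injective, not_forall] at hf
      obtain ⟨x, y, hxy, hne⟩ := hf
      rw [Matrix.det_zero_of_row_eq hne, mul_zero]
      ext j; simp [hxy]
    rw [h2]; simp only [abs_zero, zero_mul]
    refine mul_nonneg (by positivity) (Finset.prod_nonneg fun i _ => mul_nonneg (ha _ _) (by positivity))

lemma pow_exp_series (k : ℕ) (c t : ℝ) (H : ℕ) :
    ∑ m ∈ range (k + H), (if k ≤ m then c ^ (m - k) / (m - k).factorial else 0) * t ^ m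
      = t ^ k * ∑ m ∈ range H, (c * t) ^ m / m.factorial := by
  rw [Finset.sum_range_add, Finset.sum_eq_zero, zero_add, Finset.mul_sum]
  · refine Finset.sum_congr rfl fun m _ => ?_
    simp [pow_add, mul_pow]; ring
  · intro m hm
    rw [mem_range] at hm
    simp [not_le.mpr hm]

lemma tendsto_pow_exp (k : ℕ) (c t : ℝ) :
    Filter.Tendsto (fun H => ∑ m ∈ range H, (if k ≤ m then c ^ (m - k) / (m - k).factorial else 0) * t ^ m)
      Filter.atTop (nhds (t ^ k * Real.exp (c * t))) := by
  have h1 : Filter.Tendsto (fun H => t ^ k * ∑ m ∈ range H, (c * t) ^ m / m.factorial) Filter.atTop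
      (nhds (t ^ k * Real.exp (c * t))) := by
    refine Filter.Tendsto.const_mul _ ?_
    have := (NormedSpace.expSeries_div_hasSum_exp (c * t)).tendsto_sum_nat
    rw [← Real.exp_eq_exp_ℝ] at this
    exact this
  simp_rw [← pow_exp_series] at h1
  have h2 := (Filter.tendsto_add_atTop_iff_nat (f := (fun H => ∑ m ∈ range H, (if k ≤ m then c ^ (m - k) / (m - k).factorial else 0) * t ^ m)) (l := nhds (t ^ k * Real.exp (c * t))) k).mp
  refine h2 ?_
  simpa [add_comm] using h1

lemma det_pow_exp {ι : Type} [Fintype ι] [DecidableEq ι] (k : ι → ℕ) (c : ι → ℝ) (hc : ∀ i, 0 ≤ c i)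
    (t : ι → ℝ) (R ρ : ℝ) (hR : ∀ j, |t j| ≤ R) (hR0 : 0 ≤ R) (hρ : 1 ≤ ρ) :
    |(Matrix.of fun i j => t j ^ k i * Real.exp (c i * t j)).det| *
        ρ ^ (Fintype.card ι * (Fintype.card ι - 1) / 2)
      ≤ (Fintype.card ι).factorial * ∏ i, ((ρ * R) ^ k i * Real.exp (c i * (ρ * R))) := by
  set a : ι → ℕ → ℝ := fun i m => if k i ≤ m then c i ^ (m - k i) / (m - k i).factorial else 0 with ha
  have ha0 : ∀ i m, 0 ≤ a i m := by
    intro i m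
    simp only [ha]
    split_ifs
    · have := hc i; positivity
    · exact le_rfl
  have h1 := det_series a ha0 t R ρ hR hR0 hρ
  refine le_of_tendsto_of_tendsto' (b := Filter.atTop) ?_ ?_ h1
  · refine Filter.Tendsto.mul_const _ ?_
    refine Filter.Tendsto.abs ?_
    have hcont : Continuous (fun M : Matrix ι ι ℝ => M.det) := continuous_id.matrix_det
    refine (hcont.tendsto _).comp ?_
    refine tendsto_pi_nhds.mpr fun i => tendsto_pi_nhds.mpr fun j => ?_
    exact tendsto_pow_exp (k i) (c i) (t j)
  · refine Filter.Tendsto.const_mul _ ?_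
    exact tendsto_finsetProd _ fun i _ => tendsto_pow_exp (k i) (c i) (ρ * R)

lemma prod_perturb {ι : Type} (s : Finset ι) (x x' C : ι → ℝ) (δ : ℝ)
    (hδ : 0 ≤ δ) (h : ∀ i, |x i| ≤ C i) (h' : ∀ i, |x' i - x i| ≤ C i * δ) :
    |∏ i ∈ s, x' i - ∏ i ∈ s, x i| ≤ (∏ i ∈ s, C i) * ((1 + δ) ^ s.card - 1) := by
  classical
  have hC : ∀ i, 0 ≤ C i := fun i => (abs_nonneg _).trans (h i)
  induction s using Finset.induction_on with
  | empty => simp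
  | insert a s ha ih =>
    rw [prod_insert ha, prod_insert ha, prod_insert ha, card_insert_of_notMem ha]
    have e : x' a * ∏ i ∈ s, x' i - x a * ∏ i ∈ s, x i
      = x' a * (∏ i ∈ s, x' i - ∏ i ∈ s, x i) + (x' a - x a) * ∏ i ∈ s, x i := by ring
    have h1 : |x' a| ≤ C a * (1 + δ) := by
      have e2 : x' a = x a + (x' a - x a) := by ring
      rw [e2]; refine (abs_add_le _ _).trans ?_
      linarith [h a, h' a]
    have h2 : |∏ i ∈ s, x i| ≤ ∏ i ∈ s, C i := by
      rw [Finset.abs_prod]; exact Finset.prod_le_prod (fun i _ => abs_nonneg _) (fun i _ => h i)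
    rw [e]
    refine (abs_add_le _ _).trans ?_
    rw [abs_mul, abs_mul]
    have hCa := hC a
    have := mul_le_mul h1 ih (abs_nonneg _) (by positivity)
    have := mul_le_mul (h' a) h2 (abs_nonneg _) (by positivity)
    calc _ ≤ C a * (1 + δ) * ((∏ i ∈ s, C i) * ((1 + δ) ^ #s - 1)) + C a * δ * ∏ i ∈ s, C i := by linarith
      _ = _ := by ring

lemma det_perturb {ι : Type} [Fintype ι] [DecidableEq ι] (M M' : Matrix ι ι ℝ) (C : ι → ℝ) (δ : ℝ)
    (hδ : 0 ≤ δ) (h : ∀ i j, |M i j| ≤ C i) (h' : ∀ i j, |M' i j - M i j| ≤ C i * δ)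
    (hN : Fintype.card ι * δ ≤ 1) :
    |M'.det| ≤ |M.det| + (Fintype.card ι).factorial * (∏ i, C i) * (2 * Fintype.card ι * δ) := by
  have key : |M'.det - M.det| ≤ (Fintype.card ι).factorial * (∏ i, C i) * (2 * Fintype.card ι * δ) := by
    rw [← Matrix.det_transpose, ← Matrix.det_transpose M, Matrix.det_apply, Matrix.det_apply,
      ← Finset.sum_sub_distrib]
    refine (Finset.abs_sum_le_sum_abs _ _).trans ?_
    have : ∀ σ : Equiv.Perm ι, |Equiv.Perm.sign σ • ∏ i, M'.transpose (σ i) i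
        - Equiv.Perm.sign σ • ∏ i, M.transpose (σ i) i| ≤ (∏ i, C i) * (2 * Fintype.card ι * δ) := by
      intro σ
      have h1 : |Equiv.Perm.sign σ • ∏ i, M'.transpose (σ i) i - Equiv.Perm.sign σ • ∏ i, M.transpose (σ i) i|
        = |∏ i, M' i (σ i) - ∏ i, M i (σ i)| := by
        rcases Int.units_eq_one_or (Equiv.Perm.sign σ) with h | h
        · simp [h]
        · simp only [h, Units.smul_def, Matrix.transpose_apply]
          rw [← smul_sub]; simp
          rw [← abs_neg]; congr 1; ring
      rw [h1]
      refine (prod_perturb univ _ _ C δ hδ (fun i => h i _) (fun i => h' i _)).trans ?_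
      have hC : ∀ i, 0 ≤ C i := fun i => (abs_nonneg _).trans (h i i)
      refine mul_le_mul_of_nonneg_left ?_ (Finset.prod_nonneg fun i _ => hC i)
      have h2 : (1 + δ) ^ Fintype.card ι ≤ Real.exp (Fintype.card ι * δ) := by
        rw [Real.exp_nat_mul]
        exact pow_le_pow_left₀ (by positivity) (by linarith [Real.add_one_le_exp δ]) _
      have h3 := Real.abs_exp_sub_one_le (x := Fintype.card ι * δ) (by rwa [abs_of_nonneg (by positivity)])
      rw [abs_of_nonneg (a := Fintype.card ι * δ) (by positivity)] at h3
      have := le_of_abs_le h3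
      rw [Finset.card_univ]; linarith
    refine (Finset.sum_le_sum (fun σ _ => this σ)).trans ?_
    rw [Finset.sum_const, Finset.card_univ, Fintype.card_perm, nsmul_eq_mul]
    exact le_of_eq (by ring)
  have e : M'.det = M.det + (M'.det - M.det) := by ring
  rw [e]; refine (abs_add_le _ _).trans ?_
  linarith

end

section
open Finset

lemma zero_core (m : ℕ) (P : Fin m → Polynomial ℝ) (hP : ∀ l, P l ≠ 0) (hm : 0 < m)
    (e : Fin m → ℕ) (he : Function.Injective e) (Θ q : ℝ) (hΘ : 0 < Θ) (hΘ1 : Θ ≠ 1) (S : Finset ℝ)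
    (hS : ∀ n ∈ S, ∃ ε : ℝ, ε ≠ 0 ∧ ∀ i : Fin m, ∑ l, (P l).eval (n + i * q) * (Θ ^ (i:ℕ) * ε) ^ e l = 0)
    (hc : ∑ l, (P l).natDegree < S.card) : False := by
  classical
  set D : Matrix (Fin m) (Fin m) (Polynomial ℝ) :=
    Matrix.of fun l i => Polynomial.C ((Θ ^ e l) ^ (i:ℕ)) * Polynomial.taylor ((i:ℕ) * q) (P l) with hD
  have hne : ∀ l i, D l i ≠ 0 := by
    intro l i
    simp only [hD, Matrix.of_apply]
    refine mul_ne_zero (by rw [Polynomial.C_ne_zero]; positivity) ?_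
    intro h
    exact hP l ((Polynomial.taylor_injective ((i:ℕ) * q : ℝ)) (by rw [h, map_zero]))
  have hdeg : ∀ l i, (D l i).natDegree = (P l).natDegree := by
    intro l i
    simp only [hD, Matrix.of_apply]
    rw [Polynomial.natDegree_C_mul (by positivity), Polynomial.natDegree_taylor]
  have hlc : ∀ l i, (D l i).leadingCoeff = (P l).leadingCoeff * (Matrix.vandermonde (fun l => Θ ^ e l)) l i := by
    intro l i
    simp only [hD, Matrix.of_apply, Matrix.vandermonde_apply]
    rw [Polynomial.leadingCoeff_mul, Polynomial.leadingCoeff_C, Polynomial.leadingCoeff_taylor, mul_comm]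
  have hpd : ∀ σ : Equiv.Perm (Fin m), (∏ l, D.transpose (σ l) l).natDegree = ∑ l, (P l).natDegree := by
    intro σ
    simp only [Matrix.transpose_apply]
    rw [Polynomial.natDegree_prod _ _ (fun i _ => hne _ _)]
    exact Finset.sum_congr rfl fun l _ => hdeg _ _
  have hcoef : D.det.coeff (∑ l, (P l).natDegree) =
      (∏ l, (P l).leadingCoeff) * (Matrix.vandermonde (fun l => Θ ^ e l)).det := by
    rw [← Matrix.det_mul_column, ← Matrix.det_transpose, Matrix.det_apply, ← Matrix.det_transpose, Matrix.det_apply,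
      Polynomial.finsetSum_coeff]
    refine Finset.sum_congr rfl fun σ _ => ?_
    rw [Units.smul_def, Units.smul_def, Polynomial.coeff_smul]
    congr 1
    rw [← hpd σ, Polynomial.coeff_natDegree, Polynomial.leadingCoeff_prod]
    refine Finset.prod_congr rfl fun l _ => ?_
    simp only [Matrix.transpose_apply, Matrix.of_apply]
    rw [hlc]
  have hinj : Function.Injective (fun l => Θ ^ e l) := by
    intro a b hab
    exact he (pow_right_injective₀ hΘ hΘ1 hab)
  have hdetdeg : D.det.natDegree ≤ ∑ l, (P l).natDegree := by
    rw [← Matrix.det_transpose, Matrix.det_apply]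
    refine Polynomial.natDegree_sum_le_of_forall_le _ _ fun σ _ => ?_
    rw [Units.smul_def]
    exact (Polynomial.natDegree_smul_le _ _).trans (hpd σ).le
  have hzero : D.det = 0 := by
    refine Polynomial.eq_zero_of_natDegree_lt_card_of_eval_eq_zero' _ S ?_ (hdetdeg.trans_lt hc)
    intro n hn
    obtain ⟨ε, hε, hz⟩ := hS n hn
    rw [← Polynomial.coe_evalRingHom, RingHom.map_det, ← Matrix.det_transpose, ← Matrix.exists_mulVec_eq_zero_iff]
    refine ⟨fun l => ε ^ e l, ?_, ?_⟩
    · intro h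
      have := congrFun h ⟨0, hm⟩
      exact pow_ne_zero _ hε this
    · ext i
      simp only [Matrix.mulVec, dotProduct, Pi.zero_apply]
      rw [← hz i]
      refine Finset.sum_congr rfl fun l _ => ?_
      simp only [Matrix.transpose_apply, RingHom.mapMatrix_apply, Matrix.map_apply, hD, Matrix.of_apply,
        Polynomial.coe_evalRingHom, Polynomial.eval_mul, Polynomial.eval_C, Polynomial.taylor_eval]
      rw [mul_pow, ← pow_mul, ← pow_mul, mul_comm (e l)]; ring
  rw [hzero, Polynomial.coeff_zero] at hcoef
  have : (∏ l, (P l).leadingCoeff) * (Matrix.vandermonde (fun l => Θ ^ e l)).det ≠ 0 := by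
    refine mul_ne_zero (Finset.prod_ne_zero_iff.mpr fun l _ => ?_) (Matrix.det_vandermonde_ne_zero_iff.mpr hinj)
    simpa using hP l
  exact this hcoef.symm

lemma cols_exists {ι Ω : Type} [Fintype ι] [DecidableEq ι] (w : Ω → ι → ℝ)
    (h : ∀ f : ι → ℝ, (∀ ω, ∑ i, f i * w ω i = 0) → f = 0) :
    ∃ c : ι → Ω, (Matrix.of fun i j => w (c j) i).det ≠ 0 := by
  classical
  have hs : Submodule.span ℝ (Set.range w) = ⊤ := by
    by_contra hne
    obtain ⟨f, hf, hk⟩ := Submodule.exists_le_ker_of_lt_top _ (lt_top_iff_ne_top.mpr hne)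
    apply hf
    have h1 := h (fun i => f (Pi.single i 1)) (by
      intro ω
      have : f (w ω) = 0 := hk (Submodule.subset_span ⟨ω, rfl⟩)
      rw [← this]
      conv_rhs => rw [← Finset.univ_sum_single (w ω)]
      rw [map_sum]
      refine Finset.sum_congr rfl fun i _ => ?_
      rw [show (Pi.single i (w ω i) : ι → ℝ) = (w ω i) • Pi.single i 1 by
        rw [← Pi.single_smul]; simp, map_smul, smul_eq_mul, mul_comm])
    refine LinearMap.pi_ext' fun i => ?_
    ext
    simpa using congrFun h1 i
  obtain ⟨κ, a, ha, hsp, hli⟩ := exists_linearIndependent' ℝ w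
  rw [hs] at hsp
  let b := Module.Basis.mk hli hsp.ge
  let b0 := Pi.basisFun ℝ ι
  let e : ι ≃ κ := b0.indexEquiv b
  refine ⟨fun j => a (e j), ?_⟩
  have h2 : LinearIndependent ℝ (fun j => w (a (e j))) := hli.comp e e.injective
  have h3 : IsUnit (Matrix.of fun i j => w (a (e j)) i) := by
    rw [← Matrix.linearIndependent_cols_iff_isUnit]
    exact h2
  rw [Matrix.isUnit_iff_isUnit_det] at h3
  exact h3.ne_zero

lemma exists_minor (K L A V p q : ℕ) (Θ Φ : ℝ) (hΘ : 0 < Θ) (hΘ1 : Θ ≠ 1) (hΦ : 0 < Φ)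
    (hpq : Nat.Coprime p q) (hV : V ≤ q) (hq : 0 < q) (hK : L * K < A * V) :
    ∃ c : Fin K × Fin L → Fin (A + L) × Fin V,
      (Matrix.of fun (i : Fin K × Fin L) j =>
        (((c j).1 : ℕ) * (q:ℝ) - ((c j).2 : ℕ) * (p:ℝ)) ^ (i.1 : ℕ) *
          (Θ ^ ((c j).1 : ℕ) * Φ ^ ((c j).2 : ℕ)) ^ (i.2 : ℕ)).det ≠ 0 := by
  classical
  apply cols_exists (fun (ω : Fin (A + L) × Fin V) (i : Fin K × Fin L) =>
        ((ω.1 : ℕ) * (q:ℝ) - (ω.2 : ℕ) * (p:ℝ)) ^ (i.1 : ℕ) *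
          (Θ ^ (ω.1 : ℕ) * Φ ^ (ω.2 : ℕ)) ^ (i.2 : ℕ))
  intro f hf
  by_contra hne
  let P : Fin L → Polynomial ℝ := fun l => ∑ k : Fin K, Polynomial.monomial (k:ℕ) (f (k, l))
  have hPe : ∀ l x, (P l).eval x = ∑ k : Fin K, f (k, l) * x ^ (k:ℕ) := by
    intro l x; simp [P, Polynomial.eval_finsetSum]
  have hPd : ∀ l, (P l).natDegree ≤ K := by
    intro l
    refine Polynomial.natDegree_sum_le_of_forall_le _ _ fun k _ => ?_
    exact (Polynomial.natDegree_monomial_le _).trans k.2.le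
  have hPc : ∀ l (k : Fin K), (P l).coeff k = f (k, l) := by
    intro l k
    simp only [P, Polynomial.finsetSum_coeff, Polynomial.coeff_monomial]
    rw [Finset.sum_eq_single k]
    · simp
    · intro b _ hb; rw [if_neg]; intro h; exact hb (Fin.ext h)
    · simp
  let s : Finset (Fin L) := univ.filter fun l => P l ≠ 0
  have hs : s.Nonempty := by
    rw [Finset.nonempty_iff_ne_empty]
    intro h
    apply hne
    ext ⟨k, l⟩
    have : P l = 0 := by
      by_contra h2
      have : l ∈ s := by simp [s, h2]
      rw [h] at this; simp at this
    rw [← hPc, this]; simp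
  let em := s.equivFin
  let S : Finset ℝ := (univ : Finset (Fin A × Fin V)).image fun ω => ((ω.1 : ℕ) * (q:ℝ) - (ω.2 : ℕ) * (p:ℝ))
  have hScard : S.card = A * V := by
    rw [Finset.card_image_of_injective]
    · simp
    · rintro ⟨r, v⟩ ⟨r', v'⟩ h
      simp only at h
      have hz : ((r:ℕ):ℤ) * q - (v:ℕ) * p = (r':ℕ) * q - (v':ℕ) * p := by exact_mod_cast h
      have hd : (q:ℤ) ∣ (((v:ℕ):ℤ) - (v':ℕ)) := by
        have : (q:ℤ) ∣ p * (((v:ℕ):ℤ) - (v':ℕ)) := ⟨(r:ℕ) - (r':ℕ), by linarith⟩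
        exact (Int.isCoprime_iff_gcd_eq_one.mpr (by simpa [Int.gcd] using hpq.symm)).dvd_of_dvd_mul_left this
      have hv : ((v:ℕ):ℤ) - (v':ℕ) = 0 := by
        refine Int.eq_zero_of_abs_lt_dvd hd ?_
        rw [abs_lt]
        have := v.2; have := v'.2
        constructor <;> omega
      have hv' : (v:ℕ) = v' := by omega
      have hr : ((r:ℕ):ℤ) * q = (r':ℕ) * q := by rw [hv'] at hz; linarith
      have hr' : (r:ℕ) = r' := by
        have := mul_right_cancel₀ (by positivity) hr
        exact_mod_cast this
      exact Prod.ext (Fin.ext hr') (Fin.ext hv')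
  have hsL : s.card ≤ L := by simpa using s.card_le_univ
  refine zero_core s.card (fun i => P (em.symm i)) ?_ (Finset.card_pos.mpr hs) (fun i => ((em.symm i : Fin L) : ℕ)) ?_
    Θ q hΘ hΘ1 S ?_ ?_
  · intro l
    exact (Finset.mem_filter.mp (em.symm l).2).2
  · intro a b h
    exact em.symm.injective (Subtype.ext (Fin.ext h))
  · intro n hn
    obtain ⟨⟨r, v⟩, _, rfl⟩ := Finset.mem_image.mp hn
    refine ⟨Θ ^ (r:ℕ) * Φ ^ (v:ℕ), by positivity, ?_⟩
    intro i
    have h1 := hf (⟨i + r, by have := i.2; have := r.2; omega⟩, v)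
    rw [Fintype.sum_prod_type_right] at h1
    have h2 : ∑ l ∈ s, (P l).eval (((r:ℕ):ℝ) * q - (v:ℕ) * p + (i:ℕ) * q) * (Θ ^ (i:ℕ) * (Θ ^ (r:ℕ) * Φ ^ (v:ℕ))) ^ (l:ℕ) = 0 := by
      rw [← h1]
      rw [Finset.sum_filter_of_ne]
      · refine Finset.sum_congr rfl fun l _ => ?_
        rw [hPe, Finset.sum_mul]
        refine Finset.sum_congr rfl fun k _ => ?_
        push_cast
        rw [pow_add]; ring
      · intro l _ h h0
        rw [h0] at h; simp at h
    rw [← h2, ← Finset.sum_coe_sort s]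
    exact em.symm.sum_comp (fun l : s => (P l).eval (((r:ℕ):ℝ) * q - (v:ℕ) * p + (i:ℕ) * q) * (Θ ^ (i:ℕ) * (Θ ^ (r:ℕ) * Φ ^ (v:ℕ))) ^ ((l:Fin L):ℕ))
  · rw [hScard]
    refine lt_of_le_of_lt (Finset.sum_le_sum fun i _ => hPd _) ?_
    simp only [Finset.sum_const, Finset.card_univ, Fintype.card_fin, smul_eq_mul]
    exact lt_of_le_of_lt (Nat.mul_le_mul_right _ hsL) hK

end

section
open Finset

lemma num_base (q : ℕ) (hq : 10 ^ 30 ≤ q) : ∃ L : ℕ, 552 ≤ L ∧ 8 * Real.log q ≤ L ∧ (L:ℝ) ≤ 9 * Real.log q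
    ∧ 69 ≤ Real.log q ∧ (10:ℝ) ^ 10 * (L:ℝ) ^ 4 ≤ q := by
  have hq' : (10:ℝ) ^ 30 ≤ q := by exact_mod_cast hq
  have hq0 : (0:ℝ) < q := lt_of_lt_of_le (by positivity) hq'
  have h69 : 69 ≤ Real.log q := by
    rw [Real.le_log_iff_exp_le hq0]
    refine le_trans ?_ hq'
    have : Real.exp 69 = Real.exp 1 ^ 69 := by rw [← Real.exp_nat_mul]; norm_num
    rw [this]
    calc Real.exp 1 ^ 69 ≤ (2.7182818286:ℝ) ^ 69 := pow_le_pow_left₀ (Real.exp_pos _).le Real.exp_one_lt_d9.le _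
      _ ≤ _ := by norm_num
  set y := Real.log q with hy
  have hexp : Real.exp y = q := Real.exp_log hq0
  refine ⟨⌈8 * y⌉₊, ?_, Nat.le_ceil _, ?_, h69, ?_⟩
  · have : (552:ℝ) ≤ ⌈8 * y⌉₊ := le_trans (by linarith) (Nat.le_ceil _)
    exact_mod_cast this
  · have := Nat.ceil_lt_add_one (a := 8 * y) (by linarith)
    linarith
  · have h1 : (⌈8 * y⌉₊ : ℝ) ≤ 9 * y := by
      have := Nat.ceil_lt_add_one (a := 8 * y) (by linarith)
      linarith
    have h2 : y ≤ 16 * Real.exp (y / 16) := by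
      have := Real.add_one_le_exp (y / 16); linarith
    have h3 : (⌈8 * y⌉₊ : ℝ) ^ 4 ≤ (144 * Real.exp (y / 16)) ^ 4 :=
      pow_le_pow_left₀ (by positivity) (by linarith) 4
    rw [mul_pow, ← Real.exp_nat_mul] at h3
    have h4 : Real.exp ((4:ℕ) * (y / 16)) * Real.exp 51 ≤ Real.exp y := by
      rw [← Real.exp_add]; apply Real.exp_le_exp.mpr; push_cast; linarith
    have h5 : (10:ℝ) ^ 10 * 144 ^ 4 ≤ Real.exp 51 := by
      have : Real.exp 51 = Real.exp 1 ^ 51 := by rw [← Real.exp_nat_mul]; norm_num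
      rw [this]
      calc _ ≤ (2.7182818283:ℝ) ^ 51 := by norm_num
        _ ≤ _ := pow_le_pow_left₀ (by norm_num) Real.exp_one_gt_d9.le _
    rw [hexp] at h4
    have := mul_le_mul_of_nonneg_left h5 (Real.exp_pos ((4:ℕ) * (y / 16))).le
    nlinarith

lemma sum_fst (K L : ℕ) : (∑ i : Fin K × Fin L, ((i.1 : ℕ) : ℝ)) ≤ (K * L : ℝ) * K / 2 := by
  rw [Fintype.sum_prod_type]
  simp only [Finset.sum_const, Finset.card_univ, Fintype.card_fin, nsmul_eq_mul]
  rw [← Finset.mul_sum, Fin.sum_univ_eq_sum_range (fun i => ((i:ℕ):ℝ)) K]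
  have : (∑ i ∈ range K, (i:ℝ)) ≤ (K:ℝ) * K / 2 := by
    induction K with
    | zero => simp
    | succ k ih => rw [sum_range_succ]; push_cast; nlinarith
  have h2 := mul_le_mul_of_nonneg_left this (Nat.cast_nonneg (α := ℝ) L)
  nlinarith

lemma sum_snd (K L : ℕ) : (∑ i : Fin K × Fin L, ((i.2 : ℕ) : ℝ)) ≤ (K * L : ℝ) * L / 2 := by
  rw [Fintype.sum_prod_type_right]
  simp only [Finset.sum_const, Finset.card_univ, Fintype.card_fin, nsmul_eq_mul]
  rw [← Finset.mul_sum, Fin.sum_univ_eq_sum_range (fun i => ((i:ℕ):ℝ)) L]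
  have : (∑ i ∈ range L, (i:ℝ)) ≤ (L:ℝ) * L / 2 := by
    induction L with
    | zero => simp
    | succ k ih => rw [sum_range_succ]; push_cast; nlinarith
  have h2 := mul_le_mul_of_nonneg_left this (Nat.cast_nonneg (α := ℝ) K)
  nlinarith

lemma prod_le_exp (K L : ℕ) (r b : ℝ) (hr : 0 ≤ r) (hb : 0 ≤ b) :
    ∏ i : Fin K × Fin L, (Real.exp r ^ (i.1:ℕ) * Real.exp ((i.2:ℕ) * b))
      ≤ Real.exp ((K * L) * (r * K / 2 + b * L / 2)) := by
  have : ∀ i : Fin K × Fin L, (Real.exp r ^ (i.1:ℕ) * Real.exp ((i.2:ℕ) * b))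
      = Real.exp (r * (i.1:ℕ) + b * (i.2:ℕ)) := by
    intro i
    rw [← Real.exp_nat_mul, ← Real.exp_add]; congr 1; ring
  simp_rw [this]
  rw [← Real.exp_sum]
  apply Real.exp_le_exp.mpr
  rw [Finset.sum_add_distrib, ← Finset.mul_sum, ← Finset.mul_sum]
  have h1 := mul_le_mul_of_nonneg_left (sum_fst K L) hr
  have h2 := mul_le_mul_of_nonneg_left (sum_snd K L) hb
  linarith

lemma fact_le_exp (N : ℕ) (hN : 0 < N) : (N.factorial : ℝ) ≤ Real.exp (N * Real.log N) := by
  have : (N.factorial : ℝ) ≤ (N:ℝ) ^ N := by exact_mod_cast Nat.factorial_le_pow N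
  refine this.trans (le_of_eq ?_)
  rw [Real.exp_nat_mul, Real.exp_log (by exact_mod_cast hN)]

end

section
open Finset

lemma num_logs (q L : ℝ) (hL : 552 ≤ L) (hq : 0 < q) (h8 : 8 * Real.log q ≤ L) :
    Real.log (q * (1815 * L)) ≤ L * (1/8 + 1/1024) + 13.6 ∧ Real.log (39999 * L * L) ≤ 23.1 + L / 512 := by
  have l2 := Real.log_two_lt_d9
  have hL0 : 0 < L := by linarith
  have h1 : Real.log L ≤ L / 1024 + 5.94 := by
    have e : L = (L / 1024) * 2 ^ 10 := by ring
    have := Real.log_le_sub_one_of_pos (x := L / 1024) (by positivity)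
    rw [e, Real.log_mul (by positivity) (by positivity), Real.log_pow]
    push_cast
    have e2 : L / 1024 * 2 ^ 10 / 1024 = L / 1024 := by ring
    rw [e2]; linarith
  have h2 : Real.log 1815 ≤ 7.63 := by
    have : Real.log 1815 ≤ Real.log (2 ^ 11) := Real.log_le_log (by norm_num) (by norm_num)
    rw [Real.log_pow] at this; push_cast at this; linarith
  have h3 : Real.log 39999 ≤ 11.1 := by
    have : Real.log 39999 ≤ Real.log (2 ^ 16) := Real.log_le_log (by norm_num) (by norm_num)
    rw [Real.log_pow] at this; push_cast at this; linarith
  constructor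
  · rw [Real.log_mul hq.ne' (by positivity), Real.log_mul (by norm_num) hL0.ne']
    linarith
  · rw [Real.log_mul (by positivity) hL0.ne', Real.log_mul (by norm_num) hL0.ne']
    linarith

lemma num_I (q L : ℝ) (hL : 552 ≤ L) (hq : 0 < q) (h8 : 8 * Real.log q ≤ L) (ρ : ℝ) (hρ : ρ ≤ 7.4) :
    4 * Real.log (39999 * L * L) - (39999 * L * L - 1) +
      (2 + 4 * Real.log (q * (1815 * L))) * (39999 * L) / 2
      + (ρ * (1815 * L) + 1815 * L + 2 * (5701 * L)) * L / 2 ≤ -2 := by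
  obtain ⟨h1, h2⟩ := num_logs q L hL hq h8
  set r := Real.log (q * (1815 * L))
  set n := Real.log (39999 * L * L)
  have h3 : r * L ≤ (L * (1/8 + 1/1024) + 13.6) * L := mul_le_mul_of_nonneg_right h1 (by linarith)
  have h4 : ρ * (L * L) ≤ 7.4 * (L * L) := mul_le_mul_of_nonneg_right hρ (by positivity)
  nlinarith

lemma num_II (q L : ℝ) (hL : 552 ≤ L) (h8 : 8 * Real.log q ≤ L)
    (hq : (10:ℝ) ^ 10 * L ^ 4 ≤ q) :
    (39999 * L * L) * (4 * Real.log (39999 * L * L) +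
      (4 * Real.log (q * (1815 * L))) * (39999 * L) / 2
      + (2 * (1815 * L) + 2 * (5701 * L)) * L / 2) + 2 * Real.log (39999 * L * L) - q ≤ -2 := by
  have hq0 : 0 < q := lt_of_lt_of_le (by positivity) hq
  obtain ⟨h1, h2⟩ := num_logs q L hL hq0 h8
  set r := Real.log (q * (1815 * L))
  set n := Real.log (39999 * L * L)
  have h3 : r * L ≤ (L * (1/8 + 1/1024) + 13.6) * L := mul_le_mul_of_nonneg_right h1 (by linarith)
  have h5 : (4 * n + (4 * r) * (39999 * L) / 2
      + (2 * (1815 * L) + 2 * (5701 * L)) * L / 2) ≤ 40000 * L * L := by nlinarith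
  have h6 := mul_le_mul_of_nonneg_left h5 (show 0 ≤ 39999 * L * L by positivity)
  have h7 : (1:ℝ) ≤ L ^ 3 := one_le_pow₀ (by linarith)
  have h8 : L ≤ L ^ 4 := by nlinarith
  nlinarith

end

section
open Finset

lemma place_bound (K L : ℕ) (hN : 0 < K * L) (n w : Fin K × Fin L → ℝ) (r P : ℝ) (hr : 0 ≤ r) (hP : 0 ≤ P)
    (hn : ∀ j, |n j| ≤ Real.exp r) (hw : ∀ j, |w j| ≤ P) :
    |(Matrix.of fun (i j : Fin K × Fin L) => n j ^ (i.1:ℕ) * Real.exp ((i.2:ℕ) * w j)).det| ≤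
      Real.exp ((K * L) * (Real.log (K * L) + r * K / 2 + P * L / 2)) := by
  have h1 := det_abs_le (Matrix.of fun (i j : Fin K × Fin L) => n j ^ (i.1:ℕ) * Real.exp ((i.2:ℕ) * w j))
    (fun i => Real.exp r ^ (i.1:ℕ) * Real.exp ((i.2:ℕ) * P)) (by
      intro i j
      simp only [Matrix.of_apply, abs_mul, abs_pow, Real.abs_exp]
      refine mul_le_mul (pow_le_pow_left₀ (abs_nonneg _) (hn j) _) ?_ (by positivity) (by positivity)
      apply Real.exp_le_exp.mpr
      exact mul_le_mul_of_nonneg_left (le_of_abs_le (hw j)) (by positivity))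
  refine h1.trans ?_
  have h2 := prod_le_exp K L r P hr hP
  have h3 := fact_le_exp (K * L) hN
  simp only [Fintype.card_prod, Fintype.card_fin]
  refine (mul_le_mul h3 h2 (Finset.prod_nonneg fun i _ => by positivity) (by positivity)).trans ?_
  rw [← Real.exp_add]
  apply Real.exp_le_exp.mpr
  push_cast
  linarith

lemma place0_main (K L : ℕ) (hN : 0 < K * L) (n : Fin K × Fin L → ℝ) (z r B : ℝ) (hr : 0 ≤ r) (hB : 0 ≤ B)
    (hz : 0 < z) (hzB : B / z ≤ Real.exp r) (hn : ∀ j, |z * n j| ≤ B) :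
    |(Matrix.of fun (i j : Fin K × Fin L) => n j ^ (i.1:ℕ) * Real.exp ((i.2:ℕ) * (z * n j))).det| ≤
      Real.exp ((K * L) * (Real.log (K * L) - (K * L - 1) + (2 + r) * K / 2 + (Real.exp 2 * B) * L / 2)) := by
  have h1 := det_pow_exp (fun i : Fin K × Fin L => (i.1:ℕ)) (fun i => ((i.2:ℕ):ℝ)) (fun i => by positivity)
    (fun j => z * n j) B (Real.exp 2) hn hB (Real.one_le_exp (by norm_num))
  have h2 : (Matrix.of fun (i j : Fin K × Fin L) => n j ^ (i.1:ℕ) * Real.exp ((i.2:ℕ) * (z * n j))).det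
     = (∏ i : Fin K × Fin L, (z⁻¹) ^ (i.1:ℕ)) *
       (Matrix.of fun (i j : Fin K × Fin L) => (z * n j) ^ (i.1:ℕ) * Real.exp ((i.2:ℕ) * (z * n j))).det := by
    rw [← Matrix.det_mul_column]
    congr 1
    ext i j
    simp only [Matrix.of_apply]
    rw [mul_pow, inv_pow]
    have : z ^ (i.1:ℕ) ≠ 0 := by positivity
    field_simp
  rw [h2, abs_mul, abs_of_nonneg (a := ∏ i : Fin K × Fin L, (z⁻¹) ^ (i.1:ℕ)) (Finset.prod_nonneg fun i _ => by positivity)]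
  set X := |(Matrix.of fun (i j : Fin K × Fin L) => (z * n j) ^ (i.1:ℕ) * Real.exp ((i.2:ℕ) * (z * n j))).det| with hX
  simp only [Fintype.card_prod, Fintype.card_fin] at h1
  have hE : Real.exp 2 ^ (K * L * (K * L - 1) / 2) = Real.exp ((K * L) * (K * L - 1)) := by
    rw [← Real.exp_nat_mul]
    congr 1
    have h3 : (K * L * (K * L - 1) / 2) * 2 = K * L * (K * L - 1) :=
      Nat.div_mul_cancel (Nat.even_mul_pred_self _).two_dvd
    have h4 : (((K * L * (K * L - 1) / 2 * 2 : ℕ)):ℝ) = ((K * L * (K * L - 1) : ℕ) : ℝ) := by rw [h3]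
    rw [Nat.cast_mul, Nat.cast_mul (K * L), Nat.cast_sub (by omega)] at h4
    push_cast at h4 ⊢
    exact h4
  rw [hE] at h1
  have h5 : X ≤ Real.exp (-((K * L) * (K * L - 1))) * (((K * L).factorial : ℝ) *
     ∏ i : Fin K × Fin L, ((Real.exp 2 * B) ^ (i.1:ℕ) * Real.exp ((i.2:ℕ) * (Real.exp 2 * B)))) := by
    rw [Real.exp_neg, ← div_eq_inv_mul, le_div_iff₀ (Real.exp_pos _)]
    exact h1
  have h6 : (∏ i : Fin K × Fin L, (z⁻¹) ^ (i.1:ℕ)) *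
     ∏ i : Fin K × Fin L, ((Real.exp 2 * B) ^ (i.1:ℕ) * Real.exp ((i.2:ℕ) * (Real.exp 2 * B)))
     ≤ ∏ i : Fin K × Fin L, (Real.exp (2 + r) ^ (i.1:ℕ) * Real.exp ((i.2:ℕ) * (Real.exp 2 * B))) := by
    rw [← Finset.prod_mul_distrib]
    refine Finset.prod_le_prod (fun i _ => by positivity) fun i _ => ?_
    rw [← mul_assoc, ← mul_pow]
    refine mul_le_mul_of_nonneg_right (pow_le_pow_left₀ (by positivity) ?_ _) (by positivity)
    rw [Real.exp_add]
    have := mul_le_mul_of_nonneg_left hzB (Real.exp_pos 2).le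
    calc _ = Real.exp 2 * (B / z) := by rw [div_eq_mul_inv]; ring
      _ ≤ _ := this
  have h7 := h6.trans (prod_le_exp K L (2 + r) (Real.exp 2 * B) (by linarith) (by positivity))
  have h8 := fact_le_exp (K * L) hN
  have h9 := mul_le_mul_of_nonneg_left h5 (a := ∏ i : Fin K × Fin L, (z⁻¹) ^ (i.1:ℕ)) (Finset.prod_nonneg fun i _ => by positivity)
  refine h9.trans ?_
  calc _ = Real.exp (-((K * L) * (K * L - 1))) * (((K * L).factorial : ℝ) * ((∏ i : Fin K × Fin L, (z⁻¹) ^ (i.1:ℕ)) *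
     ∏ i : Fin K × Fin L, ((Real.exp 2 * B) ^ (i.1:ℕ) * Real.exp ((i.2:ℕ) * (Real.exp 2 * B))))) := by ring
    _ ≤ Real.exp (-((K * L) * (K * L - 1))) * (Real.exp ((K * L : ℕ) * Real.log (K * L : ℕ)) * Real.exp ((K * L) * ((2 + r) * K / 2 + (Real.exp 2 * B) * L / 2))) := by
        refine mul_le_mul_of_nonneg_left ?_ (Real.exp_pos _).le
        refine mul_le_mul h8 h7 ?_ (Real.exp_pos _).le
        exact mul_nonneg (Finset.prod_nonneg fun i _ => by positivity) (Finset.prod_nonneg fun i _ => by positivity)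
    _ ≤ _ := by
        rw [← Real.exp_add, ← Real.exp_add]
        apply Real.exp_le_exp.mpr
        push_cast
        linarith

lemma place0 (K L : ℕ) (hN : 0 < K * L) (n w : Fin K × Fin L → ℝ) (z r B η : ℝ) (hr : 0 ≤ r) (hB : 0 ≤ B)
    (hz : 0 < z) (hzB : B / z ≤ Real.exp r) (hn : ∀ j, |z * n j| ≤ B) (hn' : ∀ j, |n j| ≤ Real.exp r)
    (hη : 0 ≤ η) (hw : ∀ j, |w j - z * n j| ≤ η) (hLη : L * η ≤ 1) (hη2 : (K * L) * (2 * (L * η)) ≤ 1) :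
    |(Matrix.of fun (i j : Fin K × Fin L) => n j ^ (i.1:ℕ) * Real.exp ((i.2:ℕ) * w j)).det| ≤
      Real.exp ((K * L) * (Real.log (K * L) - (K * L - 1) + (2 + r) * K / 2 + (Real.exp 2 * B) * L / 2))
      + Real.exp ((K * L) * (Real.log (K * L) + r * K / 2 + B * L / 2)) * (2 * (K * L) * (2 * (L * η))) := by
  have h1 := det_perturb (Matrix.of fun (i j : Fin K × Fin L) => n j ^ (i.1:ℕ) * Real.exp ((i.2:ℕ) * (z * n j)))
    (Matrix.of fun (i j : Fin K × Fin L) => n j ^ (i.1:ℕ) * Real.exp ((i.2:ℕ) * w j))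
    (fun i => Real.exp r ^ (i.1:ℕ) * Real.exp ((i.2:ℕ) * B)) (2 * (L * η)) (by positivity) ?_ ?_ ?_
  · refine h1.trans ?_
    refine add_le_add (place0_main K L hN n z r B hr hB hz hzB hn) ?_
    simp only [Fintype.card_prod, Fintype.card_fin]
    push_cast
    refine mul_le_mul_of_nonneg_right ?_ (by positivity)
    have h2 := prod_le_exp K L r B hr hB
    have h3 := fact_le_exp (K * L) hN
    refine (mul_le_mul h3 h2 (Finset.prod_nonneg fun i _ => by positivity) (by positivity)).trans ?_
    rw [← Real.exp_add]
    apply Real.exp_le_exp.mpr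
    push_cast
    linarith
  · intro i j
    simp only [Matrix.of_apply, abs_mul, abs_pow, Real.abs_exp]
    refine mul_le_mul (pow_le_pow_left₀ (abs_nonneg _) (hn' j) _) ?_ (by positivity) (by positivity)
    apply Real.exp_le_exp.mpr
    refine mul_le_mul_of_nonneg_left ?_ (by positivity)
    exact le_of_abs_le (hn j)
  · intro i j
    simp only [Matrix.of_apply]
    have e : n j ^ (i.1:ℕ) * Real.exp ((i.2:ℕ) * w j) - n j ^ (i.1:ℕ) * Real.exp ((i.2:ℕ) * (z * n j))
      = n j ^ (i.1:ℕ) * Real.exp ((i.2:ℕ) * (z * n j)) * (Real.exp ((i.2:ℕ) * (w j - z * n j)) - 1) := by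
      rw [mul_sub, mul_one, mul_assoc, ← Real.exp_add]
      congr 3; ring
    rw [e, abs_mul, abs_mul, abs_pow, Real.abs_exp]
    have hi : ((i.2:ℕ):ℝ) ≤ L := by exact_mod_cast i.2.2.le
    have hs : |((i.2:ℕ):ℝ) * (w j - z * n j)| ≤ L * η := by
      rw [abs_mul, abs_of_nonneg (by positivity)]
      exact mul_le_mul hi (hw j) (abs_nonneg _) (by positivity)
    have h3 := Real.abs_exp_sub_one_le (x := ((i.2:ℕ):ℝ) * (w j - z * n j)) (hs.trans hLη)
    refine mul_le_mul ?_ (h3.trans (by linarith)) (abs_nonneg _) (by positivity)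
    refine mul_le_mul (pow_le_pow_left₀ (abs_nonneg _) (hn' j) _) ?_ (by positivity) (by positivity)
    apply Real.exp_le_exp.mpr
    refine mul_le_mul_of_nonneg_left ?_ (by positivity)
    exact le_of_abs_le (hn j)
  · simp only [Fintype.card_prod, Fintype.card_fin]
    push_cast
    exact hη2

end

section
open Finset

lemma aux_e1 (L E : ℝ) (hL : 552 ≤ L) (hE : 0 < E) : L * (3200 * L * E) ≤ (39999 * L * L) ^ 2 * E := by
  have h : (1:ℝ) ≤ L ^ 2 := one_le_pow₀ (by linarith)
  have : L * (3200 * L * E) = (3200 * L ^ 2) * E := by ring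
  rw [this]
  refine mul_le_mul_of_nonneg_right ?_ hE.le
  nlinarith

lemma aux_e2 (L E : ℝ) (hL : 552 ≤ L) (hE : 0 < E) :
    2 * (39999 * L * L) * (2 * (L * (3200 * L * E))) ≤ (39999 * L * L) ^ 2 * E := by
  have : 2 * (39999 * L * L : ℝ) * (2 * (L * (3200 * L * E))) = (511987200 * (L:ℝ) ^ 4) * E := by ring
  rw [this]
  refine mul_le_mul_of_nonneg_right ?_ hE.le
  have : 0 ≤ L ^ 4 := by positivity
  nlinarith

lemma aux_fin (L r lN NN E q : ℝ) (hL : 552 ≤ L) (hNN1 : 1 ≤ NN) (Z1 Z2 Z3 Z4 : ℝ)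
    (nI : 4 * lN - (NN - 1) + (2 + 4 * r) * (39999 * L) / 2
      + (E * (1815 * L) + 1815 * L + 2 * (5701 * L)) * L / 2 ≤ -2)
    (nII : NN * (4 * lN + (4 * r) * (39999 * L) / 2
      + (2 * (1815 * L) + 2 * (5701 * L)) * L / 2) + 2 * lN - q ≤ -2)
    (hl : Real.exp (2 * lN) = NN ^ 2)
    (h0 : |Z1| ≤ Real.exp (NN * (lN - (NN - 1) + (2 + r) * (39999 * L) / 2 + E * (1815 * L) * L / 2))
      + Real.exp (NN * (lN + r * (39999 * L) / 2 + 1815 * L * L / 2)) * (NN ^ 2 * Real.exp (-q)))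
    (h1 : |Z2| ≤ Real.exp (NN * (lN + r * (39999 * L) / 2 + 1814 * L * L / 2)))
    (h2 : |Z3| ≤ Real.exp (NN * (lN + r * (39999 * L) / 2 + 5701 * L * L / 2)))
    (h3 : |Z4| ≤ Real.exp (NN * (lN + r * (39999 * L) / 2 + 5701 * L * L / 2)))
    (h : 1 ≤ |Z1| * |Z2| * |Z3| * |Z4|) : False := by
  have hLL : 0 ≤ NN * (L * L) := by positivity
  have t1 := mul_le_mul_of_nonneg_left nI (show 0 ≤ NN by linarith)
  have t3 : Real.exp (-2) < 1 / 2 := by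
    rw [Real.exp_neg, inv_eq_one_div]
    apply one_div_lt_one_div_of_lt (by norm_num)
    linarith [Real.add_one_lt_exp (show (2:ℝ) ≠ 0 by norm_num)]
  rw [← hl, ← Real.exp_add, ← Real.exp_add] at h0
  have hm := mul_le_mul (mul_le_mul (mul_le_mul h0 h1 (abs_nonneg _) (by positivity)) h2 (abs_nonneg _) (by positivity)) h3 (abs_nonneg _) (by positivity)
  rw [add_mul, add_mul, add_mul, ← Real.exp_add, ← Real.exp_add, ← Real.exp_add, ← Real.exp_add, ← Real.exp_add, ← Real.exp_add] at hm
  have q1 : Real.exp (-2) + Real.exp (-2) < 1 := by linarith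
  refine absurd (h.trans (hm.trans (add_le_add (b := Real.exp (-2)) (d := Real.exp (-2)) ?_ ?_))) (not_le.mpr q1)
  · apply Real.exp_le_exp.mpr; nlinarith
  · apply Real.exp_le_exp.mpr; nlinarith

set_option maxHeartbeats 1000000 in
theorem lfl {R : Type} [CommRing R] (e0 e1 e2 e3 : R →+* ℝ)
    (hn : ∀ x, e0 x ≠ 0 → 1 ≤ |e0 x| * |e1 x| * |e2 x| * |e3 x|) (Θ Φ : R) (x y : ℝ)
    (hx : 1 ≤ x) (hx2 : x ≤ 14) (hy : |y| ≤ 1)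
    (hΘ0 : e0 Θ = Real.exp x) (hΘ1 : e1 Θ = Real.exp (-x)) (hΘ2 : e2 Θ = Real.exp y) (hΘ3 : e3 Θ = Real.exp (-y))
    (hΦ0 : e0 Φ = Real.exp y) (hΦ1 : e1 Φ = Real.exp (-y)) (hΦ2 : e2 Φ = Real.exp (-x)) (hΦ3 : e3 Φ = Real.exp x)
    (p q : ℕ) (hpq : Nat.Coprime p q) (hq : 10 ^ 30 ≤ q)
    (hsmall : |p * x + q * y| ≤ 8 * Real.exp (-q)) : False := by
  obtain ⟨L, hL, hL8, hL9, h69, hqL⟩ := num_base q hq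
  have hL' : (552:ℝ) ≤ L := by exact_mod_cast hL
  have hq0 : (0:ℝ) < q := lt_of_lt_of_le (by positivity) hqL
  obtain ⟨K, hK⟩ : ∃ K, K = 39999 * L := ⟨_, rfl⟩
  have hL3 : (1:ℝ) ≤ (L:ℝ) ^ 3 := one_le_pow₀ (by linarith)
  have hL4 : (L:ℝ) ≤ (L:ℝ) ^ 4 := by nlinarith
  have hVq : 400 * L ≤ q := by
    have : (400:ℝ) * L ≤ q := by linarith
    exact_mod_cast this
  have hKr : (K:ℝ) = 39999 * L := by rw [hK]; push_cast; ring
  have hNpos : 0 < K * L := Nat.mul_pos (by omega) (by omega)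
  obtain ⟨c, hc⟩ := exists_minor K L (100 * L) (400 * L) p q (Real.exp x) (Real.exp y) (Real.exp_pos _)
    (by intro h; rw [Real.exp_eq_one_iff] at h; linarith) (Real.exp_pos _) hpq hVq (by exact_mod_cast hq0)
    (by rw [hK]; have h1 : 0 < L * L := Nat.mul_pos (by omega) (by omega)
        have h2 : 100 * L * (400 * L) = 40000 * (L * L) := by ring
        have h3 : L * (39999 * L) = 39999 * (L * L) := by ring
        omega)
  set rr : Fin K × Fin L → ℕ := fun j => ((c j).1 : ℕ) with hrr
  set vv : Fin K × Fin L → ℕ := fun j => ((c j).2 : ℕ) with hvv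
  have hrb : ∀ j, (rr j : ℝ) ≤ 101 * L := by
    intro j
    have h := (c j).1.2
    have : rr j ≤ 101 * L := by simp only [hrr]; omega
    exact_mod_cast this
  have hvb : ∀ j, (vv j : ℝ) ≤ 400 * L := by
    intro j
    have h := (c j).2.2
    have : vv j ≤ 400 * L := by simp only [hvv]; omega
    exact_mod_cast this
  set nn : Fin K × Fin L → ℝ := fun j => (rr j : ℝ) * q - (vv j : ℝ) * p with hnn
  set D : R := (Matrix.of fun (i j : Fin K × Fin L) =>
    ((rr j : R) * (q : R) - (vv j : R) * (p : R)) ^ (i.1 : ℕ) * (Θ ^ rr j * Φ ^ vv j) ^ (i.2 : ℕ)).det with hD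
  have hmap : ∀ (e : R →+* ℝ) (a b : ℝ), e Θ = Real.exp a → e Φ = Real.exp b →
      e D = (Matrix.of fun (i j : Fin K × Fin L) => nn j ^ (i.1:ℕ) * Real.exp ((i.2:ℕ) * (rr j * a + vv j * b))).det := by
    intro e a b ha hb
    rw [hD, RingHom.map_det]
    congr 1
    ext i j
    simp only [RingHom.mapMatrix_apply, Matrix.map_apply, Matrix.of_apply, map_mul, map_pow, map_sub, map_natCast, ha, hb, hnn]
    rw [← Real.exp_nat_mul, ← Real.exp_nat_mul, ← Real.exp_add, ← Real.exp_nat_mul]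
  have hD0 : e0 D ≠ 0 := by
    rw [hmap e0 x y hΘ0 hΦ0]
    convert hc using 3
    ext i j
    simp only [hnn]
    rw [← Real.exp_nat_mul x, ← Real.exp_nat_mul y, ← Real.exp_add, ← Real.exp_nat_mul]
  have h1 := hn D hD0
  -- bounds
  set r := Real.log (q * (1815 * L)) with hrdef
  have hq1 : (10:ℝ) ^ 30 ≤ q := by exact_mod_cast hq
  have hexpr : Real.exp r = q * (1815 * L) := Real.exp_log (by positivity)
  have hr0 : 0 ≤ r := Real.log_nonneg (one_le_mul_of_one_le_of_one_le (by linarith) (by linarith))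
  have hxyB : ∀ j, |rr j * x + vv j * y| ≤ 1814 * L := by
    intro j
    have ha : |(rr j : ℝ) * x| ≤ 101 * L * 14 := by
      rw [abs_mul, Nat.abs_cast, abs_of_nonneg (by linarith)]
      exact mul_le_mul (hrb j) hx2 (by linarith) (by positivity)
    have hb : |(vv j : ℝ) * y| ≤ 400 * L * 1 := by
      rw [abs_mul, Nat.abs_cast]
      exact mul_le_mul (hvb j) hy (abs_nonneg _) (by positivity)
    have := abs_add_le ((rr j : ℝ) * x) (vv j * y)
    linarith
  have hxyP : ∀ j, |rr j * y + vv j * -x| ≤ 5701 * L := by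
    intro j
    have ha : |(rr j : ℝ) * y| ≤ 101 * L * 1 := by
      rw [abs_mul, Nat.abs_cast]
      exact mul_le_mul (hrb j) hy (abs_nonneg _) (by positivity)
    have hb : |(vv j : ℝ) * -x| ≤ 400 * L * 14 := by
      rw [abs_mul, Nat.abs_cast, abs_neg, abs_of_nonneg (by linarith)]
      exact mul_le_mul (hvb j) hx2 (by linarith) (by positivity)
    have := abs_add_le ((rr j : ℝ) * y) (vv j * -x)
    linarith
  set η : ℝ := 3200 * L * Real.exp (-q) with hη
  have hη0 : 0 ≤ η := by positivity
  -- N^2 * exp(-q) small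
  have hNr : ((K:ℝ) * L) = 39999 * L * L := by rw [hKr]
  have hlogN : Real.exp (2 * Real.log (39999 * L * L)) = (39999 * L * L : ℝ) ^ 2 := by
    rw [show (2:ℝ) * Real.log (39999 * L * L) = (2:ℕ) * Real.log (39999 * L * L) by norm_num, Real.exp_nat_mul,
      Real.exp_log (by positivity)]
  have hsm : (39999 * L * L : ℝ) ^ 2 * Real.exp (-q) ≤ 1 := by
    have e1 := Real.add_one_le_exp (q:ℝ)
    rw [Real.exp_neg, ← div_eq_mul_inv, div_le_one (Real.exp_pos _)]
    have e3 : (39999 * L * L : ℝ) ^ 2 = 1599920001 * (L:ℝ) ^ 4 := by ring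
    linarith
  have hLη : L * η ≤ 1 := by
    rw [hη]; exact le_trans (aux_e1 L _ hL' (Real.exp_pos _)) hsm
  have hηN : 2 * (K * L : ℝ) * (2 * (L * η)) ≤ (39999 * L * L : ℝ) ^ 2 * Real.exp (-q) := by
    rw [hη, hNr]; exact aux_e2 L _ hL' (Real.exp_pos _)
  have hwz : ∀ j, |(rr j * x + vv j * y) - x / q * nn j| ≤ η := by
    intro j
    have e : (rr j * x + vv j * y) - x / q * nn j = vv j * (p * x + q * y) / q := by
      simp only [hnn]; field_simp; ring
    rw [e, abs_div, abs_mul, Nat.abs_cast, abs_of_pos hq0, div_le_iff₀ hq0]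
    have := mul_le_mul (hvb j) hsmall (abs_nonneg _) (by positivity)
    refine this.trans ?_
    rw [hη]
    have h0 : 0 ≤ 3200 * L * Real.exp (-q) := by positivity
    have := le_mul_of_one_le_right h0 (show (1:ℝ) ≤ q by linarith)
    linarith
  have hη1 : η ≤ L := by
    have := le_mul_of_one_le_left hη0 (show (1:ℝ) ≤ L by linarith)
    linarith
  have hzn : ∀ j, |x / q * nn j| ≤ 1815 * L := by
    intro j
    have h2 := hwz j
    have h3 := hxyB j
    rw [abs_le] at *
    constructor <;> linarith
  have hnb : ∀ j, |nn j| ≤ Real.exp r := by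
    intro j
    have h2 := hzn j
    rw [abs_mul, abs_of_pos (by positivity), div_mul_eq_mul_div, div_le_iff₀ hq0] at h2
    rw [hexpr]
    have h3 : |nn j| ≤ x * |nn j| := le_mul_of_one_le_left (abs_nonneg _) hx
    linarith
  have b0 := place0 K L hNpos nn (fun j => rr j * x + vv j * y) (x / q) r (1815 * L) η hr0 (by positivity) (by positivity)
    (by
      rw [hexpr, div_div_eq_mul_div, div_le_iff₀ (by positivity)]
      have : (0:ℝ) ≤ q * (1815 * L) := by positivity
      have := le_mul_of_one_le_right this hx
      linarith) hzn hnb hη0 hwz hLη (by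
        have : (0:ℝ) ≤ (K * L : ℝ) * (2 * (L * η)) := by positivity
        linarith)
  have b1 := place_bound K L hNpos nn (fun j => rr j * -x + vv j * -y) r (1814 * L) hr0 (by positivity) hnb (by
    intro j; rw [← abs_neg]; have := hxyB j; convert this using 2; ring)
  have b2 := place_bound K L hNpos nn (fun j => rr j * y + vv j * -x) r (5701 * L) hr0 (by positivity) hnb hxyP
  have b3 := place_bound K L hNpos nn (fun j => rr j * -y + vv j * x) r (5701 * L) hr0 (by positivity) hnb (by
    intro j; rw [← abs_neg]; have := hxyP j; convert this using 2; ring)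
  rw [← hmap e0 x y hΘ0 hΦ0] at b0
  rw [← hmap e1 _ _ hΘ1 hΦ1] at b1
  rw [← hmap e2 _ _ hΘ2 hΦ2] at b2
  rw [← hmap e3 _ _ hΘ3 hΦ3] at b3
  have e2le : Real.exp 2 ≤ 7.4 := by
    have : Real.exp 2 = Real.exp 1 ^ 2 := by rw [← Real.exp_nat_mul]; norm_num
    rw [this]
    calc Real.exp 1 ^ 2 ≤ (2.7182818286:ℝ) ^ 2 := pow_le_pow_left₀ (Real.exp_pos _).le Real.exp_one_lt_d9.le _
      _ ≤ _ := by norm_num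
  have nI := num_I q L hL' hq0 hL8 (Real.exp 2) e2le
  have nII := num_II q L hL' hL8 hqL
  rw [← hrdef] at nI nII
  rw [hNr, hKr] at b0 b1 b2 b3
  have hNN1 : (1:ℝ) ≤ 39999 * L * L := one_le_mul_of_one_le_of_one_le (by linarith) (by linarith)
  rw [hNr] at hηN
  have b0' := b0.trans (add_le_add le_rfl (mul_le_mul_of_nonneg_left hηN (Real.exp_pos _).le))
  exact aux_fin L r (Real.log (39999 * L * L)) (39999 * L * L) (Real.exp 2) q hL' hNN1 _ _ _ _ nI nII hlogN b0' b1 b2 b3 h1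

end

section

structure Fld where
  s : ℕ
  hs : 1 ≤ s
  w : ℝ
  θ : ℝ
  θ2 : ℝ
  hw : w * w = s * s + 1
  hw0 : 0 < w
  hθ : θ * θ = 2 * (s + w) * θ + 1
  hθ5 : 5 ≤ θ
  hθ2 : θ2 * (θ + 1) = θ - 1

namespace Fld
variable (F : Fld)

lemma th2_sq : F.θ2 * F.θ2 = 2 * (F.s - F.w) * F.θ2 + 1 := by
  have h5 := F.hθ5
  have h2 : F.θ2 = (F.θ - 1) / (F.θ + 1) := by rw [eq_div_iff (by linarith)]; exact F.hθ2
  have hne : F.θ + 1 ≠ 0 := by linarith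
  have hα : 2 * (F.s + F.w) * F.θ = F.θ * F.θ - 1 := by linarith [F.hθ]
  have h1 : (F.s - F.w) * (F.θ * F.θ - 1) = -2 * F.θ := by
    rw [← hα]; linear_combination (-2 * F.θ) * F.hw
  rw [h2]
  field_simp
  linear_combination 2 * (-1) * h1

lemma th2_el : F.θ2 = -1 + (F.s - F.w) - (F.s - F.w) * F.θ := by
  have h5 := F.hθ5
  have hne : F.θ + 1 ≠ 0 := by linarith
  apply mul_right_cancel₀ hne
  rw [F.hθ2]
  have hα : 2 * (F.s + F.w) * F.θ = F.θ * F.θ - 1 := by linarith [F.hθ]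
  have h1 : (F.s - F.w) * (F.θ * F.θ - 1) = -2 * F.θ := by
    rw [← hα]; linear_combination (-2 * F.θ) * F.hw
  linear_combination h1

lemma th_el : 2 * (F.s + F.w) - F.θ = -1 + (F.s + F.w) - (F.s + F.w) * F.θ2 := by
  have h5 := F.hθ5
  have hne : F.θ + 1 ≠ 0 := by linarith
  apply mul_right_cancel₀ hne
  linear_combination (F.s + F.w) * F.hθ2 - F.hθ

lemma th2_pos : 0 < F.θ2 := by
  have h5 := F.hθ5
  have h2 : F.θ2 = (F.θ - 1) / (F.θ + 1) := by rw [eq_div_iff (by linarith)]; exact F.hθ2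
  rw [h2]; apply div_pos <;> linarith

/-- integral form -/
def val (w t : ℝ) (X : ℤ × ℤ × ℤ × ℤ) : ℝ := (X.1 + X.2.1 * w) + (X.2.2.1 + X.2.2.2 * w) * t

def mulc (s : ℕ) (X Y : ℤ × ℤ × ℤ × ℤ) : ℤ × ℤ × ℤ × ℤ :=
  (X.1 * Y.1 + (s * s + 1) * X.2.1 * Y.2.1 + X.2.2.1 * Y.2.2.1 + (s * s + 1) * X.2.2.2 * Y.2.2.2,
   X.1 * Y.2.1 + X.2.1 * Y.1 + X.2.2.1 * Y.2.2.2 + X.2.2.2 * Y.2.2.1,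
   X.1 * Y.2.2.1 + (s * s + 1) * X.2.1 * Y.2.2.2 + X.2.2.1 * Y.1 + (s * s + 1) * X.2.2.2 * Y.2.1
     + 2 * (s * (X.2.2.1 * Y.2.2.1 + (s * s + 1) * X.2.2.2 * Y.2.2.2) + (s * s + 1) * (X.2.2.1 * Y.2.2.2 + X.2.2.2 * Y.2.2.1)),
   X.1 * Y.2.2.2 + X.2.1 * Y.2.2.1 + X.2.2.1 * Y.2.1 + X.2.2.2 * Y.1
     + 2 * ((X.2.2.1 * Y.2.2.1 + (s * s + 1) * X.2.2.2 * Y.2.2.2) + s * (X.2.2.1 * Y.2.2.2 + X.2.2.2 * Y.2.2.1)))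

lemma val_mul (s : ℕ) (w t : ℝ) (hw : w * w = s * s + 1) (ht : t * t = 2 * (s + w) * t + 1) (X Y : ℤ × ℤ × ℤ × ℤ) :
    val w t X * val w t Y = val w t (mulc s X Y) := by
  obtain ⟨X1, X2, Y1, Y2⟩ := X
  obtain ⟨X1', X2', Y1', Y2'⟩ := Y
  simp only [val, mulc]
  push_cast
  linear_combination ((Y1 + Y2 * w) * (Y1' + Y2' * w)) * ht + (X2 * X2' + Y2 * Y2' + (X2 * Y2' + Y2 * X2') * t
    + 2 * (s + w) * Y2 * Y2' * t + 2 * (Y1 * Y2' + Y2 * Y1') * t) * hw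

def tup (X : ℤ × ℤ × ℤ × ℤ) : ℝ × ℝ × ℝ × ℝ :=
  (val F.w F.θ X, val F.w (2 * (F.s + F.w) - F.θ) X, val (-F.w) F.θ2 X, val (-F.w) (2 * (F.s - F.w) - F.θ2) X)

lemma tup_mul (X Y) : F.tup X * F.tup Y = F.tup (mulc F.s X Y) := by
  have h1 := F.hw
  have h2 := F.hθ
  have h3 := F.th2_sq
  simp only [tup, Prod.mk_mul_mk]
  rw [val_mul F.s _ _ h1 h2, val_mul F.s _ _ h1 (by linear_combination h2), val_mul F.s _ _ (by linear_combination h1) (by linear_combination h3),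
    val_mul F.s _ _ (by linear_combination h1) (by linear_combination h3)]

def ring : Subring (ℝ × ℝ × ℝ × ℝ) where
  carrier := Set.range F.tup
  mul_mem' := by
    rintro _ _ ⟨X, rfl⟩ ⟨Y, rfl⟩
    exact ⟨mulc F.s X Y, (F.tup_mul X Y).symm⟩
  one_mem' := ⟨(1, 0, 0, 0), by simp [tup, val]⟩
  add_mem' := by
    rintro _ _ ⟨X, rfl⟩ ⟨Y, rfl⟩
    refine ⟨X + Y, ?_⟩
    simp only [tup, val, Prod.mk_add_mk, Prod.fst_add, Prod.snd_add]
    push_cast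
    ext <;> simp only <;> ring
  zero_mem' := ⟨0, by simp [tup, val]⟩
  neg_mem' := by
    rintro _ ⟨X, rfl⟩
    refine ⟨-X, ?_⟩
    simp only [tup, val, Prod.neg_mk, Prod.fst_neg, Prod.snd_neg]
    push_cast
    ext <;> simp only <;> ring

lemma nonsq {s : ℕ} (hs : 1 ≤ s) (k m : ℤ) (h : k ^ 2 = (s * s + 1) * m ^ 2) : k = 0 ∧ m = 0 := by
  have hm : m = 0 := by
    by_contra hm
    have h1 : m ^ 2 ∣ k ^ 2 := ⟨(s*s+1 : ℤ), by rw [h]; ring⟩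
    rw [Int.pow_dvd_pow_iff (by norm_num)] at h1
    obtain ⟨c, rfl⟩ := h1
    have h2 : c ^ 2 = s * s + 1 := by
      have : m ^ 2 ≠ 0 := pow_ne_zero _ hm
      apply mul_left_cancel₀ this
      linarith
    have hs' : (1:ℤ) ≤ s := by exact_mod_cast hs
    have h3 : |c| ^ 2 = s * s + 1 := by rw [sq_abs]; exact h2
    have h4 := abs_nonneg c
    rcases lt_or_ge (s:ℤ) |c| with h5 | h5
    · nlinarith
    · nlinarith
  subst hm
  simp at h
  exact ⟨h, rfl⟩

lemma key4d {s : ℕ} (hs : 1 ≤ s) (k m : ℤ) (h : k ^ 2 = 4 * (s * s + 1) * m ^ 2) : k = 0 ∧ m = 0 := by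
  have := nonsq hs k (2 * m) (by rw [h]; ring)
  omega

lemma norm_ge (X : ℤ × ℤ × ℤ × ℤ) (h0 : (F.tup X).1 ≠ 0) :
    1 ≤ |(F.tup X).1| * |(F.tup X).2.1| * |(F.tup X).2.2.1| * |(F.tup X).2.2.2| := by
  obtain ⟨X1, X2, Y1, Y2⟩ := X
  have hw := F.hw
  have h2 := F.hθ
  have h3 := F.th2_sq
  set s := F.s with hs
  set w := F.w
  obtain ⟨n1, hn1⟩ : ∃ n1 : ℤ, n1 = X1 ^ 2 + (s * s + 1) * X2 ^ 2 - Y1 ^ 2 - (s * s + 1) * Y2 ^ 2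
    + 2 * (s * (X1 * Y1 + (s * s + 1) * X2 * Y2) + (s * s + 1) * (X1 * Y2 + X2 * Y1)) := ⟨_, rfl⟩
  obtain ⟨n2, hn2⟩ : ∃ n2 : ℤ, n2 = 2 * X1 * X2 - 2 * Y1 * Y2
    + 2 * ((X1 * Y1 + (s * s + 1) * X2 * Y2) + s * (X1 * Y2 + X2 * Y1)) := ⟨_, rfl⟩
  have hn1' : (n1:ℝ) = X1 ^ 2 + (s * s + 1) * X2 ^ 2 - Y1 ^ 2 - (s * s + 1) * Y2 ^ 2
    + 2 * (s * (X1 * Y1 + (s * s + 1) * X2 * Y2) + (s * s + 1) * (X1 * Y2 + X2 * Y1)) := by rw [hn1]; push_cast; ring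
  have hn2' : (n2:ℝ) = 2 * X1 * X2 - 2 * Y1 * Y2
    + 2 * ((X1 * Y1 + (s * s + 1) * X2 * Y2) + s * (X1 * Y2 + X2 * Y1)) := by rw [hn2]; push_cast; ring
  have gen : ∀ w t : ℝ, w * w = s * s + 1 → t * t = 2 * (s + w) * t + 1 →
      val w t (X1, X2, Y1, Y2) * val w (2 * (s + w) - t) (X1, X2, Y1, Y2) = n1 + n2 * w := by
    intro w t hw ht
    simp only [val, hn1', hn2']
    linear_combination -(Y1 + Y2 * w) ^ 2 * ht + (X2 ^ 2 - Y2 ^ 2 + 2 * (s + w) * (X2 * Y2) + 2 * (X1 * Y2 + X2 * Y1)) * hw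
  have g1 := gen w F.θ hw h2
  have g2 := gen (-w) F.θ2 (by linear_combination hw) (by linear_combination h3)
  rw [← sub_eq_add_neg] at g2
  have hprod : (F.tup (X1, X2, Y1, Y2)).1 * (F.tup (X1, X2, Y1, Y2)).2.1 * (F.tup (X1, X2, Y1, Y2)).2.2.1 * (F.tup (X1, X2, Y1, Y2)).2.2.2
      = ((n1 ^ 2 - (s * s + 1) * n2 ^ 2 : ℤ) : ℝ) := by
    simp only [tup]
    push_cast
    calc _ = (val w F.θ (X1, X2, Y1, Y2) * val w (2 * (s + w) - F.θ) (X1, X2, Y1, Y2)) *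
        (val (-w) F.θ2 (X1, X2, Y1, Y2) * val (-w) (2 * (s - w) - F.θ2) (X1, X2, Y1, Y2)) := by ring
      _ = _ := by rw [g1, g2]; linear_combination -(n2:ℝ) ^ 2 * hw
  rw [← abs_mul, ← abs_mul, ← abs_mul, hprod]
  rw [← Int.cast_abs]
  suffices n1 ^ 2 - (s * s + 1) * n2 ^ 2 ≠ 0 by
    have := Int.one_le_abs this
    exact_mod_cast this
  intro hz
  obtain ⟨z1, z2⟩ := nonsq F.hs n1 n2 (by linarith)
  -- k² = 4 d m²
  have hk : ((X1 + s * Y1 + (s * s + 1) * Y2) ^ 2 - (s * s + 1) * (X2 + Y1 + s * Y2) ^ 2) ^ 2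
      = 4 * (s * s + 1) * (Y1 ^ 2 - (s * s + 1) * Y2 ^ 2) ^ 2 := by
    have e1 : (X1 + s * Y1 + (s * s + 1) * Y2) ^ 2 + (s * s + 1) * (X2 + Y1 + s * Y2) ^ 2
       = n1 + 2 * (s * s + 1) * (Y1 ^ 2 + (s * s + 1) * Y2 ^ 2 + 2 * s * Y1 * Y2) := by rw [hn1]; ring
    have e2 : 2 * (X1 + s * Y1 + (s * s + 1) * Y2) * (X2 + Y1 + s * Y2)
       = n2 + 2 * (s * (Y1 ^ 2 + (s * s + 1) * Y2 ^ 2) + 2 * (s * s + 1) * Y1 * Y2) := by rw [hn2]; ring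
    rw [z1] at e1
    rw [z2] at e2
    have e3 : ((X1 + s * Y1 + (s * s + 1) * Y2) ^ 2 - (s * s + 1) * (X2 + Y1 + s * Y2) ^ 2) ^ 2
      = ((X1 + s * Y1 + (s * s + 1) * Y2) ^ 2 + (s * s + 1) * (X2 + Y1 + s * Y2) ^ 2) ^ 2
        - (s * s + 1) * (2 * (X1 + s * Y1 + (s * s + 1) * Y2) * (X2 + Y1 + s * Y2)) ^ 2 := by ring
    rw [e3, e1, e2]; ring
  obtain ⟨_, hm⟩ := key4d F.hs _ _ hk
  obtain ⟨y1, y2⟩ := nonsq F.hs Y1 Y2 (by linarith)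
  subst y1 y2
  obtain ⟨x1, x2⟩ : X1 = 0 ∧ X2 = 0 := by
    rw [z1] at hn1
    have hss : (0:ℤ) ≤ s * s := by positivity
    have h5 : X1 ^ 2 = 0 := by nlinarith [sq_nonneg X1, sq_nonneg X2]
    have h6 : X2 ^ 2 = 0 := by nlinarith [sq_nonneg X1, sq_nonneg X2]
    exact ⟨by simpa using h5, by simpa using h6⟩
  subst x1 x2
  apply h0
  simp [tup, val]
end Fld

end

section

namespace Fld
variable (F : Fld)

def G (X : ℤ × ℤ × ℤ × ℤ) : Prop :=
  ∃ δ : ℝ, (δ = 1 ∨ δ = -1) ∧ (F.tup X).1 * (F.tup X).2.1 = δ ∧ (F.tup X).2.2.1 * (F.tup X).2.2.2 = δ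

noncomputable def L0 (X : ℤ × ℤ × ℤ × ℤ) : ℝ := Real.log |(F.tup X).1|
noncomputable def L2 (X : ℤ × ℤ × ℤ × ℤ) : ℝ := Real.log |(F.tup X).2.2.1|

lemma G_ne {X} (h : F.G X) : (F.tup X).1 ≠ 0 ∧ (F.tup X).2.2.1 ≠ 0 := by
  obtain ⟨δ, hδ, h1, h2⟩ := h
  have : δ ≠ 0 := by rcases hδ with h | h <;> rw [h] <;> norm_num
  constructor
  · intro h; rw [h, zero_mul] at h1; exact this h1.symm
  · intro h; rw [h, zero_mul] at h2; exact this h2.symm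

lemma G_mul {X Y} (hX : F.G X) (hY : F.G Y) : ∃ Z, F.G Z ∧ F.L0 Z = F.L0 X + F.L0 Y ∧ F.L2 Z = F.L2 X + F.L2 Y := by
  have nX := F.G_ne hX
  have nY := F.G_ne hY
  refine ⟨mulc F.s X Y, ?_, ?_, ?_⟩
  · obtain ⟨δ, hδ, h1, h2⟩ := hX
    obtain ⟨δ', hδ', h1', h2'⟩ := hY
    refine ⟨δ * δ', ?_, ?_, ?_⟩
    · rcases hδ with h | h <;> rcases hδ' with h' | h' <;> rw [h, h'] <;> norm_num
    · rw [← F.tup_mul, ← h1, ← h1']; simp only [Prod.fst_mul, Prod.snd_mul]; ring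
    · rw [← F.tup_mul, ← h2, ← h2']; simp only [Prod.fst_mul, Prod.snd_mul]; ring
  · unfold L0
    rw [← F.tup_mul, Prod.fst_mul, abs_mul, Real.log_mul (abs_ne_zero.2 nX.1) (abs_ne_zero.2 nY.1)]
  · unfold L2
    rw [← F.tup_mul, Prod.snd_mul, Prod.snd_mul, Prod.fst_mul, abs_mul, Real.log_mul (abs_ne_zero.2 nX.2) (abs_ne_zero.2 nY.2)]

lemma G_inv {X} (hX : F.G X) : ∃ Z, F.G Z ∧ F.L0 Z = - F.L0 X ∧ F.L2 Z = - F.L2 X := by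
  have nX := F.G_ne hX
  obtain ⟨X1, X2, Y1, Y2⟩ := X
  obtain ⟨δ, hδ, h1, h2⟩ := hX
  have hw := F.hw
  have key : F.tup (X1 + 2 * (F.s * Y1 + (F.s * F.s + 1) * Y2), X2 + 2 * (Y1 + F.s * Y2), -Y1, -Y2)
      = ((F.tup (X1, X2, Y1, Y2)).2.1, (F.tup (X1, X2, Y1, Y2)).1, (F.tup (X1, X2, Y1, Y2)).2.2.2, (F.tup (X1, X2, Y1, Y2)).2.2.1) := by
    simp only [tup, val]
    push_cast
    ext <;> simp only <;> linear_combination (-2 * Y2) * hw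
  have habs : |δ| = 1 := by rcases hδ with h | h <;> rw [h] <;> norm_num
  refine ⟨(X1 + 2 * (F.s * Y1 + (F.s * F.s + 1) * Y2), X2 + 2 * (Y1 + F.s * Y2), -Y1, -Y2), ?_, ?_, ?_⟩
  · refine ⟨δ, hδ, ?_, ?_⟩
    · rw [key]; simp only; rw [← h1]; ring
    · rw [key]; simp only; rw [← h2]; ring
  · unfold L0
    rw [key, ← Real.log_inv]
    congr 1
    apply eq_inv_of_mul_eq_one_left
    simp only
    rw [← abs_mul, mul_comm, h1, habs]
  · unfold L2
    rw [key, ← Real.log_inv]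
    congr 1
    apply eq_inv_of_mul_eq_one_left
    simp only
    rw [← abs_mul, mul_comm, h2, habs]

lemma G_one : F.G (1, 0, 0, 0) ∧ F.L0 (1, 0, 0, 0) = 0 ∧ F.L2 (1, 0, 0, 0) = 0 := by
  refine ⟨⟨1, Or.inl rfl, ?_, ?_⟩, ?_, ?_⟩ <;> simp [tup, val, L0, L2]

lemma G_pow {X} (hX : F.G X) (n : ℕ) : ∃ Z, F.G Z ∧ F.L0 Z = n * F.L0 X ∧ F.L2 Z = n * F.L2 X := by
  induction n with
  | zero => exact ⟨_, F.G_one.1, by simp [F.G_one.2.1], by simp [F.G_one.2.2]⟩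
  | succ n ih =>
    obtain ⟨Z, hZ, h1, h2⟩ := ih
    obtain ⟨Z', hZ', h1', h2'⟩ := F.G_mul hZ hX
    exact ⟨Z', hZ', by rw [h1', h1]; push_cast; ring, by rw [h2', h2]; push_cast; ring⟩

lemma G_zpow {X} (hX : F.G X) (n : ℤ) : ∃ Z, F.G Z ∧ F.L0 Z = n * F.L0 X ∧ F.L2 Z = n * F.L2 X := by
  obtain ⟨m, rfl | rfl⟩ := n.eq_nat_or_neg
  · exact_mod_cast F.G_pow hX m
  · obtain ⟨Z, hZ, h1, h2⟩ := F.G_pow hX m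
    obtain ⟨Z', hZ', h1', h2'⟩ := F.G_inv hZ
    exact ⟨Z', hZ', by rw [h1', h1]; push_cast; ring, by rw [h2', h2]; push_cast; ring⟩

noncomputable def T : ℝ := Real.log F.θ
noncomputable def S : ℝ := Real.log F.θ2

lemma th_inv : 2 * (F.s + F.w) - F.θ = - F.θ⁻¹ := by
  have h5 := F.hθ5
  have : F.θ ≠ 0 := by linarith
  field_simp
  linear_combination -F.hθ

lemma th2_inv : 2 * (F.s - F.w) - F.θ2 = - F.θ2⁻¹ := by
  have : F.θ2 ≠ 0 := F.th2_pos.ne'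
  field_simp
  linear_combination -F.th2_sq

lemma G_th : F.G (0, 0, 1, 0) ∧ F.L0 (0, 0, 1, 0) = F.T ∧ F.L2 (0, 0, 1, 0) = F.S := by
  have h5 := F.hθ5
  have h0 : F.θ ≠ 0 := by linarith
  have h2 : F.θ2 ≠ 0 := F.th2_pos.ne'
  refine ⟨⟨-1, Or.inr rfl, ?_, ?_⟩, ?_, ?_⟩
  · simp [tup, val, F.th_inv, h0]
  · simp [tup, val, F.th2_inv, h2]
  · simp [tup, val, L0, T]
  · simp [tup, val, L2, S]

lemma tup_th2 : F.tup (-1 + F.s, -1, -F.s, 1) = (F.θ2, -F.θ2⁻¹, -F.θ⁻¹, F.θ) := by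
  have e1 := F.th2_el
  have e2 := F.th_el
  have e3 := F.th_inv
  have e4 := F.th2_inv
  have hw := F.hw
  simp only [tup, val]
  push_cast
  ext <;> simp only
  · linear_combination -e1
  · rw [← e4]; linear_combination e1 + 2 * hw
  · rw [← e3]; linear_combination -e2
  · linear_combination e2 + 2 * hw

lemma G_th2 : F.G (-1 + F.s, -1, -F.s, 1) ∧ F.L0 (-1 + F.s, -1, -F.s, 1) = F.S ∧ F.L2 (-1 + F.s, -1, -F.s, 1) = - F.T := by
  have h5 := F.hθ5
  have h0 : F.θ ≠ 0 := by linarith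
  have h2 : F.θ2 ≠ 0 := F.th2_pos.ne'
  refine ⟨⟨-1, Or.inr rfl, ?_, ?_⟩, ?_, ?_⟩
  · rw [tup_th2]; simp [h2]
  · rw [tup_th2]; simp [h0]
  · unfold L0; rw [tup_th2]; simp [S]
  · unfold L2; rw [tup_th2]; simp [T]

lemma cvx (A u : ℝ) (h1 : -(1/2) ≤ u) (h2 : u ≤ 1/2) :
    Real.exp (u * A) ≤ (1/2 + u) * Real.exp (A/2) + (1/2 - u) * (Real.exp (A/2))⁻¹ := by
  have := convexOn_exp.2 (Set.mem_univ (A/2)) (Set.mem_univ (-(A/2))) (by linarith : 0 ≤ 1/2 + u) (by linarith : 0 ≤ 1/2 - u) (by ring)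
  simp only [smul_eq_mul, Real.exp_neg] at this
  have e : (1/2 + u) * (A/2) + (1/2 - u) * -(A/2) = u * A := by ring
  rw [e] at this
  exact this

lemma M_lt : ((Real.exp (F.T/2) + (Real.exp (F.T/2))⁻¹) * (Real.exp (F.S/2) + (Real.exp (F.S/2))⁻¹)) < 4 * F.w := by
  have h5 := F.hθ5
  have h0 : 0 < F.θ := by linarith
  have h2 := F.th2_pos
  have ea : Real.exp (F.T/2) ^ 2 = F.θ := by rw [← Real.exp_nat_mul, T]; push_cast; rw [mul_div_cancel₀ _ (by norm_num)]; exact Real.exp_log h0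
  have eb : Real.exp (F.S/2) ^ 2 = F.θ2 := by rw [← Real.exp_nat_mul, S]; push_cast; rw [mul_div_cancel₀ _ (by norm_num)]; exact Real.exp_log h2
  have pa := Real.exp_pos (F.T/2)
  have pb := Real.exp_pos (F.S/2)
  set a := Real.exp (F.T/2)
  set b := Real.exp (F.S/2)
  have hw0 := F.hw0
  apply lt_of_pow_lt_pow_left₀ 2 (by positivity)
  have e1 : ((a + a⁻¹) * (b + b⁻¹)) ^ 2 = (F.θ + 1) ^ 2 / F.θ * ((F.θ2 + 1) ^ 2 / F.θ2) := by
    rw [← ea, ← eb]; field_simp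
  have e2 : F.θ2 = (F.θ - 1) / (F.θ + 1) := by rw [eq_div_iff (by linarith)]; exact F.hθ2
  have h1 : 0 < F.θ - 1 := by linarith
  have e3 : ((a + a⁻¹) * (b + b⁻¹)) ^ 2 = 4 * F.θ * (F.θ + 1) / (F.θ - 1) := by
    rw [e1, e2]; field_simp; ring
  rw [e3, div_lt_iff₀ h1]
  have hθ := F.hθ
  have hw := F.hw
  clear e1 e2 e3 ea eb pa pb h2
  clear_value a b
  clear a b
  -- θ(θ+1) < 4 w²(θ-1)
  suffices F.θ * (F.θ + 1) < 4 * (F.w * F.w) * (F.θ - 1) by linarith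
  have hs : (1:ℝ) ≤ F.s := by exact_mod_cast F.hs
  rcases Nat.lt_or_ge F.s 2 with h | h
  · have hs1 : F.s = 1 := by have := F.hs; omega
    have hs1' : (F.s:ℝ) = 1 := by rw [hs1]; simp
    rw [hs1'] at hθ hw
    have hwb : F.w < 1.415 := by nlinarith
    rw [hw]
    nlinarith
  · have hs2 : (2:ℝ) ≤ F.s := by exact_mod_cast h
    have hws : F.s < F.w := by nlinarith
    have hwu : F.w < F.s + 1/4 := by nlinarith
    have : F.θ * (F.θ + 1) = (2 * (F.s + F.w) + 1) * F.θ + 1 := by linear_combination hθ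
    rw [this, hw]
    have k1 : 0 < 4 * ((F.s:ℝ) * F.s + 1) - 2 * (F.s + F.w) - 1 := by nlinarith
    have k2 := mul_le_mul_of_nonneg_left h5 k1.le
    nlinarith

set_option maxHeartbeats 1000000 in
lemma resid {X} (hX : F.G X) (u v : ℝ) (hu : |u| ≤ 1/2) (hv : |v| ≤ 1/2) (h0 : F.L0 X = u * F.T + v * F.S)
    (h2 : F.L2 X = u * F.S - v * F.T) : F.L0 X = 0 ∧ F.L2 X = 0 := by
  have nX := F.G_ne hX
  obtain ⟨X1, X2, Y1, Y2⟩ := X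
  obtain ⟨δ, hδ, p1, p2⟩ := hX
  have hw := F.hw
  have hw0 := F.hw0
  have hθ := F.hθ
  have hθ2 := F.th2_sq
  have habs : |δ| = 1 := by rcases hδ with h | h <;> rw [h] <;> norm_num
  have E0 : Real.exp (F.L0 (X1, X2, Y1, Y2)) = |(F.tup (X1, X2, Y1, Y2)).1| := Real.exp_log (abs_pos.2 nX.1)
  have E2 : Real.exp (F.L2 (X1, X2, Y1, Y2)) = |(F.tup (X1, X2, Y1, Y2)).2.2.1| := Real.exp_log (abs_pos.2 nX.2)
  have E1 : Real.exp (-F.L0 (X1, X2, Y1, Y2)) = |(F.tup (X1, X2, Y1, Y2)).2.1| := by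
    rw [Real.exp_neg, E0]; symm; apply eq_inv_of_mul_eq_one_right; rw [← abs_mul, p1, habs]
  have E3 : Real.exp (-F.L2 (X1, X2, Y1, Y2)) = |(F.tup (X1, X2, Y1, Y2)).2.2.2| := by
    rw [Real.exp_neg, E2]; symm; apply eq_inv_of_mul_eq_one_right; rw [← abs_mul, p2, habs]
  obtain ⟨g, hg⟩ : ∃ g : ℤ, g = X1 + F.s * Y1 + (F.s * F.s + 1) * Y2 := ⟨_, rfl⟩
  obtain ⟨h, hh⟩ : ∃ h : ℤ, h = X2 + Y1 + F.s * Y2 := ⟨_, rfl⟩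
  have hg' : (g:ℝ) = X1 + F.s * Y1 + (F.s * F.s + 1) * Y2 := by rw [hg]; push_cast; ring
  have hh' : (h:ℝ) = X2 + Y1 + F.s * Y2 := by rw [hh]; push_cast; ring
  have t1 : (F.tup (X1, X2, Y1, Y2)).1 + (F.tup (X1, X2, Y1, Y2)).2.1 = 2 * (g + h * F.w) := by
    simp only [tup, val, hg', hh']; linear_combination 2 * Y2 * hw
  have t2 : (F.tup (X1, X2, Y1, Y2)).2.2.1 + (F.tup (X1, X2, Y1, Y2)).2.2.2 = 2 * (g - h * F.w) := by
    simp only [tup, val, hg', hh']; linear_combination 2 * Y2 * hw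
  have d1 : (F.tup (X1, X2, Y1, Y2)).1 - (F.tup (X1, X2, Y1, Y2)).2.1 = 2 * ((Y1 + Y2 * F.w) * (F.θ - (F.s + F.w))) := by
    simp only [tup, val]; ring
  have d2 : (F.tup (X1, X2, Y1, Y2)).2.2.1 - (F.tup (X1, X2, Y1, Y2)).2.2.2 = 2 * ((Y1 - Y2 * F.w) * (F.θ2 - (F.s - F.w))) := by
    simp only [tup, val]; ring
  set r0 := (F.tup (X1, X2, Y1, Y2)).1
  set r1 := (F.tup (X1, X2, Y1, Y2)).2.1
  set r2 := (F.tup (X1, X2, Y1, Y2)).2.2.1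
  set r3 := (F.tup (X1, X2, Y1, Y2)).2.2.2
  have hsum : |r0| + |r1| + |r2| + |r3| < 4 * F.w := by
    refine lt_of_le_of_lt ?_ F.M_lt
    rw [← E0, ← E1, ← E2, ← E3, h0, h2]
    obtain ⟨u1, u2⟩ := abs_le.1 hu
    obtain ⟨v1, v2⟩ := abs_le.1 hv
    have a1 := cvx F.T u u1 u2
    have a2 := cvx F.S v v1 v2
    have a3 := cvx F.T (-u) (by linarith) (by linarith)
    have a4 := cvx F.S (-v) (by linarith) (by linarith)
    have b1 := cvx F.S u u1 u2
    have b2 := cvx F.T v v1 v2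
    have b3 := cvx F.S (-u) (by linarith) (by linarith)
    have b4 := cvx F.T (-v) (by linarith) (by linarith)
    have c1 := mul_le_mul a1 a2 (Real.exp_pos _).le ((Real.exp_pos _).le.trans a1)
    have c2 := mul_le_mul a3 a4 (Real.exp_pos _).le ((Real.exp_pos _).le.trans a3)
    have c3 := mul_le_mul b1 b4 (Real.exp_pos _).le ((Real.exp_pos _).le.trans b1)
    have c4 := mul_le_mul b3 b2 (Real.exp_pos _).le ((Real.exp_pos _).le.trans b3)
    rw [← Real.exp_add] at c1 c2 c3 c4
    have e2 : -(u * F.T + v * F.S) = -u * F.T + -v * F.S := by ring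
    have e3 : u * F.S - v * F.T = u * F.S + -v * F.T := by ring
    have e4 : -(u * F.S + -v * F.T) = -u * F.S + v * F.T := by ring
    rw [e2, e3, e4]
    refine (add_le_add (add_le_add (add_le_add c1 c2) c3) c4).trans (le_of_eq ?_)
    ring
  have hh0 : h = 0 := by
    by_contra hne
    have h1 : (1:ℝ) ≤ |(h:ℝ)| := by exact_mod_cast Int.one_le_abs hne
    have e : 4 * (h * F.w) = r0 + r1 - (r2 + r3) := by rw [t1, t2]; ring
    have h3 : 4 * F.w ≤ |4 * (h * F.w)| := by
      rw [abs_mul, abs_mul, abs_of_pos hw0]; norm_num; exact le_mul_of_one_le_left hw0.le h1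
    rw [e] at h3
    have h4 : |r0 + r1 - (r2 + r3)| ≤ |r0| + |r1| + |r2| + |r3| := by
      have := abs_sub (r0 + r1) (r2 + r3)
      have := abs_add_le r0 r1
      have := abs_add_le r2 r3
      linarith
    linarith
  rw [hh0] at t1 t2
  simp only [Int.cast_zero, zero_mul, add_zero, sub_zero] at t1 t2
  have q1 : (g:ℝ) ^ 2 - δ = (Y1 + Y2 * F.w) ^ 2 * (2 * F.w * (F.s + F.w)) := by
    have : 4 * ((g:ℝ) ^ 2 - δ) = (r0 - r1) ^ 2 := by
      linear_combination -(r0 + r1 + 2 * g) * t1 + 4 * p1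
    rw [d1] at this
    linear_combination this / 4 + (Y1 + Y2 * F.w) ^ 2 * (hθ - hw)
  have q2 : (g:ℝ) ^ 2 - δ = (Y1 - Y2 * F.w) ^ 2 * (-2 * F.w * (F.s - F.w)) := by
    have : 4 * ((g:ℝ) ^ 2 - δ) = (r2 - r3) ^ 2 := by
      linear_combination -(r2 + r3 + 2 * g) * t2 + 4 * p2
    rw [d2] at this
    linear_combination this / 4 + (Y1 - Y2 * F.w) ^ 2 * (hθ2 - hw)
  have q3 : ((g:ℝ) ^ 2 - δ) ^ 2 = 4 * (F.s * F.s + 1) * ((Y1:ℝ) ^ 2 - (F.s * F.s + 1) * Y2 ^ 2) ^ 2 := by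
    have e : ((g:ℝ) ^ 2 - δ) ^ 2 = ((Y1 + Y2 * F.w) ^ 2 * (2 * F.w * (F.s + F.w))) * ((Y1 - Y2 * F.w) ^ 2 * (-2 * F.w * (F.s - F.w))) := by
      rw [← q1, ← q2]; ring
    have e2 : ((Y1 + Y2 * F.w) ^ 2 * (2 * F.w * (F.s + F.w))) * ((Y1 - Y2 * F.w) ^ 2 * (-2 * F.w * (F.s - F.w)))
       = 4 * (F.w * F.w) * ((F.w * F.w) - F.s * F.s) * (Y1 ^ 2 - (F.w * F.w) * Y2 ^ 2) ^ 2 := by ring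
    rw [e, e2, hw]; ring
  have hgd : (g:ℝ) ^ 2 = δ := by
    rcases hδ with hd | hd
    · rw [hd] at q3 ⊢
      have := key4d F.hs (g ^ 2 - 1) (Y1 ^ 2 - (F.s * F.s + 1) * Y2 ^ 2) (by exact_mod_cast q3)
      have := this.1
      have : (g:ℤ) ^ 2 = 1 := by linarith
      exact_mod_cast this
    · rw [hd] at q3 ⊢
      have := key4d F.hs (g ^ 2 + 1) (Y1 ^ 2 - (F.s * F.s + 1) * Y2 ^ 2) (by
        have : ((g:ℝ) ^ 2 + 1) ^ 2 = 4 * (F.s * F.s + 1) * ((Y1:ℝ) ^ 2 - (F.s * F.s + 1) * Y2 ^ 2) ^ 2 := by rw [← q3]; ring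
        exact_mod_cast this)
      have := this.1
      have hz := sq_nonneg g
      exfalso; omega
  have f1 : r0 = g := by
    have : (r0 - g) ^ 2 = 0 := by linear_combination r0 * t1 - p1 + hgd
    have := pow_eq_zero_iff (two_ne_zero) |>.1 this
    linarith
  have f2 : r2 = g := by
    have : (r2 - g) ^ 2 = 0 := by linear_combination r2 * t2 - p2 + hgd
    have := pow_eq_zero_iff (two_ne_zero) |>.1 this
    linarith
  have hg1 : |(g:ℝ)| = 1 := by
    have : |(g:ℝ)| ^ 2 = 1 := by rw [sq_abs, hgd]; rcases hδ with hd | hd; exact hd; exfalso; have := sq_nonneg (g:ℝ); linarith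
    exact (pow_eq_one_iff_of_nonneg (abs_nonneg _) two_ne_zero).1 this
  constructor
  · show Real.log |r0| = 0
    rw [f1, hg1, Real.log_one]
  · show Real.log |r2| = 0
    rw [f2, hg1, Real.log_one]

lemma T_pos : 0 < F.T := Real.log_pos (by linarith [F.hθ5])

lemma G_round {X} (hX : F.G X) : ∃ p q : ℤ, F.L0 X = p * F.T + q * F.S ∧ F.L2 X = p * F.S - q * F.T := by
  have hT := F.T_pos
  have hD : 0 < F.T ^ 2 + F.S ^ 2 := by positivity
  obtain ⟨u, hu⟩ : ∃ u, u = (F.L0 X * F.T + F.L2 X * F.S) / (F.T ^ 2 + F.S ^ 2) := ⟨_, rfl⟩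
  obtain ⟨v, hv⟩ : ∃ v, v = (F.L0 X * F.S - F.L2 X * F.T) / (F.T ^ 2 + F.S ^ 2) := ⟨_, rfl⟩
  have e0 : F.L0 X = u * F.T + v * F.S := by rw [hu, hv]; field_simp; ring
  have e2 : F.L2 X = u * F.S - v * F.T := by rw [hu, hv]; field_simp; ring
  obtain ⟨A, hA, a0, a2⟩ := F.G_zpow F.G_th.1 (-(round u))
  obtain ⟨B, hB, b0, b2⟩ := F.G_zpow F.G_th2.1 (-(round v))
  obtain ⟨C, hC, c0, c2⟩ := F.G_mul hX hA
  obtain ⟨E, hE, f0, f2⟩ := F.G_mul hC hB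
  rw [F.G_th.2.1] at a0
  rw [F.G_th.2.2] at a2
  rw [F.G_th2.2.1] at b0
  rw [F.G_th2.2.2] at b2
  rw [c0, a0, b0] at f0
  rw [c2, a2, b2] at f2
  obtain ⟨z0, z2⟩ := F.resid hE (u - round u) (v - round v) (abs_sub_round u) (abs_sub_round v)
    (by rw [f0, e0]; push_cast; ring) (by rw [f2, e2]; push_cast; ring)
  rw [z0] at f0
  rw [z2] at f2
  push_cast at f0 f2
  exact ⟨round u, round v, by linarith, by linarith⟩

end Fld

end

section

namespace Fld

lemma fg_lem (f g U : ℝ) (hf : 1 < f) (hg : 1 < g) (hfg : (f-1)*(g-1) = 2) (hle : g ≤ f) (hU : 1 ≤ U)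
    (hμ : 4 * U ^ 2 * (f * (f ^ 2 - 1)) ≤ (f ^ 2 + 1) ^ 2) : Real.log g ≤ 4 * Real.exp (-Real.log f) ∧ U ≤ f := by
  have h1 : 2 ≤ (f - 1) ^ 2 := by nlinarith
  have h2 : 2.4 ≤ f := by nlinarith
  have hf0 : 0 < f := by linarith
  constructor
  · rw [Real.exp_neg, Real.exp_log hf0]
    have := Real.log_le_sub_one_of_pos (by linarith : 0 < g)
    refine this.trans ?_
    have e : g - 1 = 2 / (f - 1) := by rw [eq_div_iff (by linarith)]; linarith
    rw [e, ← div_eq_mul_inv, div_le_div_iff₀ (by linarith) hf0]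
    linarith
  · have h3 : (f ^ 2 + 1) ^ 2 ≤ 2 * f * (f * (f ^ 2 - 1)) := by
      have : 5 ≤ f ^ 2 := by nlinarith
      nlinarith
    have h4 : 0 < f * (f ^ 2 - 1) := by
      apply mul_pos hf0; nlinarith
    have h5 : 4 * U ^ 2 ≤ 2 * f := le_of_mul_le_mul_right (hμ.trans h3) h4
    nlinarith

lemma exp_abs_log (x : ℝ) (hx : 0 < x) : (1 ≤ x ∧ Real.exp |Real.log x| = x) ∨ (x ≤ 1 ∧ Real.exp |Real.log x| = x⁻¹) := by
  rcases le_total 1 x with h | h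
  · left
    exact ⟨h, by rw [abs_of_nonneg (Real.log_nonneg h), Real.exp_log hx]⟩
  · right
    exact ⟨h, by rw [abs_of_nonpos (Real.log_nonpos hx.le h), Real.exp_neg, Real.exp_log hx]⟩

/-- with x=|e| -/
lemma fg_of (e : ℝ) (h0 : e ≠ 0) (h1 : e ≠ 1) (h2 : e ≠ -1) (c : ℝ) (hc : c * |e * (1 - e ^ 2)| ≤ (1 + e ^ 2) ^ 2) :
    ∃ f g : ℝ, 1 < f ∧ 1 < g ∧ (f - 1) * (g - 1) = 2 ∧ abs (Real.log |e|) = Real.log f ∧ abs (Real.log |(1 + e) / (1 - e)|) = Real.log g ∧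
      c * (f * (f ^ 2 - 1)) ≤ (f ^ 2 + 1) ^ 2 ∧ c * (g * (g ^ 2 - 1)) ≤ (g ^ 2 + 1) ^ 2 := by
  have key : ∀ e : ℝ, 1 < e → c * |e * (1 - e ^ 2)| ≤ (1 + e ^ 2) ^ 2 → 
     ∃ f g : ℝ, 1 < f ∧ 1 < g ∧ (f - 1) * (g - 1) = 2 ∧ abs (Real.log |e|) = Real.log f ∧ abs (Real.log |(1 + e) / (1 - e)|) = Real.log g ∧
      c * (f * (f ^ 2 - 1)) ≤ (f ^ 2 + 1) ^ 2 ∧ c * (g * (g ^ 2 - 1)) ≤ (g ^ 2 + 1) ^ 2 := by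
    intro e he hc
    have hm : 0 < e - 1 := by linarith
    have h3 : 1 < (e + 1) / (e - 1) := by rw [lt_div_iff₀ hm]; linarith
    have hc' : c * (e * (e ^ 2 - 1)) ≤ (e ^ 2 + 1) ^ 2 := by
      rw [abs_of_nonpos (by nlinarith [mul_pos (by linarith : 0 < e) hm])] at hc
      linarith
    refine ⟨e, (e + 1) / (e - 1), he, h3, by field_simp; ring, ?_, ?_, hc', ?_⟩
    · rw [abs_of_pos (by linarith : 0 < e), abs_of_nonneg (Real.log_nonneg he.le)]
    · have : |(1 + e) / (1 - e)| = (e + 1) / (e - 1) := by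
        rw [abs_div, abs_of_pos (by linarith), abs_of_neg (by linarith)]; congr 1 <;> ring
      rw [this, abs_of_nonneg (Real.log_nonneg h3.le)]
    · have e1 : c * ((e + 1) / (e - 1) * (((e + 1) / (e - 1)) ^ 2 - 1)) = 4 / (e - 1) ^ 4 * (c * (e * (e ^ 2 - 1))) := by
        field_simp; ring
      have e2 : (((e + 1) / (e - 1)) ^ 2 + 1) ^ 2 = 4 / (e - 1) ^ 4 * (e ^ 2 + 1) ^ 2 := by
        field_simp; ring
      rw [e1, e2]
      exact mul_le_mul_of_nonneg_left hc' (by positivity)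
  have key2 : ∀ e : ℝ, 0 < e → e ≠ 1 → c * |e * (1 - e ^ 2)| ≤ (1 + e ^ 2) ^ 2 → 
     ∃ f g : ℝ, 1 < f ∧ 1 < g ∧ (f - 1) * (g - 1) = 2 ∧ abs (Real.log |e|) = Real.log f ∧ abs (Real.log |(1 + e) / (1 - e)|) = Real.log g ∧
      c * (f * (f ^ 2 - 1)) ≤ (f ^ 2 + 1) ^ 2 ∧ c * (g * (g ^ 2 - 1)) ≤ (g ^ 2 + 1) ^ 2 := by
    intro e he hne hc
    rcases lt_or_gt_of_ne hne with h | h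
    · have hi : 1 < e⁻¹ := (one_lt_inv₀ he).2 h
      have := key e⁻¹ hi (by
        have e1 : |e⁻¹ * (1 - e⁻¹ ^ 2)| = |e * (1 - e ^ 2)| / e ^ 4 := by
          have : e⁻¹ * (1 - e⁻¹ ^ 2) = -(e * (1 - e ^ 2)) / e ^ 4 := by field_simp; ring
          rw [this, abs_div, abs_neg, abs_of_pos (by positivity : 0 < e ^ 4)]
        have e2 : (1 + e⁻¹ ^ 2) ^ 2 = (1 + e ^ 2) ^ 2 / e ^ 4 := by field_simp; ring
        rw [e1, e2, ← mul_div_assoc]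
        exact div_le_div_of_nonneg_right hc (by positivity))
      have a1 : abs (Real.log |e⁻¹|) = abs (Real.log |e|) := by rw [abs_inv, Real.log_inv, abs_neg]
      have a2 : |(1 + e⁻¹) / (1 - e⁻¹)| = |(1 + e) / (1 - e)| := by
        have hm : 1 - e ≠ 0 := by intro h; apply hne; linarith
        have hm' : e - 1 ≠ 0 := by intro h; apply hne; linarith
        have : (1 + e⁻¹) / (1 - e⁻¹) = -((1 + e) / (1 - e)) := by
          have : 1 - e⁻¹ = (e - 1) / e := by field_simp
          rw [this]
          field_simp; ring
        rw [this, abs_neg]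
      rw [a1, a2] at this
      exact this
    · exact key e h hc
  rcases lt_or_gt_of_ne h0 with h | h
  · have := key2 (-e) (by linarith) (by intro h; apply h2; linarith) (by
      have e1 : -e * (1 - (-e) ^ 2) = -(e * (1 - e ^ 2)) := by ring
      rw [e1, abs_neg, neg_sq]; exact hc)
    have a2 : abs (Real.log |(1 + -e) / (1 - -e)|) = abs (Real.log |(1 + e) / (1 - e)|) := by
      have : |(1 + -e) / (1 - -e)| = |(1 + e) / (1 - e)|⁻¹ := by
        rw [← abs_inv, inv_div]; congr 2 <;> ring
      rw [this, Real.log_inv, abs_neg]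
    rw [a2, abs_neg] at this
    exact this
  · exact key2 e h h1 hc

variable (F : Fld)

lemma eps (a b : ℤ) (h : QF F.s a b = 1) : ∃ p q : ℤ,
    Real.log |(a - F.θ * b) / (a * F.θ + b)| = p * F.T + q * F.S ∧
    Real.log |((a * F.θ + b) + (a - F.θ * b)) / ((a * F.θ + b) - (a - F.θ * b))| = p * F.S - q * F.T ∧
    (a * F.θ + b) * (a - F.θ * b) ≠ 0 ∧ (a * F.θ + b) ^ 2 - (a - F.θ * b) ^ 2 ≠ 0 ∧
    |(a * F.θ + b) * (a - F.θ * b) * ((a * F.θ + b) ^ 2 - (a - F.θ * b) ^ 2)| = 2 * (F.s + F.w) * F.θ ^ 2 := by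
  have hw := F.hw
  have hw0 := F.hw0
  have hθ := F.hθ
  have h5 := F.hθ5
  have hθ2 := F.th2_sq
  have p2 := F.th2_pos
  have hs : (1:ℝ) ≤ F.s := by exact_mod_cast F.hs
  obtain ⟨β, hβ⟩ : ∃ β : ℝ, β = a ^ 2 - b ^ 2 - 2 * (F.s + F.w) * a * b := ⟨_, rfl⟩
  obtain ⟨γ, hγ⟩ : ∃ γ : ℝ, γ = a ^ 2 - b ^ 2 - 2 * (F.s - F.w) * a * b := ⟨_, rfl⟩
  have h' : (a:ℝ)^4-4*F.s*a^3*b-6*a^2*b^2+4*F.s*a*b^3+b^4 = 1 := by unfold QF at h; exact_mod_cast h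
  have hβγ : β * γ = 1 := by
    rw [hβ, hγ, ← h']; linear_combination (-4 * a ^ 2 * b ^ 2 : ℝ) * hw
  have hβ0 : β ≠ 0 := left_ne_zero_of_mul_eq_one hβγ
  have hγ0 : γ ≠ 0 := right_ne_zero_of_mul_eq_one hβγ
  have hPQ : (a * F.θ + b) * (a - F.θ * b) = F.θ * β := by rw [hβ]; linear_combination (-a * b : ℝ) * hθ
  have hPQ2 : (a * F.θ2 + b) * (a - F.θ2 * b) = F.θ2 * γ := by rw [hγ]; linear_combination (-a * b : ℝ) * hθ2
  have hθ0 : F.θ ≠ 0 := by linarith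
  have hP : (a * F.θ + b) * (a - F.θ * b) ≠ 0 := by rw [hPQ]; exact mul_ne_zero hθ0 hβ0
  have hP2 : (a * F.θ2 + b) * (a - F.θ2 * b) ≠ 0 := by rw [hPQ2]; exact mul_ne_zero p2.ne' hγ0
  have hPP : (a * F.θ + b) ^ 2 - (a - F.θ * b) ^ 2 = 2 * (F.s + F.w) * F.θ * γ := by
    rw [hγ]; linear_combination (a ^ 2 - b ^ 2 : ℝ) * hθ - 4 * a * b * F.θ * hw
  have hα : 0 < F.s + F.w := by linarith
  obtain ⟨m, hm⟩ : ∃ m : ℤ, m = a ^ 2 - b ^ 2 - 2 * F.s * a * b := ⟨_, rfl⟩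
  have hm' : (m:ℝ) = a ^ 2 - b ^ 2 - 2 * F.s * a * b := by rw [hm]; push_cast; ring
  have t1 : F.tup (a, 0, -b, 0) = (a - F.θ * b, a - (2 * (F.s + F.w) - F.θ) * b, a - F.θ2 * b, a - (2 * (F.s - F.w) - F.θ2) * b) := by
    simp only [tup, val]; push_cast; ext <;> simp only <;> ring
  have t2 : F.tup (m, 2 * a * b, 0, 0) = (γ, γ, β, β) := by
    simp only [tup, val, hm', hβ, hγ]; push_cast; ext <;> simp only <;> ring
  have tt : F.tup (mulc F.s (mulc F.s (a, 0, -b, 0) (a, 0, -b, 0)) (m, 2 * a * b, 0, 0)) =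
     ((a - F.θ * b) * (a - F.θ * b) * γ, (a - (2 * (F.s + F.w) - F.θ) * b) * (a - (2 * (F.s + F.w) - F.θ) * b) * γ,
      (a - F.θ2 * b) * (a - F.θ2 * b) * β, (a - (2 * (F.s - F.w) - F.θ2) * b) * (a - (2 * (F.s - F.w) - F.θ2) * b) * β) := by
    rw [← F.tup_mul, ← F.tup_mul, t1, t2]; rfl
  have n1 : (a - F.θ * b) * (a - (2 * (F.s + F.w) - F.θ) * b) = β := by rw [hβ]; linear_combination (-b ^ 2 : ℝ) * hθ
  have n2 : (a - F.θ2 * b) * (a - (2 * (F.s - F.w) - F.θ2) * b) = γ := by rw [hγ]; linear_combination (-b ^ 2 : ℝ) * hθ2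
  have hG : F.G (mulc F.s (mulc F.s (a, 0, -b, 0) (a, 0, -b, 0)) (m, 2 * a * b, 0, 0)) := by
    refine ⟨1, Or.inl rfl, ?_, ?_⟩
    · rw [tt]; simp only
      calc _ = ((a - F.θ * b) * (a - (2 * (F.s + F.w) - F.θ) * b)) ^ 2 * γ ^ 2 := by ring
        _ = (β * γ) ^ 2 := by rw [n1]; ring
        _ = 1 := by rw [hβγ]; norm_num
    · rw [tt]; simp only
      calc _ = ((a - F.θ2 * b) * (a - (2 * (F.s - F.w) - F.θ2) * b)) ^ 2 * β ^ 2 := by ring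
        _ = (β * γ) ^ 2 := by rw [n2]; ring
        _ = 1 := by rw [hβγ]; norm_num
  obtain ⟨p, q, e0, e2⟩ := F.G_round hG
  have hPne := left_ne_zero_of_mul hP
  have hQne := right_ne_zero_of_mul hP
  have hP2ne := left_ne_zero_of_mul hP2
  have hQ2ne := right_ne_zero_of_mul hP2
  have x0 : (a - F.θ * b) * (a - F.θ * b) * γ = F.θ * ((a - F.θ * b) / (a * F.θ + b)) := by
    rw [← mul_div_assoc, eq_div_iff hPne]
    calc _ = (a - F.θ * b) * ((a * F.θ + b) * (a - F.θ * b)) * γ := by ring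
      _ = (a - F.θ * b) * F.θ * (β * γ) := by rw [hPQ]; ring
      _ = _ := by rw [hβγ]; ring
  have x2 : (a - F.θ2 * b) * (a - F.θ2 * b) * β = F.θ2 * (((a * F.θ + b) + (a - F.θ * b)) / ((a * F.θ + b) - (a - F.θ * b))) := by
    have k1 : (a * F.θ + b) + (a - F.θ * b) = (F.θ + 1) * (a - F.θ2 * b) := by linear_combination (b:ℝ) * F.hθ2
    have k2 : (a * F.θ + b) - (a - F.θ * b) = (F.θ + 1) * (a * F.θ2 + b) := by linear_combination -(a:ℝ) * F.hθ2
    have hne : F.θ + 1 ≠ 0 := by linarith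
    rw [k1, k2, mul_div_mul_left _ _ hne]
    rw [← mul_div_assoc, eq_div_iff hP2ne]
    calc _ = (a - F.θ2 * b) * ((a * F.θ2 + b) * (a - F.θ2 * b)) * β := by ring
      _ = (a - F.θ2 * b) * F.θ2 * (β * γ) := by rw [hPQ2]; ring
      _ = _ := by rw [hβγ]; ring
  have nX := F.G_ne hG
  rw [L0] at e0
  rw [L2] at e2
  rw [tt] at e0 e2 nX
  simp only at e0 e2 nX
  rw [x0] at e0 nX
  rw [x2] at e2 nX
  rw [abs_mul, Real.log_mul (abs_ne_zero.2 hθ0) (abs_ne_zero.2 (right_ne_zero_of_mul nX.1)), Real.log_abs F.θ] at e0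
  rw [abs_mul, Real.log_mul (abs_ne_zero.2 p2.ne') (abs_ne_zero.2 (right_ne_zero_of_mul nX.2)), Real.log_abs F.θ2] at e2
  refine ⟨p - 1, q, ?_, ?_, hP, ?_, ?_⟩
  · have : F.T = Real.log F.θ := rfl
    push_cast; linarith
  · have : F.S = Real.log F.θ2 := rfl
    push_cast; linarith
  · rw [hPP]; exact mul_ne_zero (mul_ne_zero (mul_ne_zero two_ne_zero hα.ne') hθ0) hγ0
  · rw [hPQ, hPP]
    have : F.θ * β * (2 * (F.s + F.w) * F.θ * γ) = 2 * (F.s + F.w) * F.θ ^ 2 * (β * γ) := by ring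
    rw [this, hβγ, mul_one, abs_of_pos]
    have : 0 < F.θ := by linarith
    positivity

lemma num_lem : 4 * (2 * (F.s + F.w) * F.θ ^ 2) ≤ (1 + F.θ ^ 2) ^ 2 := by
  have hθ := F.hθ
  have h5 := F.hθ5
  have e1 : 2 * (F.s + F.w) * F.θ ^ 2 = F.θ * (F.θ ^ 2 - 1) := by linear_combination -F.θ * hθ
  rw [e1]
  generalize F.θ = t at h5
  have : 0 ≤ t * (t ^ 2 - 1) := by apply mul_nonneg; linarith; nlinarith
  have e2 : t * (t ^ 2 - 1) * 5 ≤ t ^ 2 * (t ^ 2 - 1) := by nlinarith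
  nlinarith

theorem out (a b : ℤ) (h : QF F.s a b = 1) : ∃ p q : ℤ, |p * F.T + q * F.S| ≤ 4 * Real.exp (-|p * F.S - q * F.T|) ∧
    ((a ^ 2 + b ^ 2 : ℤ) : ℝ) ≤ Real.exp |p * F.S - q * F.T| := by
  obtain ⟨p, q, e0, e2, hne, hne2, hprod⟩ := F.eps a b h
  have hU1 : (1:ℝ) ≤ ((a ^ 2 + b ^ 2 : ℤ) : ℝ) := by
    have : 0 < a ^ 2 + b ^ 2 := by
      rcases eq_or_ne a 0 with rfl | ha
      · rcases eq_or_ne b 0 with rfl | hb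
        · simp [QF] at h
        · positivity
      · positivity
    exact_mod_cast this
  have h5 := F.hθ5
  have hθ := F.hθ
  have hw0 := F.hw0
  have hw := F.hw
  obtain ⟨U, hU⟩ : ∃ U : ℝ, U = ((a ^ 2 + b ^ 2 : ℤ) : ℝ) := ⟨_, rfl⟩
  rw [← hU] at hU1 ⊢
  have hU' : U = a ^ 2 + b ^ 2 := by rw [hU]; push_cast; ring
  obtain ⟨P, hP⟩ : ∃ P : ℝ, P = a * F.θ + b := ⟨_, rfl⟩
  obtain ⟨Q, hQ⟩ : ∃ Q : ℝ, Q = a - F.θ * b := ⟨_, rfl⟩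
  have hPU : P ^ 2 + Q ^ 2 = U * (1 + F.θ ^ 2) := by rw [hU', hP, hQ]; ring
  rw [← hP, ← hQ] at e0 e2 hne hne2 hprod
  have hP0 := left_ne_zero_of_mul hne
  have hQ0 := right_ne_zero_of_mul hne
  have h3 : P - Q ≠ 0 := by intro h; apply hne2; linear_combination (P + Q) * h
  have h4 : P + Q ≠ 0 := by intro h; apply hne2; linear_combination (P - Q) * h
  have ee : (P + Q) / (P - Q) = (1 + Q / P) / (1 - Q / P) := by
    have : 1 - Q / P = (P - Q) / P := by field_simp
    rw [this]; field_simp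
  rw [ee] at e2
  obtain ⟨f, g, hf, hg, hfg, hA, hB, m1, m2⟩ := fg_of (Q / P) (div_ne_zero hQ0 hP0)
    (by intro h; rw [div_eq_one_iff_eq hP0] at h; apply h3; linarith)
    (by intro h; rw [div_eq_iff hP0] at h; apply h4; linarith) (4 * U ^ 2) (by
      have a1 : |Q / P * (1 - (Q / P) ^ 2)| = 2 * (F.s + F.w) * F.θ ^ 2 / P ^ 4 := by
        rw [← hprod]
        have : Q / P * (1 - (Q / P) ^ 2) = P * Q * (P ^ 2 - Q ^ 2) / P ^ 4 := by field_simp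
        rw [this, abs_div, abs_of_nonneg (by positivity : 0 ≤ P ^ 4)]
      have a2 : (1 + (Q / P) ^ 2) ^ 2 = U ^ 2 * (1 + F.θ ^ 2) ^ 2 / P ^ 4 := by
        rw [← mul_pow, ← hPU]; field_simp
      rw [a1, a2, ← mul_div_assoc]
      apply div_le_div_of_nonneg_right _ (by positivity)
      have := F.num_lem
      have := mul_le_mul_of_nonneg_left this (sq_nonneg U)
      linarith)
  rcases le_total g f with hle | hle
  · obtain ⟨r1, r2⟩ := fg_lem f g U hf hg hfg hle hU1 m1
    refine ⟨-q, p, ?_, ?_⟩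
    · have x1 : ((-q : ℤ):ℝ) * F.T + p * F.S = p * F.S - q * F.T := by push_cast; ring
      have x2 : ((-q : ℤ):ℝ) * F.S - p * F.T = -(p * F.T + q * F.S) := by push_cast; ring
      rw [x1, x2, abs_neg, ← e0, ← e2, hA, hB]; exact r1
    · have x2 : ((-q : ℤ):ℝ) * F.S - p * F.T = -(p * F.T + q * F.S) := by push_cast; ring
      rw [x2, abs_neg, ← e0, hA, Real.exp_log (by linarith)]; exact r2
  · obtain ⟨r1, r2⟩ := fg_lem g f U hg hf (by rw [mul_comm]; exact hfg) hle hU1 m2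
    refine ⟨p, q, ?_, ?_⟩
    · rw [← e0, ← e2, hA, hB]; exact r1
    · rw [← e2, hB, Real.exp_log (by linarith)]; exact r2
end Fld

end

section

namespace Fld
variable (F : Fld)

lemma S_bd : F.S < 0 ∧ 2 / (F.θ + 1) ≤ -F.S ∧ -F.S ≤ 1/2 := by
  have h5 := F.hθ5
  have e2 : F.θ2 = (F.θ - 1) / (F.θ + 1) := by rw [eq_div_iff (by linarith)]; exact F.hθ2
  have p2 := F.th2_pos
  have h1 : F.S ≤ F.θ2 - 1 := Real.log_le_sub_one_of_pos p2
  have h2 : -F.S ≤ F.θ2⁻¹ - 1 := by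
    rw [S, ← Real.log_inv]; exact Real.log_le_sub_one_of_pos (inv_pos.2 p2)
  have h3 : F.θ2 - 1 = -(2 / (F.θ + 1)) := by rw [e2]; field_simp; ring
  have h0 : 0 < F.θ - 1 := by linarith
  have h4 : F.θ2⁻¹ - 1 = 2 / (F.θ - 1) := by rw [e2]; field_simp; ring
  have h6 : 0 < 2 / (F.θ + 1) := by positivity
  have h7 : 2 / (F.θ - 1) ≤ 1 / 2 := by rw [div_le_iff₀ h0]; linarith
  refine ⟨by linarith, by linarith, by linarith⟩

lemma th_le (h : F.s ≤ 199) : F.θ ≤ 798 := by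
  have h5 := F.hθ5
  have hθ := F.hθ
  have hw := F.hw
  have hw0 := F.hw0
  have hs1 : (1:ℝ) ≤ F.s := by exact_mod_cast F.hs
  have hs : (F.s:ℝ) ≤ 199 := by exact_mod_cast h
  have hw1 : F.w ≤ 199.5 := by
    by_contra hc
    push Not at hc
    have := mul_lt_mul'' hc hc (by norm_num) (by norm_num)
    have := mul_le_mul hs hs (by positivity) (by norm_num)
    linarith
  by_contra hc
  push Not at hc
  have : F.θ * F.θ ≤ 797 * F.θ + 1 := by
    rw [hθ]
    have := mul_le_mul_of_nonneg_right (by linarith : 2 * (F.s + F.w) ≤ 797) (by linarith : 0 ≤ F.θ)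
    linarith
  nlinarith

lemma T_bd (h : F.s ≤ 199) : 1 ≤ F.T ∧ F.T ≤ 7 := by
  have h5 := F.hθ5
  have h6 := F.th_le h
  have e1 := Real.exp_one_lt_d9
  have e2 := Real.exp_one_gt_d9
  constructor
  · rw [T, Real.le_log_iff_exp_le (by linarith)]; linarith
  · rw [T, Real.log_le_iff_le_exp (by linarith)]
    have : Real.exp 7 = Real.exp 1 ^ 7 := by rw [← Real.exp_nat_mul]; norm_num
    rw [this]
    have := pow_le_pow_left₀ (by norm_num) e2.le 7
    refine le_trans ?_ this
    norm_num
    linarith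

def pr0 : F.ring →+* ℝ := (RingHom.fst ℝ (ℝ × ℝ × ℝ)).comp F.ring.subtype
def pr1 : F.ring →+* ℝ := ((RingHom.fst ℝ (ℝ × ℝ)).comp (RingHom.snd ℝ (ℝ × ℝ × ℝ))).comp F.ring.subtype
def pr2 : F.ring →+* ℝ := ((RingHom.fst ℝ ℝ).comp ((RingHom.snd ℝ (ℝ × ℝ)).comp (RingHom.snd ℝ (ℝ × ℝ × ℝ)))).comp F.ring.subtype
def pr3 : F.ring →+* ℝ := ((RingHom.snd ℝ ℝ).comp ((RingHom.snd ℝ (ℝ × ℝ)).comp (RingHom.snd ℝ (ℝ × ℝ × ℝ)))).comp F.ring.subtype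

lemma apply_lfl (h : F.s ≤ 199) (p q : ℕ) (hpq : Nat.Coprime p q) (hq : 10 ^ 30 ≤ q)
    (hsmall : |p * F.T + q * F.S| ≤ 4 * Real.exp (-q)) : False := by
  obtain ⟨s1, s2, s3⟩ := F.S_bd
  obtain ⟨t1, t2⟩ := F.T_bd h
  have h5 := F.hθ5
  have h0 : 0 < F.θ := by linarith
  have p2 := F.th2_pos
  have E1 : Real.exp (2 * F.T) = F.θ * F.θ := by rw [two_mul, Real.exp_add, T, Real.exp_log h0]
  have E2 : Real.exp (2 * F.S) = F.θ2 * F.θ2 := by rw [two_mul, Real.exp_add, S, Real.exp_log p2]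
  have m1 : F.tup (0, 0, 1, 0) ∈ F.ring := ⟨_, rfl⟩
  have m2 : F.tup (-1 + F.s, -1, -F.s, 1) ∈ F.ring := ⟨_, rfl⟩
  have v1 : F.tup (0, 0, 1, 0) = (F.θ, -F.θ⁻¹, F.θ2, -F.θ2⁻¹) := by
    simp [tup, val, F.th_inv, F.th2_inv]
  have v2 := F.tup_th2
  have ne0 := h0.ne'
  have ne2 := p2.ne'
  refine lfl F.pr0 F.pr1 F.pr2 F.pr3 ?_ (⟨_, m1⟩ * ⟨_, m1⟩) (⟨_, m2⟩ * ⟨_, m2⟩) (2 * F.T) (2 * F.S) (by linarith) (by linarith) ?_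
    ?_ ?_ ?_ ?_ ?_ ?_ ?_ ?_ p q hpq hq ?_
  · rintro ⟨x, ⟨X, rfl⟩⟩ hx
    exact F.norm_ge X hx
  · rw [abs_le]; constructor <;> linarith
  · rw [map_mul, E1]
    show (F.tup (0, 0, 1, 0)).1 * (F.tup (0, 0, 1, 0)).1 = _
    rw [v1]
  · rw [map_mul, Real.exp_neg, E1]
    show (F.tup (0, 0, 1, 0)).2.1 * (F.tup (0, 0, 1, 0)).2.1 = _
    rw [v1]; field_simp
  · rw [map_mul, E2]
    show (F.tup (0, 0, 1, 0)).2.2.1 * (F.tup (0, 0, 1, 0)).2.2.1 = _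
    rw [v1]
  · rw [map_mul, Real.exp_neg, E2]
    show (F.tup (0, 0, 1, 0)).2.2.2 * (F.tup (0, 0, 1, 0)).2.2.2 = _
    rw [v1]; field_simp
  · rw [map_mul, E2]
    show (F.tup (-1 + F.s, -1, -F.s, 1)).1 * (F.tup (-1 + F.s, -1, -F.s, 1)).1 = _
    rw [v2]
  · rw [map_mul, Real.exp_neg, E2]
    show (F.tup (-1 + F.s, -1, -F.s, 1)).2.1 * (F.tup (-1 + F.s, -1, -F.s, 1)).2.1 = _
    rw [v2]; field_simp
  · rw [map_mul, Real.exp_neg, E1]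
    show (F.tup (-1 + F.s, -1, -F.s, 1)).2.2.1 * (F.tup (-1 + F.s, -1, -F.s, 1)).2.2.1 = _
    rw [v2]; field_simp
  · rw [map_mul, E1]
    show (F.tup (-1 + F.s, -1, -F.s, 1)).2.2.2 * (F.tup (-1 + F.s, -1, -F.s, 1)).2.2.2 = _
    rw [v2]
  · have : (p:ℝ) * (2 * F.T) + q * (2 * F.S) = 2 * (p * F.T + q * F.S) := by ring
    rw [this, abs_mul, abs_two]; linarith

def Cert : Prop := ∃ A B : ℕ, Nat.Coprime A B ∧ 10 ^ 30 ≤ A ∧ A ≤ 10 ^ 33 ∧ |A * F.S + B * F.T| * (2 * 10 ^ 30) ≤ F.T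

lemma case_small (h : F.s ≤ 199) (hc : F.Cert) (p q : ℕ) (hq0 : 0 < q) (hq : q < 10 ^ 30)
    (hsm : |p * F.T + q * F.S| ≤ 4 / 10 ^ 34) : False := by
  obtain ⟨A, B, hAB, hA1, hA2, hAB2⟩ := hc
  obtain ⟨t1, t2⟩ := F.T_bd h
  obtain ⟨ε, hε⟩ : ∃ ε, ε = p * F.T + q * F.S := ⟨_, rfl⟩
  obtain ⟨δ, hδ⟩ : ∃ δ, δ = A * F.S + B * F.T := ⟨_, rfl⟩
  rw [← hε] at hsm
  rw [← hδ] at hAB2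
  have key : ((A * p - q * B : ℤ) : ℝ) * F.T = A * ε - q * δ := by rw [hε, hδ]; push_cast; ring
  by_cases hz : (A * p - q * B : ℤ) = 0
  · have h1 : A * p = q * B := by have : (A * p : ℤ) = q * B := by linarith
                                  exact_mod_cast this
    have h2 : A ∣ q * B := ⟨p, h1.symm⟩
    have h3 : A ∣ q := hAB.dvd_of_dvd_mul_right h2
    have := Nat.le_of_dvd hq0 h3
    omega
  · have h1 : (1:ℝ) ≤ |((A * p - q * B : ℤ) : ℝ)| := by exact_mod_cast Int.one_le_abs hz
    have h2 : F.T ≤ |A * ε - q * δ| := by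
      rw [← key, abs_mul, abs_of_nonneg (by linarith : 0 ≤ F.T)]
      exact le_mul_of_one_le_left (by linarith) h1
    have h3 : |A * ε - q * δ| ≤ A * |ε| + q * |δ| := by
      have := abs_sub (A * ε) (q * δ)
      rwa [abs_mul, abs_mul, Nat.abs_cast, Nat.abs_cast] at this
    have h4 : (A:ℝ) * |ε| ≤ 10 ^ 33 * (4 / 10 ^ 34) := mul_le_mul (by exact_mod_cast hA2) hsm (abs_nonneg _) (by norm_num)
    have h5 : (q:ℝ) * |δ| ≤ 10 ^ 30 * |δ| := mul_le_mul_of_nonneg_right (by exact_mod_cast hq.le) (abs_nonneg _)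
    norm_num at h4 h5 hAB2
    linarith

lemma case_pos (h : F.s ≤ 199) (hc : F.Cert) (p q : ℕ) (hp0 : 0 < p) (hq0 : 0 < q)
    (hsm : |p * F.T + q * F.S| ≤ 4 * Real.exp (-(q * F.T - p * F.S)))
    (hU : 10 ^ 34 ≤ Real.exp (q * F.T - p * F.S)) : False := by
  obtain ⟨s1, s2, s3⟩ := F.S_bd
  obtain ⟨t1, t2⟩ := F.T_bd h
  obtain ⟨g, p', q', hg, hco, rfl, rfl⟩ := Nat.exists_coprime' (m := p) (n := q) (Nat.gcd_pos_of_pos_left _ hp0)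
  have hq' : 0 < q' := Nat.pos_of_mul_pos_right hq0 |> fun h => by
    rcases Nat.eq_zero_or_pos q' with h | h
    · subst h; simp at hq0
    · exact h
  have hsm' : |p' * F.T + q' * F.S| ≤ 4 * Real.exp (-((q' * g : ℕ) * F.T - (p' * g : ℕ) * F.S)) := by
    refine le_trans ?_ hsm
    have : ((p' * g : ℕ):ℝ) * F.T + (q' * g : ℕ) * F.S = (p' * F.T + q' * F.S) * g := by push_cast; ring
    rw [this, abs_mul, Nat.abs_cast]
    have hg1 : (1:ℝ) ≤ g := by exact_mod_cast hg
    exact le_mul_of_one_le_right (abs_nonneg _) hg1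
  rcases lt_or_ge q' (10 ^ 30) with hlt | hge
  · refine F.case_small h hc p' q' hq' hlt (hsm'.trans ?_)
    rw [Real.exp_neg, div_eq_mul_inv]
    apply mul_le_mul_of_nonneg_left _ (by norm_num)
    exact inv_anti₀ (by positivity) hU
  · refine F.apply_lfl h p' q' hco hge (hsm'.trans ?_)
    apply mul_le_mul_of_nonneg_left _ (by norm_num)
    apply Real.exp_le_exp.2
    have hg1 : (1:ℝ) ≤ g := by exact_mod_cast hg
    have a1 : (q':ℝ) ≤ (q' * g : ℕ) := by push_cast; exact le_mul_of_one_le_right (Nat.cast_nonneg _) hg1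
    have a2 : ((q' * g : ℕ):ℝ) ≤ (q' * g : ℕ) * F.T := le_mul_of_one_le_right (Nat.cast_nonneg _) t1
    have a3 : ((p' * g : ℕ):ℝ) * F.S ≤ 0 := mul_nonpos_of_nonneg_of_nonpos (Nat.cast_nonneg _) s1.le
    linarith

theorem U_lt (h : F.s ≤ 199) (hc : F.Cert) (a b : ℤ) (hab : QF F.s a b = 1) : a ^ 2 + b ^ 2 < 10 ^ 34 := by
  by_contra hcon
  push Not at hcon
  obtain ⟨p, q, hsm, hU⟩ := F.out a b hab
  have hU' : (10:ℝ) ^ 34 ≤ Real.exp |p * F.S - q * F.T| := by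
    refine le_trans ?_ hU
    exact_mod_cast hcon
  clear hU
  obtain ⟨s1, s2, s3⟩ := F.S_bd
  obtain ⟨t1, t2⟩ := F.T_bd h
  have hth := F.th_le h
  have h5 := F.hθ5
  have hsl : 1 / 400 ≤ - F.S := by
    refine le_trans ?_ s2
    rw [div_le_div_iff₀ (by norm_num) (by linarith)]
    linarith
  have small : |p * F.T + q * F.S| ≤ 4 / 10 ^ 34 := by
    refine hsm.trans ?_
    rw [Real.exp_neg, div_eq_mul_inv]
    apply mul_le_mul_of_nonneg_left _ (by norm_num)
    exact inv_anti₀ (by positivity) hU'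
  obtain ⟨sm1, sm2⟩ := abs_le.1 small
  norm_num at sm1 sm2
  rcases lt_trichotomy p 0 with hp | hp | hp
  · have hp' : (p:ℝ) ≤ -1 := by exact_mod_cast (by omega : p ≤ -1)
    have hpT : (p:ℝ) * F.T ≤ -1 := by nlinarith
    rcases lt_or_ge q 0 with hq | hq
    · obtain ⟨p', rfl⟩ : ∃ p' : ℕ, p = -(p' : ℤ) := ⟨p.natAbs, by omega⟩
      obtain ⟨q', rfl⟩ : ∃ q' : ℕ, q = -(q' : ℤ) := ⟨q.natAbs, by omega⟩
      have e1 : |((-(p':ℤ) : ℤ) : ℝ) * F.T + ((-(q':ℤ) : ℤ) : ℝ) * F.S| = |p' * F.T + q' * F.S| := by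
        rw [← abs_neg]; congr 1; push_cast; ring
      have e2 : |((-(p':ℤ) : ℤ) : ℝ) * F.S - ((-(q':ℤ) : ℤ) : ℝ) * F.T| = q' * F.T - p' * F.S := by
        have : ((-(p':ℤ) : ℤ) : ℝ) * F.S - ((-(q':ℤ) : ℤ) : ℝ) * F.T = q' * F.T - p' * F.S := by push_cast; ring
        rw [this, abs_of_nonneg]
        have a2 : 0 ≤ (q':ℝ) * F.T := by positivity
        have a3 : (p':ℝ) * F.S ≤ 0 := mul_nonpos_of_nonneg_of_nonpos (Nat.cast_nonneg _) s1.le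
        linarith
      rw [e1, e2] at hsm
      rw [e2] at hU'
      exact F.case_pos h hc p' q' (by omega) (by omega) hsm hU'
    · have : (q:ℝ) * F.S ≤ 0 := mul_nonpos_of_nonneg_of_nonpos (by exact_mod_cast hq) s1.le
      linarith
  · subst hp
    simp only [Int.cast_zero, zero_mul, zero_add, zero_sub] at *
    rcases eq_or_ne q 0 with hq | hq
    · subst hq
      norm_num at hU'
    · have h1 : (1:ℝ) ≤ |(q:ℝ)| := by exact_mod_cast Int.one_le_abs hq
      rw [abs_mul, abs_of_neg s1] at small
      norm_num at small
      nlinarith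
  · have hp' : (1:ℝ) ≤ p := by exact_mod_cast (by omega : 1 ≤ p)
    have hpT : 1 ≤ (p:ℝ) * F.T := by nlinarith
    rcases lt_or_ge 0 q with hq | hq
    · obtain ⟨p', rfl⟩ : ∃ p' : ℕ, p = (p' : ℤ) := ⟨p.natAbs, by omega⟩
      obtain ⟨q', rfl⟩ : ∃ q' : ℕ, q = (q' : ℤ) := ⟨q.natAbs, by omega⟩
      have e2 : |((p':ℤ) : ℝ) * F.S - ((q':ℤ) : ℝ) * F.T| = q' * F.T - p' * F.S := by
        rw [abs_sub_comm, Int.cast_natCast, Int.cast_natCast, abs_of_nonneg]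
        have a2 : 0 ≤ (q':ℝ) * F.T := by positivity
        have a3 : (p':ℝ) * F.S ≤ 0 := mul_nonpos_of_nonneg_of_nonpos (Nat.cast_nonneg _) s1.le
        linarith
      rw [e2] at hsm hU'
      exact F.case_pos h hc p' q' (by omega) (by omega) (by exact_mod_cast hsm) hU'
    · have : 0 ≤ (q:ℝ) * F.S := mul_nonneg_of_nonpos_of_nonpos (by exact_mod_cast hq) s1.le
      linarith

end Fld

end

section

def frc {α : Type} (n : ℕ) (f : ℕ → α) : α := Nat.rec (f 0) (fun k _ => f (Nat.succ k)) n

lemma frc_eq {α : Type} (n : ℕ) (f : ℕ → α) : frc n f = f n := by cases n <;> rfl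

def WW : ℕ := 2 ^ 256
def L2l : ℕ := 80260960185991308862233904206310070533990667611589946606122867505419956976098
def L2u : ℕ := 80260960185991308862233904206310070533990667611589946606122867505419956976276

noncomputable def nwt (n fuel : ℕ) : ℕ → ℕ :=
  Nat.rec (motive := fun _ => ℕ → ℕ) (fun x => x) (fun _ ih x => frc ((x + n / x) / 2) ih) fuel

noncomputable def loopLo (x2 fuel : ℕ) : ℕ → ℕ → ℕ → ℕ :=
  Nat.rec (motive := fun _ => ℕ → ℕ → ℕ → ℕ) (fun _ _ acc => acc)
    (fun _ ih i p acc => frc (i + 1) fun i' => frc (p * x2 / WW) fun p' => frc (acc + p / (2 * i + 1)) fun acc' => ih i' p' acc') fuel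

noncomputable def loopUp (x2 fuel : ℕ) : ℕ → ℕ → ℕ → ℕ :=
  Nat.rec (motive := fun _ => ℕ → ℕ → ℕ → ℕ) (fun _ p acc => acc + 2 * p)
    (fun _ ih i p acc => frc (i + 1) fun i' => frc (p * x2 / WW + 1) fun p' => frc (acc + (p / (2 * i + 1) + 1)) fun acc' => ih i' p' acc') fuel

noncomputable def aLo (X : ℕ) : ℕ := frc X fun X => frc (X * X / WW) fun x2 => loopLo x2 80 0 X 0
noncomputable def aUp (X : ℕ) : ℕ := frc X fun X => frc (X * X / WW + 1) fun x2 => loopUp x2 80 0 X 0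

noncomputable def cf (fuel : ℕ) : ℕ → ℕ → ℕ → ℕ → ℕ → ℕ → (ℕ → ℕ → Bool) → Bool :=
  Nat.rec (motive := fun _ => ℕ → ℕ → ℕ → ℕ → ℕ → ℕ → (ℕ → ℕ → Bool) → Bool) (fun _ _ _ _ p1 q1 k => k q1 p1)
    (fun _ ih n d p0 q0 p1 q1 k => Bool.rec
       (frc (n % d) fun d' => frc (n / d * p1 + p0) fun p' => frc (n / d * q1 + q0) fun q' => ih d d' p1 q1 p' q' k)
       (k q1 p1) (Nat.ble (2 * 10 ^ 30) q1)) fuel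

def chkAB (a b Tl Tu A B : ℕ) : Bool :=
  Nat.beq (Nat.gcd A B) 1 && (Nat.ble (10 ^ 30) A && (Nat.ble A (10 ^ 33) &&
  (Nat.ble (2 * 10 ^ 30 * A * b) (Tl + 2 * 10 ^ 30 * B * Tl) && Nat.ble (2 * 10 ^ 30 * B * Tu) (Tl + 2 * 10 ^ 30 * A * a))))

def chkTh (s tl tu : ℕ) : Bool :=
  Nat.ble (2 * s * tl * WW + WW * WW) (tl * tl) && (Nat.ble (2 * s * tu * WW + WW * WW) (tu * tu) &&
  (Nat.ble ((tl * tl - (2 * s * tl * WW + WW * WW)) ^ 2) (4 * (s * s + 1) * (tl * WW) ^ 2) &&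
   Nat.ble (4 * (s * s + 1) * (tu * WW) ^ 2) ((tu * tu - (2 * s * tu * WW + WW * WW)) ^ 2)))

noncomputable def chk2 (s tl tu m : ℕ) : Bool :=
  chkTh s tl tu && (Nat.ble (2 ^ m * WW) tl && (Nat.ble (WW * 5) tl &&
  frc (WW * WW / tu) fun xl => frc (WW * WW / tl + 1) fun xu =>
  frc ((tl - 2 ^ m * WW) * WW / (tl + 2 ^ m * WW)) fun yl =>
  frc ((tu - 2 ^ m * WW) * WW / (tu + 2 ^ m * WW) + 1) fun yu =>
  Nat.ble (xu * 2) WW && (Nat.ble (yu * 2) WW &&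
  frc (2 * aLo xl) fun a => frc (2 * aUp xu) fun b =>
  frc (m * L2l + 2 * aLo yl) fun Tl => frc (m * L2u + 2 * aUp yu) fun Tu =>
  cf 200 a Tl 0 1 1 0 (chkAB a b Tl Tu))))

noncomputable def thA (s : ℕ) : ℕ :=
  frc (s * WW + nwt ((s * s + 1) * (WW * WW)) 12 ((s + 1) * WW)) fun al =>
    al + nwt (al * al + WW * WW) 12 (al + WW)

noncomputable def chk1 (s : ℕ) : Bool :=
  frc (thA s) fun th => frc (th - 8) fun tl => frc (th + 8) fun tu => frc (Nat.log2 (th / WW)) fun m => chk2 s tl tu m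

noncomputable def chkAll (n : ℕ) : Bool := Nat.rec true (fun k ih => chk1 (k + 1) && ih) n

lemma L2_lo : Nat.ble L2l (2 * aLo (WW / 3)) = true := by decide +kernel
lemma L2_up : Nat.ble (2 * aUp (WW / 3 + 1)) L2u = true := by decide +kernel
lemma chk_199 : chkAll 199 = true := by decide +kernel
lemma WW_pos : (0:ℝ) < (WW:ℝ) := by unfold WW; positivity
lemma WW_posn : 0 < WW := by unfold WW; positivity
attribute [irreducible] WW

end

section

open Finset


lemma dv_le (a b : ℕ) (_ : 0 < b) : ((a / b : ℕ):ℝ) ≤ (a:ℝ) / b := Nat.cast_div_le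
lemma le_dv (a b : ℕ) (hb : 0 < b) : (a:ℝ) / b ≤ ((a / b + 1 : ℕ):ℝ) := by
  rw [div_le_iff₀ (by exact_mod_cast hb)]
  have := Nat.lt_div_mul_add (a := a) hb
  have h2 : a ≤ (a / b + 1) * b := by rw [add_mul]; linarith
  exact_mod_cast h2

lemma loopLo_succ (x2 f i p acc : ℕ) : loopLo x2 (f+1) i p acc = loopLo x2 f (i+1) (p * x2 / WW) (acc + p / (2*i+1)) := by
  unfold loopLo
  simp only [frc_eq]

lemma loopUp_succ (x2 f i p acc : ℕ) : loopUp x2 (f+1) i p acc = loopUp x2 f (i+1) (p * x2 / WW + 1) (acc + (p / (2*i+1) + 1)) := by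
  unfold loopUp
  simp only [frc_eq]

lemma loopLo_le (x : ℝ) (hx : 0 ≤ x) (x2 : ℕ) (h2 : (x2:ℝ) ≤ WW * x ^ 2) (f : ℕ) : ∀ (i p acc : ℕ), (p:ℝ) ≤ WW * x ^ (2*i+1) →
    (acc:ℝ) ≤ WW * ∑ j ∈ range i, x ^ (2*j+1) / (2*j+1) →
    (loopLo x2 f i p acc : ℝ) ≤ WW * ∑ j ∈ range (i+f), x ^ (2*j+1) / (2*j+1) := by
  have hW := WW_pos
  induction f with
  | zero => intro i p acc hp ha; exact ha
  | succ f ih =>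
    intro i p acc hp ha
    rw [loopLo_succ, show i + (f+1) = (i+1) + f by ring]
    apply ih
    · refine (dv_le _ _ WW_posn).trans ?_
      rw [div_le_iff₀ hW]
      push_cast
      calc (p:ℝ) * x2 ≤ (WW * x ^ (2*i+1)) * (WW * x ^ 2) := mul_le_mul hp h2 (by positivity) (by positivity)
        _ = _ := by ring
    · rw [sum_range_succ, mul_add]
      push_cast
      refine add_le_add ha ((dv_le _ _ (by omega)).trans ?_)
      push_cast
      rw [← mul_div_assoc]
      gcongr

lemma loopUp_ge (x : ℝ) (_hx : 0 ≤ x) (x2 : ℕ) (h2 : WW * x ^ 2 ≤ (x2:ℝ)) (f : ℕ) : ∀ (i p acc : ℕ), WW * x ^ (2*i+1) ≤ (p:ℝ) →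
    WW * ∑ j ∈ range i, x ^ (2*j+1) / (2*j+1) ≤ (acc:ℝ) →
    WW * (∑ j ∈ range (i+f), x ^ (2*j+1) / (2*j+1) + 2 * x ^ (2*(i+f)+1)) ≤ (loopUp x2 f i p acc : ℝ) := by
  have hW := WW_pos
  induction f with
  | zero =>
    intro i p acc hp ha
    have : loopUp x2 0 i p acc = acc + 2 * p := rfl
    rw [this]; push_cast
    simp only [add_zero]
    linarith
  | succ f ih =>
    intro i p acc hp ha
    rw [loopUp_succ, show i + (f+1) = (i+1) + f by ring]
    apply ih
    · refine le_trans ?_ (le_dv _ _ WW_posn)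
      rw [le_div_iff₀ hW]
      push_cast
      calc _ = (WW * x ^ (2*i+1)) * (WW * x ^ 2) := by ring
        _ ≤ (p:ℝ) * x2 := mul_le_mul hp h2 (by positivity) (by positivity)
    · rw [sum_range_succ, mul_add]
      rw [Nat.cast_add acc]
      refine add_le_add ha (le_trans ?_ (le_dv _ _ (by omega)))
      push_cast
      rw [← mul_div_assoc]
      gcongr

lemma aLo_le (x : ℝ) (X : ℕ) (h : (X:ℝ) ≤ WW * x) (h0 : 0 ≤ x) (h1 : x < 1) :
    (2 * aLo X : ℝ) ≤ WW * Real.log ((1 + x) / (1 - x)) := by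
  have hW := WW_pos
  have e : aLo X = loopLo (X * X / WW) 80 0 X 0 := by simp only [aLo, frc_eq]
  have k := loopLo_le x h0 (X*X/WW) (by
    refine (dv_le _ _ WW_posn).trans ?_
    rw [div_le_iff₀ hW]
    push_cast
    calc (X:ℝ) * X ≤ (WW * x) * (WW * x) := mul_le_mul h h (by positivity) (by positivity)
      _ = _ := by ring) 80 0 X 0 (by rw [mul_zero, zero_add, pow_one]; exact h) (by rw [sum_range_zero, mul_zero, Nat.cast_zero])
  rw [e]
  have l := Real.sum_range_le_log_div h0 h1 (0+80)
  have := mul_le_mul_of_nonneg_left l hW.le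
  linarith

lemma aUp_ge (x : ℝ) (X : ℕ) (h : WW * x ≤ (X:ℝ)) (h0 : 0 ≤ x) (h1 : x ≤ 1/2) :
    WW * Real.log ((1 + x) / (1 - x)) ≤ (2 * aUp X : ℝ) := by
  have hW := WW_pos
  have e : aUp X = loopUp (X * X / WW + 1) 80 0 X 0 := by simp only [aUp, frc_eq]
  have k := loopUp_ge x h0 (X*X/WW+1) (by
    refine le_trans ?_ (le_dv _ _ WW_posn)
    rw [le_div_iff₀ hW]
    push_cast
    calc _ = (WW * x) * (WW * x) := by ring
      _ ≤ (X:ℝ) * X := mul_le_mul h h (mul_nonneg hW.le h0) (Nat.cast_nonneg X)) 80 0 X 0 (by rw [mul_zero, zero_add, pow_one]; exact h) (by rw [sum_range_zero, mul_zero, Nat.cast_zero])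
  rw [e]
  have l := Real.log_div_le_sum_range_add h0 (by linarith) (0+80)
  have t : x ^ (2*(0+80)+1) / (1 - x^2) ≤ 2 * x ^ (2*(0+80)+1) := by
    have : 1/2 ≤ 1 - x^2 := by nlinarith
    rw [div_le_iff₀ (by linarith)]
    have hp : 0 ≤ x ^ (2*(0+80)+1) := by positivity
    nlinarith
  have := mul_le_mul_of_nonneg_left (l.trans (add_le_add_right t _)) hW.le
  linarith

lemma log2_bd : (L2l:ℝ) ≤ WW * Real.log 2 ∧ WW * Real.log 2 ≤ (L2u:ℝ) := by
  have a := Nat.le_of_ble_eq_true L2_lo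
  have b := Nat.le_of_ble_eq_true L2_up
  have a' : (L2l:ℝ) ≤ 2 * aLo (WW/3) := by exact_mod_cast a
  have b' : (2 * aUp (WW/3+1) : ℝ) ≤ L2u := by exact_mod_cast b
  have e : ((1 + 1/3) / (1 - 1/3) : ℝ) = 2 := by norm_num
  have c := aLo_le (1/3) (WW/3) ((dv_le _ _ (by norm_num)).trans (by push_cast; apply le_of_eq; ring)) (by norm_num) (by norm_num)
  have d := aUp_ge (1/3) (WW/3+1) (le_trans (by push_cast; apply le_of_eq; ring) (le_dv _ _ (by norm_num))) (by norm_num) (by norm_num)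
  rw [e] at c d
  exact ⟨a'.trans c, d.trans b'⟩

lemma cf_imp (f : ℕ) (k : ℕ → ℕ → Bool) : ∀ n d p0 q0 p1 q1, cf f n d p0 q0 p1 q1 k = true → ∃ A B, k A B = true := by
  induction f with
  | zero => intro n d p0 q0 p1 q1 h; exact ⟨_, _, h⟩
  | succ f ih =>
    intro n d p0 q0 p1 q1 h
    change (Bool.rec _ _ _ : Bool) = true at h
    cases hb : Nat.ble (2 * 10 ^ 30) q1 with
    | true => rw [hb] at h; exact ⟨_, _, h⟩
    | false =>
      rw [hb] at h
      unfold cf at ih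
      simp only [frc_eq] at h ih
      exact ih _ _ _ _ _ _ h

end

section

lemma chkAll_imp (n : ℕ) (h : chkAll n = true) : ∀ s, 1 ≤ s → s ≤ n → chk1 s = true := by
  induction n with
  | zero => intro s h1 h2; omega
  | succ n ih =>
    intro s h1 h2
    have h' : (chk1 (n + 1) && chkAll n) = true := h
    rw [Bool.and_eq_true] at h'
    rcases Nat.lt_or_ge s (n+1) with h3 | h3
    · exact ih h'.2 s h1 (by omega)
    · rw [show s = n + 1 by omega]; exact h'.1

lemma dv_mono (a b c d : ℝ) (hb : 0 < b) (hd : 0 < d) (h : a * d ≤ c * b) : a / b ≤ c / d := by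
  rw [div_le_div_iff₀ hb hd]; exact h

namespace Fld
variable (F : Fld)

lemma th_key : (F.θ * F.θ - 1) = 2 * (F.s + F.w) * F.θ := by linarith [F.hθ]

lemma chkTh_imp (tl tu : ℕ) (h : chkTh F.s tl tu = true) : (tl:ℝ) ≤ WW * F.θ ∧ WW * F.θ ≤ (tu:ℝ) := by
  have hW := WW_pos
  have h5 := F.hθ5
  have hk := F.th_key
  have hw := F.hw
  have hw0 := F.hw0
  simp only [chkTh, Bool.and_eq_true, Nat.ble_eq] at h
  obtain ⟨h1, h2, h3, h4⟩ := h
  have h3' : ((tl * tl - (2 * F.s * tl * WW + WW * WW) : ℝ)) ^ 2 ≤ (2 * F.w * (tl * WW)) ^ 2 := by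
    have := (Nat.cast_le (α := ℝ)).2 h3
    push_cast [Nat.cast_sub h1] at this
    calc _ ≤ _ := this
      _ = _ := by rw [← hw]; ring
  have h4' : (2 * F.w * (tu * WW)) ^ 2 ≤ ((tu * tu - (2 * F.s * tu * WW + WW * WW) : ℝ)) ^ 2 := by
    have := (Nat.cast_le (α := ℝ)).2 h4
    push_cast [Nat.cast_sub h2] at this
    calc _ = _ := by rw [mul_pow (2 * F.w), mul_pow 2 F.w, pow_two F.w, hw]; ring
      _ ≤ _ := this
  have h1' := (Nat.cast_le (α := ℝ)).2 h1
  have h2' := (Nat.cast_le (α := ℝ)).2 h2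
  push_cast at h1' h2'
  have t0 : (0:ℝ) ≤ tl := Nat.cast_nonneg _
  have t1 : (0:ℝ) ≤ tu := Nat.cast_nonneg _
  have h3'' := abs_le_of_sq_le_sq' h3' (by positivity)
  have h4'' := abs_le_of_sq_le_sq' h4' (by linarith)
  have hθ0 : 0 < F.θ := by linarith
  constructor
  · by_contra hc
    push Not at hc
    have a1 : (tl * tl - WW * WW : ℝ) ≤ 2 * (F.s + F.w) * (tl * WW) := by linarith [h3''.2]
    have a2 := mul_le_mul_of_nonneg_right a1 hθ0.le
    have a3 : (tl - WW * F.θ) * (tl * F.θ + WW) ≤ 0 := by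
      have : 2 * (F.s + F.w) * (tl * WW) * F.θ = (F.θ * F.θ - 1) * (tl * WW) := by rw [hk]; ring
      rw [this] at a2
      linarith
    have a4 : 0 < (tl - WW * F.θ) * (tl * F.θ + WW) := mul_pos (by linarith) (by positivity)
    linarith
  · by_contra hc
    push Not at hc
    have a1 : 2 * (F.s + F.w) * (tu * WW) ≤ (tu * tu - WW * WW : ℝ) := by linarith [h4''.2]
    have a2 := mul_le_mul_of_nonneg_right a1 hθ0.le
    have a3 : 0 ≤ (tu - WW * F.θ) * (tu * F.θ + WW) := by
      have : 2 * (F.s + F.w) * (tu * WW) * F.θ = (F.θ * F.θ - 1) * (tu * WW) := by rw [hk]; ring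
      rw [this] at a2
      linarith
    have a4 : 0 < (WW * F.θ - tu) * (tu * F.θ + WW) := mul_pos (by linarith) (by positivity)
    linarith

lemma S_eq : -F.S = Real.log ((1 + 1 / F.θ) / (1 - 1 / F.θ)) := by
  have h5 := F.hθ5
  have e2 : F.θ2 = (F.θ - 1) / (F.θ + 1) := by rw [eq_div_iff (by linarith)]; exact F.hθ2
  rw [S, ← Real.log_inv, e2]
  congr 1
  have h1 : F.θ - 1 ≠ 0 := by linarith
  have h2 : F.θ ≠ 0 := by linarith
  have h3 : F.θ + 1 ≠ 0 := by linarith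
  have h4 : 1 - 1 / F.θ ≠ 0 := by
    rw [show 1 - 1 / F.θ = (F.θ - 1) / F.θ by field_simp]; exact div_ne_zero h1 h2
  rw [inv_div, div_eq_div_iff h1 h4]
  field_simp

lemma T_eq (m : ℕ) : F.T = m * Real.log 2 + Real.log ((1 + (F.θ - 2 ^ m) / (F.θ + 2 ^ m)) / (1 - (F.θ - 2 ^ m) / (F.θ + 2 ^ m))) := by
  have h5 := F.hθ5
  have hM : (0:ℝ) < 2 ^ m := by positivity
  have h2 : F.θ ≠ 0 := by linarith
  have h3 : F.θ + 2 ^ m ≠ 0 := by linarith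
  have e : (1 + (F.θ - 2 ^ m) / (F.θ + 2 ^ m)) / (1 - (F.θ - 2 ^ m) / (F.θ + 2 ^ m)) = F.θ / 2 ^ m := by
    have e1 : 1 + (F.θ - 2 ^ m) / (F.θ + 2 ^ m) = 2 * F.θ / (F.θ + 2 ^ m) := by field_simp; ring
    have e2 : 1 - (F.θ - 2 ^ m) / (F.θ + 2 ^ m) = 2 * 2 ^ m / (F.θ + 2 ^ m) := by field_simp; ring
    rw [e1, e2, div_div_div_cancel_right₀ h3, mul_div_mul_left _ _ (by norm_num)]
  rw [e, Real.log_div h2 hM.ne', Real.log_pow, T]; ring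

lemma cert (h : F.s ≤ 199) : F.Cert := by
  have hW := WW_pos
  have h5 := F.hθ5
  have c := chkAll_imp 199 chk_199 F.s F.hs h
  simp only [chk1, frc_eq] at c
  generalize thA F.s - 8 = tl at c
  generalize thA F.s + 8 = tu at c
  generalize Nat.log2 (thA F.s / WW) = m at c
  simp only [chk2, frc_eq, Bool.and_eq_true, Nat.ble_eq] at c
  obtain ⟨c1, c2, c3, c4, c5, c6⟩ := c
  obtain ⟨A, B, c6⟩ := cf_imp _ _ _ _ _ _ _ _ c6
  simp only [chkAB, Bool.and_eq_true, Nat.ble_eq, Nat.beq_eq] at c6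
  obtain ⟨d1, d2, d3, d4, d5⟩ := c6
  obtain ⟨b1, b2⟩ := F.chkTh_imp tl tu c1
  have tl0n : 0 < tl := by have := WW_posn; omega
  have tl0 : (0:ℝ) < tl := by exact_mod_cast tl0n
  have tu0 : (0:ℝ) < tu := by linarith
  have tu0n : 0 < tu := by exact_mod_cast tu0
  have hθ0 : 0 < F.θ := by linarith
  have hM : (0:ℝ) < 2 ^ m := by positivity
  have c2' := (Nat.cast_le (α := ℝ)).2 c2
  push_cast at c2'
  have c2u : 2 ^ m * WW ≤ tu := by
    have : (2:ℝ) ^ m * WW ≤ tu := by linarith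
    exact_mod_cast this
  have hMθ : 2 ^ m ≤ F.θ := by
    have : (2:ℝ) ^ m * WW ≤ F.θ * WW := by linarith
    exact le_of_mul_le_mul_right this hW
  -- x bounds
  have x1 : ((WW * WW / tu : ℕ):ℝ) ≤ WW * (1 / F.θ) := by
    refine (dv_le _ _ tu0n).trans ?_
    rw [mul_one_div]
    apply dv_mono _ _ _ _ tu0 hθ0
    push_cast
    rw [mul_assoc]
    exact mul_le_mul_of_nonneg_left b2 hW.le
  have x2 : WW * (1 / F.θ) ≤ ((WW * WW / tl + 1 : ℕ):ℝ) := by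
    refine le_trans ?_ (le_dv _ _ tl0n)
    rw [mul_one_div]
    apply dv_mono _ _ _ _ hθ0 tl0
    push_cast
    rw [mul_assoc]
    exact mul_le_mul_of_nonneg_left b1 hW.le
  have y1 : (((tl - 2 ^ m * WW) * WW / (tl + 2 ^ m * WW) : ℕ):ℝ) ≤ WW * ((F.θ - 2 ^ m) / (F.θ + 2 ^ m)) := by
    refine (dv_le _ _ (by omega)).trans ?_
    rw [← mul_div_assoc]
    apply dv_mono
    · positivity
    · positivity
    · push_cast [Nat.cast_sub c2]
      have k := mul_le_mul_of_nonneg_left b1 (by positivity : (0:ℝ) ≤ 2 * 2 ^ m * WW)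
      linarith
  have y2 : WW * ((F.θ - 2 ^ m) / (F.θ + 2 ^ m)) ≤ (((tu - 2 ^ m * WW) * WW / (tu + 2 ^ m * WW) + 1 : ℕ):ℝ) := by
    refine le_trans ?_ (le_dv _ _ (by omega))
    rw [← mul_div_assoc]
    apply dv_mono
    · positivity
    · positivity
    · push_cast [Nat.cast_sub c2u]
      have k := mul_le_mul_of_nonneg_left b2 (by positivity : (0:ℝ) ≤ 2 * 2 ^ m * WW)
      linarith
  have hx0 : 0 ≤ 1 / F.θ := by positivity
  have hy0 : 0 ≤ (F.θ - 2 ^ m) / (F.θ + 2 ^ m) := div_nonneg (by linarith) (by linarith)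
  have half : ∀ (X : ℕ) (x : ℝ), X * 2 ≤ WW → WW * x ≤ X → x ≤ 1 / 2 := by
    intro X x h1 h2
    have h1' := (Nat.cast_le (α := ℝ)).2 h1
    push_cast at h1'
    have : WW * x ≤ WW * (1/2) := by linarith
    exact le_of_mul_le_mul_left this hW
  have hx1 := half _ _ c4 x2
  have hy1 := half _ _ c5 y2
  have ba := aLo_le _ _ x1 hx0 (by linarith)
  have bb := aUp_ge _ _ x2 hx0 hx1
  have bc := aLo_le _ _ y1 hy0 (by linarith)
  have bd := aUp_ge _ _ y2 hy0 hy1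
  rw [← F.S_eq] at ba bb
  obtain ⟨l1, l2⟩ := log2_bd
  have hT := F.T_eq m
  have m0 : (0:ℝ) ≤ m := Nat.cast_nonneg _
  generalize aLo (WW * WW / tu) = a at *
  generalize aUp (WW * WW / tl + 1) = b at *
  generalize aLo ((tl - 2 ^ m * WW) * WW / (tl + 2 ^ m * WW)) = e at *
  generalize aUp ((tu - 2 ^ m * WW) * WW / (tu + 2 ^ m * WW) + 1) = f at *
  generalize Real.log ((1 + (F.θ - 2 ^ m) / (F.θ + 2 ^ m)) / (1 - (F.θ - 2 ^ m) / (F.θ + 2 ^ m))) = L at *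
  have t1 : ((m * L2l + 2 * e : ℕ):ℝ) ≤ WW * F.T := by
    push_cast
    have := mul_le_mul_of_nonneg_left l1 m0
    rw [hT]; linarith
  have t2 : WW * F.T ≤ ((m * L2u + 2 * f : ℕ):ℝ) := by
    push_cast
    have := mul_le_mul_of_nonneg_left l2 m0
    rw [hT]; linarith
  have ba' : ((2 * a : ℕ):ℝ) ≤ WW * -F.S := by push_cast; exact ba
  have bb' : WW * -F.S ≤ ((2 * b : ℕ):ℝ) := by push_cast; exact bb
  generalize m * L2l + 2 * e = Tl at *
  generalize m * L2u + 2 * f = Tu at *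
  generalize 2 * a = a' at *
  generalize 2 * b = b' at *
  have d4' := (Nat.cast_le (α := ℝ)).2 d4
  have d5' := (Nat.cast_le (α := ℝ)).2 d5
  push_cast at d4' d5'
  have A0 : (0:ℝ) ≤ A := Nat.cast_nonneg _
  have B0 : (0:ℝ) ≤ B := Nat.cast_nonneg _
  refine ⟨A, B, d1, d2, d3, ?_⟩
  rw [← abs_of_pos (by norm_num : (0:ℝ) < 2 * 10 ^ 30), ← abs_mul, abs_le]
  have q1 := mul_le_mul_of_nonneg_left bb' (mul_nonneg (by norm_num : (0:ℝ) ≤ 2 * 10 ^ 30) A0)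
  have q2 := mul_le_mul_of_nonneg_left ba' (mul_nonneg (by norm_num : (0:ℝ) ≤ 2 * 10 ^ 30) A0)
  have q3 := mul_le_mul_of_nonneg_left t1 (mul_nonneg (by norm_num : (0:ℝ) ≤ 2 * 10 ^ 30) B0)
  have q4 := mul_le_mul_of_nonneg_left t2 (mul_nonneg (by norm_num : (0:ℝ) ≤ 2 * 10 ^ 30) B0)
  constructor
  · apply le_of_mul_le_mul_left _ hW
    linarith
  · apply le_of_mul_le_mul_left _ hW
    linarith

end Fld

end


noncomputable def nonsq (u : ℕ) : Bool :=
  frc (nwt u 12 (2 ^ (Nat.log2 u / 2 + 1))) fun r => Nat.blt (r * r) u && Nat.blt u ((r + 1) * (r + 1))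

lemma nonsq_imp (u : ℕ) (h : nonsq u = true) (x : ℤ) : (u:ℤ) ≠ x ^ 2 := by
  simp only [nonsq, frc_eq] at h
  generalize nwt u 12 (2 ^ (Nat.log2 u / 2 + 1)) = r at h
  simp only [Bool.and_eq_true, Nat.blt_eq] at h
  obtain ⟨h1, h2⟩ := h
  intro e
  rw [← Int.natAbs_sq] at e
  have e' : u = x.natAbs ^ 2 := by exact_mod_cast e
  generalize x.natAbs = y at e'
  subst e'
  have a1 : r < y := by nlinarith
  have a2 : y < r + 1 := by nlinarith
  omega

noncomputable def sqk (t fuel : ℕ) : ℕ → ℕ → Bool :=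
  Nat.rec (motive := fun _ => ℕ → ℕ → Bool) (fun _ _ => false)
    (fun _ ih u v => Bool.rec
      ((Bool.rec (Nat.beq t 2 && Nat.beq u 169) true (nonsq u)) &&
        frc (t * v + u) fun u' => frc (t * u' + v) fun v' => ih u' v')
      true (Nat.ble (10 ^ 68) u)) fuel

noncomputable def sqAll (n : ℕ) : Bool :=
  Nat.rec true (fun k ih => sqk (2 * (k + 1)) 100 ((2 * (k + 1)) * (2 * (k + 1)) + 1) ((2 * (k + 1)) * ((2 * (k + 1)) * (2 * (k + 1)) + 1) + (2 * (k + 1))) && ih) n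

lemma sqAll_199 : sqAll 199 = true := by decide +kernel

lemma sqAll_imp (n : ℕ) (h : sqAll n = true) : ∀ s, 1 ≤ s → s ≤ n →
    sqk (2 * s) 100 ((2 * s) * (2 * s) + 1) ((2 * s) * ((2 * s) * (2 * s) + 1) + (2 * s)) = true := by
  induction n with
  | zero => intro s h1 h2; omega
  | succ n ih =>
    intro s h1 h2
    have h' : (_ && sqAll n) = true := h
    rw [Bool.and_eq_true] at h'
    rcases Nat.lt_or_ge s (n+1) with h3 | h3
    · exact ih h'.2 s h1 (by omega)
    · rw [show s = n + 1 by omega]; exact h'.1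

lemma LU_nn (t : ℤ) (ht : 1 ≤ t) (n : ℕ) : 0 ≤ LU t n ∧ 1 ≤ LU t (n + 1) := by
  induction n with
  | zero => simp [LU]
  | succ n ih =>
    refine ⟨by linarith [ih.2], ?_⟩
    rw [LU_succ]
    nlinarith [ih.1, ih.2]

lemma LU_lt2 (t : ℤ) (ht : 1 ≤ t) (n : ℕ) : LU t n < LU t (n + 2) := by
  rw [LU_succ]
  nlinarith [(LU_nn t ht n).2]

lemma LU_lt (t : ℤ) (ht : 1 ≤ t) (n k : ℕ) : LU t n ≤ LU t (n + 2 * k) ∧ (0 < k → LU t n < LU t (n + 2 * k)) := by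
  induction k with
  | zero => simp
  | succ k ih =>
    have := LU_lt2 t ht (n + 2 * k)
    rw [show n + 2 * (k + 1) = n + 2 * k + 2 by ring]
    exact ⟨by linarith [ih.1], fun _ => by linarith [ih.1]⟩

lemma LU_inj (t : ℤ) (ht : 1 ≤ t) (m n : ℕ) (hm : m % 2 = 1) (hn : n % 2 = 1) (h : LU t m = LU t n) : m = n := by
  rcases lt_trichotomy m n with h1 | h1 | h1
  · have := (LU_lt t ht m ((n - m) / 2)).2 (by omega)
    rw [show m + 2 * ((n - m) / 2) = n by omega] at this
    omega
  · exact h1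
  · have := (LU_lt t ht n ((m - n) / 2)).2 (by omega)
    rw [show n + 2 * ((m - n) / 2) = m by omega] at this
    omega

lemma sqk_imp (t : ℕ) (ht : 1 ≤ t) (f : ℕ) : ∀ (n u v : ℕ), sqk t f u v = true → (u:ℤ) = LU t n → (v:ℤ) = LU t (n + 1) →
    ∀ k, LU t (n + 2 * k) < 10 ^ 68 → ∀ x, LU t (n + 2 * k) = x ^ 2 → t = 2 ∧ LU t (n + 2 * k) = 169 := by
  induction f with
  | zero => intro n u v h; exact absurd (show false = true from h) Bool.false_ne_true
  | succ f ih =>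
    intro n u v h hu hv k hk x hx
    have ht' : (1:ℤ) ≤ (t:ℤ) := by exact_mod_cast ht
    change (Bool.rec _ _ _ : Bool) = true at h
    cases hb : Nat.ble (10 ^ 68) u with
    | true =>
      have h1 := Nat.le_of_ble_eq_true hb
      have h2 := (LU_lt t ht' n k).1
      have h3 : ((10 ^ 68 : ℕ) : ℤ) ≤ u := by exact_mod_cast h1
      push_cast at h3
      linarith
    | false =>
      rw [hb] at h
      replace h := (Bool.and_eq_true _ _).mp h
      obtain ⟨h1, h2⟩ := h
      rw [frc_eq, frc_eq] at h2
      cases k with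
      | zero =>
        simp only [mul_zero, add_zero] at hk hx ⊢
        cases hc : nonsq u with
        | true =>
          exact absurd (hu.trans hx) (nonsq_imp u hc x)
        | false =>
          rw [hc] at h1
          have h1' : (Nat.beq t 2 && Nat.beq u 169) = true := h1
          simp only [Bool.and_eq_true, Nat.beq_eq] at h1'
          refine ⟨h1'.1, ?_⟩
          rw [← hu, h1'.2]; rfl
      | succ k =>
        rw [show n + 2 * (k + 1) = n + 2 + 2 * k by ring] at *
        have e1 : ((t * v + u : ℕ):ℤ) = LU t (n + 2) := by push_cast; rw [LU_succ, hu, hv]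
        refine ih (n + 2) _ _ h2 e1 ?_ k hk x hx
        rw [Nat.cast_add, Nat.cast_mul, e1, hv]
        rfl

lemma small_n (s : ℕ) (h1 : 1 ≤ s) (h2 : s ≤ 199) (n : ℕ) (hn : n % 2 = 1) (x : ℤ) (hx : LU (2 * s) n = x ^ 2)
    (hl : LU (2 * s) n < 10 ^ 68) : n = 1 ∨ (s = 1 ∧ n = 7) := by
  by_contra hc
  push Not at hc
  have hk := sqk_imp (2 * s) (by omega) 100 3 _ _ (sqAll_imp 199 sqAll_199 s h1 h2)
    (by push_cast; simp [LU]) (by push_cast; simp [LU]) ((n - 3) / 2)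
  rw [show 3 + 2 * ((n - 3) / 2) = n by omega] at hk
  push_cast at hk
  obtain ⟨k1, k2⟩ := hk hl x hx
  have k3 : s = 1 := by omega
  subst k3
  have e : LU (2 * (1:ℕ)) 7 = 169 := by norm_num [LU]
  push_cast at e k2
  exact hc.2 rfl (LU_inj _ (by norm_num) n 7 hn (by norm_num) (k2.trans e.symm))

lemma exists_fld (s : ℕ) (hs : 1 ≤ s) : ∃ F : Fld, F.s = s := by
  have hs' : (1:ℝ) ≤ s := by exact_mod_cast hs
  have e1 : √((s:ℝ) * s + 1) * √((s:ℝ) * s + 1) = s * s + 1 := Real.mul_self_sqrt (by positivity)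
  have p1 : 1.4 ≤ √((s:ℝ) * s + 1) := Real.le_sqrt_of_sq_le (by nlinarith)
  generalize √((s:ℝ) * s + 1) = w at *
  have e2 : √((s + w) * (s + w) + 1) * √((s + w) * (s + w) + 1) = (s + w) * (s + w) + 1 := Real.mul_self_sqrt (by positivity)
  have p2 : 2.6 ≤ √((s + w) * (s + w) + 1) := Real.le_sqrt_of_sq_le (by nlinarith)
  generalize √((s + w) * (s + w) + 1) = z at *
  have p3 : 5 ≤ s + w + z := by linarith
  refine ⟨⟨s, hs, w, s + w + z, (s + w + z - 1) / (s + w + z + 1), e1, by linarith, by linear_combination e2, p3, ?_⟩, rfl⟩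
  exact div_mul_cancel₀ _ (by linarith)

lemma sq_even (s : ℕ) (hs : 1 ≤ s) (n : ℕ) (hn : n % 2 = 1) (x : ℤ) (hx : LU (2 * s) n = x ^ 2) :
    n = 1 ∨ (s = 1 ∧ n = 7) := by
  obtain ⟨a, b, hq, hU⟩ := M2_main s n hn x hx
  rcases Nat.lt_or_ge s 200 with h | h
  · obtain ⟨F, hF⟩ := exists_fld s hs
    have hF' : F.s ≤ 199 := by omega
    have := F.U_lt hF' (F.cert hF') a b (by rw [hF]; exact hq)
    refine small_n s hs (by omega) n hn x hx ?_
    rw [← hU]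
    have h0 : 0 ≤ a ^ 2 + b ^ 2 := by positivity
    calc (a ^ 2 + b ^ 2) ^ 2 < (10 ^ 34) ^ 2 := pow_lt_pow_left₀ this h0 (by norm_num)
      _ = _ := by norm_num
  · left
    have h0 := M3_main s h a b hq
    have h1 : (a ^ 2 + b ^ 2) ^ 2 = 1 := by
      rw [← hq, QF]
      linear_combination (8 * a * b + 4 * s * (a ^ 2 - b ^ 2)) * h0
    rw [h1] at hU
    exact LU_inj (2 * s) (by omega) n 1 hn (by norm_num) hU.symm

theorem stmt_15 (t : ℤ) (ht : 1 ≤ t) (u : ℕ → ℤ)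
    (hu0 : u 0 = 0) (hu1 : u 1 = 1) (hu : ∀ n, u (n + 2) = t * u (n + 1) + u n) :
    (t ≠ 2 → ∀ j : ℕ, Odd j → 1 ≤ j → (∃ x : ℤ, u j = x ^ 2) → j = 1) ∧
    (t = 2 → ∀ j : ℕ, Odd j → 1 ≤ j →
      ((∃ x : ℤ, u j = x ^ 2) ↔ (j = 1 ∨ j = 7))) := by
  have hU := LU_unique t u hu0 hu1 hu
  have key : ∀ j : ℕ, Odd j → (∃ x : ℤ, u j = x ^ 2) → j = 1 ∨ (t = 2 ∧ j = 7) := by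
    rintro j hj ⟨x, hx⟩
    rw [hU] at hx
    have hj' := Nat.odd_iff.1 hj
    rcases Int.emod_two_eq_zero_or_one t with h | h
    · obtain ⟨s, rfl⟩ : ∃ s : ℕ, t = 2 * s := ⟨(t / 2).toNat, by omega⟩
      rcases sq_even s (by omega) j hj' x hx with h1 | ⟨h1, h2⟩
      · exact Or.inl h1
      · exact Or.inr ⟨by subst h1; norm_num, h2⟩
    · exact Or.inl (M1_main t ht h j hj' x hx)
  refine ⟨fun h2 j hj _ hx => ?_, fun h2 j hj _ => ⟨fun hx => ?_, ?_⟩⟩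
  · rcases key j hj hx with h | h
    · exact h
    · exact absurd h.1 h2
  · rcases key j hj hx with h | h
    · exact Or.inl h
    · exact Or.inr h.2
  · rintro (rfl | rfl)
    · exact ⟨1, by rw [hu1]; norm_num⟩
    · refine ⟨13, ?_⟩
      rw [hU, h2]
      norm_num [LU]
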